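/- arXiv:1206.2629 — 10 statements merged into one kernel-verified Lean document; each statement's English description precedes it below -/
import Mathlib

section
/- Let Ω ⊂ ℝ^N be a bounded open set, let λ, γ > 0, and let f, g : ℝ → ℝ be C² functions with f' ≥ 0 and g' ≥ 0 everywhere. Let u, v : ℝ^N → ℝ be continuous on the closure of Ω. Suppose there exist C² functions ζ, χ on Ω with ζ > 0 and χ > 0 on Ω such that in Ω: −Δζ ≥ λ f''(u) g(v) ζ + λ f'(u) g'(v) χ and −Δχ ≥ γ f'(u) g'(v) ζ + γ f(u) g''(v) χ. Then for every pair of smooth compactly supported functions φ, ψ : Ω → ℝ one has ∫_Ω f''(u) g(v) φ² + ∫_Ω f(u) g''(v) ψ² + 2 ∫_Ω f'(u) g'(v) φ ψ ≤ (1/λ) ∫_Ω |∇φ|² + (1/γ) ∫_Ω |∇ψ|². -/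
open MeasureTheory Real Set Filter Topology

/-- The Euclidean Laplacian: the trace of the second derivative. -/
noncomputable def lapl {N : ℕ} (f : EuclideanSpace ℝ (Fin N) → ℝ)
    (x : EuclideanSpace ℝ (Fin N)) : ℝ :=
  ∑ i : Fin N, iteratedFDeriv ℝ 2 f x ![EuclideanSpace.single i 1, EuclideanSpace.single i 1]

/-- The derivative of a compactly supported `C¹` function has zero integral. -/
theorem integral_fderiv_apply_eq_zero {N : ℕ} {F : EuclideanSpace ℝ (Fin N) → ℝ}
    (hF : ContDiff ℝ 1 F) (hc : HasCompactSupport F) (w : EuclideanSpace ℝ (Fin N)) :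
    Integrable (fun x => fderiv ℝ F x w) ∧ ∫ x, fderiv ℝ F x w = 0 := by
  have hi : Integrable (fun x => fderiv ℝ F x w) :=
    ((hF.continuous_fderiv one_ne_zero).clm_apply continuous_const).integrable_of_hasCompactSupport
      (hc.fderiv_apply ℝ w)
  refine ⟨hi, ?_⟩
  have h := integral_mul_fderiv_eq_neg_fderiv_mul_of_integrable
    (μ := (volume : Measure (EuclideanSpace ℝ (Fin N)))) (𝕜 := ℝ)
    (f := fun _ => (1 : ℝ)) (g := F) (v := w) (by simp) (by simpa using hi)
    (by simpa using hF.continuous.integrable_of_hasCompactSupport hc)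
    (fun x _ => differentiableAt_const _) (fun x _ => hF.differentiable one_ne_zero x)
  simpa using h

/-- A function continuous on an open set times a test function supported there is integrable. -/
theorem ContinuousOn.integrable_mul_of_tsupport_subset {N : ℕ} {Ω : Set (EuclideanSpace ℝ (Fin N))}
    (hΩ : IsOpen Ω) {h η : EuclideanSpace ℝ (Fin N) → ℝ} (hh : ContinuousOn h Ω)
    (hη : Continuous η) (hc : HasCompactSupport η) (hs : tsupport η ⊆ Ω) :
    Integrable (fun x => h x * η x) := by
  have hcont : Continuous (fun x => h x * η x) :=
    continuous_of_tsupport fun x hx =>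
      (hh.continuousAt (hΩ.mem_nhds (hs (tsupport_mul_subset_right hx)))).mul hη.continuousAt
  exact hcont.integrable_of_hasCompactSupport hc.mul_left

theorem norm_gradient_sq_eq_sum {N : ℕ} (φ : EuclideanSpace ℝ (Fin N) → ℝ)
    (x : EuclideanSpace ℝ (Fin N)) :
    ‖gradient φ x‖ ^ 2 = ∑ i, fderiv ℝ φ x (EuclideanSpace.single i 1) ^ 2 := by
  rw [EuclideanSpace.norm_sq_eq]
  refine Finset.sum_congr rfl fun i _ => ?_
  have h : fderiv ℝ φ x (EuclideanSpace.single i 1) =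
      inner ℝ (gradient φ x) (EuclideanSpace.single i 1) := by
    rw [gradient, InnerProductSpace.toDual_symm_apply]
  rw [h, EuclideanSpace.inner_single_right]
  simp

/-- Picone's inequality: for `ζ > 0`, the function `-Δζ φ² / ζ` is at most `|∇φ|²` up to
subtracting a divergence, namely that of `(φ² / ζ) ∇ζ`. -/
theorem exists_divergence_picone_le {N : ℕ} {Ω : Set (EuclideanSpace ℝ (Fin N))} (hΩ : IsOpen Ω)
    {ζ φ : EuclideanSpace ℝ (Fin N) → ℝ} (hζ : ContDiffOn ℝ 2 ζ Ω) (hpos : ∀ x ∈ Ω, 0 < ζ x)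
    (hφ : ContDiff ℝ (⊤ : ℕ∞) φ) (hc : HasCompactSupport φ) (hs : tsupport φ ⊆ Ω) :
    ∃ D : EuclideanSpace ℝ (Fin N) → ℝ, Integrable D ∧ ∫ x in Ω, D x = 0 ∧
      ∀ x ∈ Ω, -lapl ζ x * (φ x ^ 2 / ζ x) + D x ≤ ‖gradient φ x‖ ^ 2 := by
  let e : Fin N → EuclideanSpace ℝ (Fin N) := fun i => EuclideanSpace.single i 1
  let F : Fin N → EuclideanSpace ℝ (Fin N) → ℝ :=
    fun i x => φ x * (φ x * ((ζ x)⁻¹ * fderiv ℝ ζ x (e i)))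
  have hζat : ∀ x ∈ Ω, ContDiffAt ℝ 2 ζ x := fun x hx => hζ.contDiffAt (hΩ.mem_nhds hx)
  have hζ' : ∀ x ∈ Ω, ContDiffAt ℝ 1 (fderiv ℝ ζ) x := fun x hx =>
    (hζat x hx).fderiv_right (by norm_num)
  have hφ1 : ContDiff ℝ 1 φ := hφ.of_le (by exact_mod_cast le_top)
  have hFs : ∀ i, tsupport (F i) ⊆ tsupport φ := fun i => tsupport_mul_subset_left
  have hF : ∀ i, ContDiff ℝ 1 (F i) := fun i => contDiff_iff_contDiffAt.2 fun x => by
    by_cases hx : x ∈ tsupport (F i)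
    · have hx' : x ∈ Ω := hs (hFs i hx)
      exact hφ1.contDiffAt.mul (hφ1.contDiffAt.mul ((((hζat x hx').of_le (by norm_num)).inv
        (hpos x hx').ne').mul ((hζ' x hx').clm_apply contDiffAt_const)))
    · exact (contDiffAt_const (c := (0 : ℝ))).congr_of_eventuallyEq
        (notMem_tsupport_iff_eventuallyEq.1 hx)
  have hFc : ∀ i, HasCompactSupport (F i) := fun i => hc.mul_right
  have hint := fun i => integral_fderiv_apply_eq_zero (hF i) (hFc i) (e i)
  refine ⟨fun x => ∑ i, fderiv ℝ (F i) x (e i), integrable_finsetSum _ fun i _ => (hint i).1, ?_, ?_⟩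
  · rw [setIntegral_eq_integral_of_forall_compl_eq_zero, integral_finsetSum _ fun i _ => (hint i).1]
    · exact Finset.sum_eq_zero fun i _ => (hint i).2
    · intro x hx
      refine Finset.sum_eq_zero fun i _ => ?_
      have : fderiv ℝ (F i) x = 0 :=
        image_eq_zero_of_notMem_tsupport fun h =>
          hx (hs (hFs i (tsupport_fderiv_subset ℝ h)))
      simp [this]
  · intro x hx
    have hz := hpos x hx
    rw [norm_gradient_sq_eq_sum, lapl, ← Finset.sum_neg_distrib, Finset.sum_mul,
      ← Finset.sum_add_distrib]
    refine Finset.sum_le_sum fun i _ => ?_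
    have hdφ : HasFDerivAt φ (fderiv ℝ φ x) x :=
      (hφ1.differentiable one_ne_zero x).hasFDerivAt
    have hdζ : HasFDerivAt ζ (fderiv ℝ ζ x) x :=
      ((hζat x hx).differentiableAt two_ne_zero).hasFDerivAt
    have hdζ' : HasFDerivAt (fun y => fderiv ℝ ζ y (e i))
        ((ContinuousLinearMap.apply ℝ ℝ (e i)).comp (fderiv ℝ (fderiv ℝ ζ) x)) x :=
      (ContinuousLinearMap.apply ℝ ℝ (e i)).hasFDerivAt.comp x
        ((hζ' x hx).differentiableAt one_ne_zero).hasFDerivAt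
    have hdF : fderiv ℝ (F i) x (e i) =
        φ x ^ 2 / ζ x * fderiv ℝ (fderiv ℝ ζ) x (e i) (e i)
        + 2 * φ x * fderiv ℝ φ x (e i) * fderiv ℝ ζ x (e i) / ζ x
        - φ x ^ 2 * fderiv ℝ ζ x (e i) ^ 2 / ζ x ^ 2 := by
      have hdF' : HasFDerivAt (F i) _ x := hdφ.mul (hdφ.mul
        (((hasDerivAt_inv hz.ne').comp_hasFDerivAt x hdζ).mul hdζ'))
      rw [hdF'.fderiv]
      simp
      field_simp
      ring
    rw [iteratedFDeriv_two_apply, hdF]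
    have := sq_nonneg (fderiv ℝ φ x (e i) - φ x * fderiv ℝ ζ x (e i) / ζ x)
    simp only [Matrix.cons_val_zero, Matrix.cons_val_one]
    change -(fderiv ℝ (fderiv ℝ ζ) x (e i) (e i)) * _ + _ ≤ fderiv ℝ φ x (e i) ^ 2
    linear_combination this

/-- Stability inequality for semi-stable solutions of the gradient system `(G)_{λ,γ}`. -/
theorem stmt_0 {N : ℕ} (Ω : Set (EuclideanSpace ℝ (Fin N)))
    (hΩo : IsOpen Ω) (hΩb : Bornology.IsBounded Ω)
    (lam gam : ℝ) (hlam : 0 < lam) (hgam : 0 < gam)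
    (f g : ℝ → ℝ) (hf : ContDiff ℝ 2 f) (hg : ContDiff ℝ 2 g)
    (hf' : ∀ s : ℝ, 0 ≤ deriv f s) (hg' : ∀ s : ℝ, 0 ≤ deriv g s)
    (u v : EuclideanSpace ℝ (Fin N) → ℝ)
    (hu : ContinuousOn u (closure Ω)) (hv : ContinuousOn v (closure Ω))
    (ζ χ : EuclideanSpace ℝ (Fin N) → ℝ)
    (hζ : ContDiffOn ℝ 2 ζ Ω) (hχ : ContDiffOn ℝ 2 χ Ω)
    (hζpos : ∀ x ∈ Ω, 0 < ζ x) (hχpos : ∀ x ∈ Ω, 0 < χ x)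
    (hstab1 : ∀ x ∈ Ω,
      lam * deriv (deriv f) (u x) * g (v x) * ζ x
        + lam * deriv f (u x) * deriv g (v x) * χ x ≤ - lapl ζ x)
    (hstab2 : ∀ x ∈ Ω,
      gam * deriv f (u x) * deriv g (v x) * ζ x
        + gam * f (u x) * deriv (deriv g) (v x) * χ x ≤ - lapl χ x)
    (φ ψ : EuclideanSpace ℝ (Fin N) → ℝ)
    (hφ : ContDiff ℝ (⊤ : ℕ∞) φ) (hψ : ContDiff ℝ (⊤ : ℕ∞) ψ)
    (hφc : HasCompactSupport φ) (hψc : HasCompactSupport ψ)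
    (hφΩ : tsupport φ ⊆ Ω) (hψΩ : tsupport ψ ⊆ Ω) :
    (∫ x in Ω, deriv (deriv f) (u x) * g (v x) * φ x ^ 2)
      + (∫ x in Ω, f (u x) * deriv (deriv g) (v x) * ψ x ^ 2)
      + 2 * ∫ x in Ω, deriv f (u x) * deriv g (v x) * φ x * ψ x
    ≤ (1 / lam) * (∫ x in Ω, ‖gradient φ x‖ ^ 2)
      + (1 / gam) * ∫ x in Ω, ‖gradient ψ x‖ ^ 2 := by
  obtain ⟨D₁, hD₁, hD₁0, hP₁⟩ := exists_divergence_picone_le hΩo hζ hζpos hφ hφc hφΩ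
  obtain ⟨D₂, hD₂, hD₂0, hP₂⟩ := exists_divergence_picone_le hΩo hχ hχpos hψ hψc hψΩ
  have huo : ContinuousOn u Ω := hu.mono subset_closure
  have hvo : ContinuousOn v Ω := hv.mono subset_closure
  have hf1 : ContDiff ℝ 1 (deriv f) := ContDiff.deriv' (by simpa [one_add_one_eq_two] using hf)
  have hg1 : ContDiff ℝ 1 (deriv g) := ContDiff.deriv' (by simpa [one_add_one_eq_two] using hg)
  have hf2 : Continuous (deriv (deriv f)) := hf1.continuous_deriv le_rfl
  have hg2 : Continuous (deriv (deriv g)) := hg1.continuous_deriv le_rfl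
  have hsq : ∀ η : EuclideanSpace ℝ (Fin N) → ℝ, tsupport (fun x => η x ^ 2) ⊆ tsupport η :=
    fun η => closure_mono fun x hx h => hx (by simp [h])
  have hA : Integrable fun x => deriv (deriv f) (u x) * g (v x) * φ x ^ 2 :=
    ContinuousOn.integrable_mul_of_tsupport_subset hΩo
      ((hf2.comp_continuousOn huo).mul (hg.continuous.comp_continuousOn hvo))
      (hφ.continuous.pow 2) (hφc.mono' ((subset_tsupport _).trans (hsq φ))) ((hsq φ).trans hφΩ)
  have hB : Integrable fun x => f (u x) * deriv (deriv g) (v x) * ψ x ^ 2 :=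
    ContinuousOn.integrable_mul_of_tsupport_subset hΩo
      ((hf.continuous.comp_continuousOn huo).mul (hg2.comp_continuousOn hvo))
      (hψ.continuous.pow 2) (hψc.mono' ((subset_tsupport _).trans (hsq ψ))) ((hsq ψ).trans hψΩ)
  have hC : Integrable fun x => deriv f (u x) * deriv g (v x) * φ x * ψ x :=
    ContinuousOn.integrable_mul_of_tsupport_subset hΩo
      (((hf1.continuous.comp_continuousOn huo).mul (hg1.continuous.comp_continuousOn hvo)).mul
        hφ.continuous.continuousOn) hψ.continuous hψc hψΩ
  have hG : ∀ η : EuclideanSpace ℝ (Fin N) → ℝ, ContDiff ℝ (⊤ : ℕ∞) η → HasCompactSupport η →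
      Integrable fun x => ‖gradient η x‖ ^ 2 := by
    intro η hη hηc
    simp_rw [norm_gradient_sq_eq_sum]
    refine integrable_finsetSum _ fun i _ => ?_
    have hcont : Continuous fun x => fderiv ℝ η x (EuclideanSpace.single i 1) :=
      (hη.continuous_fderiv (by simp)).clm_apply continuous_const
    exact (hcont.pow 2).integrable_of_hasCompactSupport
      ((hηc.fderiv_apply ℝ _).mono' ((subset_tsupport _).trans (hsq _)))
  have hG₁ := hG φ hφ hφc
  have hG₂ := hG ψ hψ hψc
  have key : ∀ x ∈ Ω, deriv (deriv f) (u x) * g (v x) * φ x ^ 2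
      + f (u x) * deriv (deriv g) (v x) * ψ x ^ 2
      + 2 * (deriv f (u x) * deriv g (v x) * φ x * ψ x)
      ≤ (1 / lam) * (‖gradient φ x‖ ^ 2 - D₁ x) + (1 / gam) * (‖gradient ψ x‖ ^ 2 - D₂ x) := by
    intro x hx
    have hz := hζpos x hx
    have hw := hχpos x hx
    have h₁ : deriv (deriv f) (u x) * g (v x) * φ x ^ 2
        + deriv f (u x) * deriv g (v x) * (χ x / ζ x * φ x ^ 2)
        ≤ (1 / lam) * (‖gradient φ x‖ ^ 2 - D₁ x) := by
      have hm := mul_le_mul_of_nonneg_right (hstab1 x hx)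
        (div_nonneg (sq_nonneg (φ x)) hz.le)
      rw [one_div, le_inv_mul_iff₀ hlam]
      refine le_trans (le_of_eq ?_) (hm.trans (le_sub_iff_add_le.2 (hP₁ x hx)))
      field_simp
    have h₂ : f (u x) * deriv (deriv g) (v x) * ψ x ^ 2
        + deriv f (u x) * deriv g (v x) * (ζ x / χ x * ψ x ^ 2)
        ≤ (1 / gam) * (‖gradient ψ x‖ ^ 2 - D₂ x) := by
      have hm := mul_le_mul_of_nonneg_right (hstab2 x hx)
        (div_nonneg (sq_nonneg (ψ x)) hw.le)
      rw [one_div, le_inv_mul_iff₀ hgam]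
      refine le_trans (le_of_eq ?_) (hm.trans (le_sub_iff_add_le.2 (hP₂ x hx)))
      field_simp
      ring
    have h₃ : 2 * (φ x * ψ x) ≤ χ x / ζ x * φ x ^ 2 + ζ x / χ x * ψ x ^ 2 := by
      have h := div_nonneg (sq_nonneg (χ x * φ x - ζ x * ψ x)) (mul_pos hz hw).le
      have he : (χ x * φ x - ζ x * ψ x) ^ 2 / (ζ x * χ x)
          = χ x / ζ x * φ x ^ 2 + ζ x / χ x * ψ x ^ 2 - 2 * (φ x * ψ x) := by
        field_simp
        ring
      linarith
    have h₄ := mul_le_mul_of_nonneg_left h₃ (mul_nonneg (hf' (u x)) (hg' (v x)))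
    linarith
  have hAB : Integrable fun x => deriv (deriv f) (u x) * g (v x) * φ x ^ 2
      + f (u x) * deriv (deriv g) (v x) * ψ x ^ 2 := hA.add hB
  have hGD₁ : Integrable fun x => (1 / lam) * (‖gradient φ x‖ ^ 2 - D₁ x) :=
    (hG₁.sub hD₁).const_mul _
  have hGD₂ : Integrable fun x => (1 / gam) * (‖gradient ψ x‖ ^ 2 - D₂ x) :=
    (hG₂.sub hD₂).const_mul _
  have hmono := setIntegral_mono_on (hAB.add (hC.const_mul 2)).integrableOn
    (hGD₁.add hGD₂).integrableOn hΩo.measurableSet key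
  simp only [Pi.add_apply] at hmono
  rw [integral_add hAB.integrableOn (hC.const_mul 2).integrableOn,
    integral_add hA.integrableOn hB.integrableOn,
    integral_add hGD₁.integrableOn hGD₂.integrableOn,
    integral_const_mul, integral_const_mul, integral_const_mul,
    integral_sub hG₁.integrableOn hD₁.integrableOn, integral_sub hG₂.integrableOn hD₂.integrableOn,
    hD₁0, hD₂0, sub_zero, sub_zero] at hmono
  exact hmono
end

section
/- Let Ω ⊂ ℝ^N be an open set and let E : Ω → ℝ be a C² function with E > 0 on Ω. Then for every smooth compactly supported function φ : Ω → ℝ one has ∫_Ω (−ΔE(x)/E(x)) φ(x)² dx ≤ ∫_Ω |∇φ(x)|² dx. -/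
open MeasureTheory Real Set Filter Topology

/-- The integral of a directional derivative of a compactly supported `C¹` function vanishes. -/
theorem integral_fderiv_apply_eq_zero_s2 {F : Type*} [NormedAddCommGroup F] [NormedSpace ℝ F]
    [FiniteDimensional ℝ F] [MeasurableSpace F] [BorelSpace F] {μ : Measure F} [μ.IsAddHaarMeasure]
    {g : F → ℝ} (hg : ContDiff ℝ 1 g) (hgc : HasCompactSupport g) (v : F) :
    ∫ x, fderiv ℝ g x v ∂μ = 0 := by
  have hg' : Integrable (fun x => fderiv ℝ g x v) μ :=
    ((hg.continuous_fderiv one_ne_zero).clm_apply continuous_const).integrable_of_hasCompactSupport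
      (hgc.fderiv_apply ℝ v)
  have key := integral_mul_fderiv_eq_neg_fderiv_mul_of_integrable (μ := μ) (f := fun _ : F => (1 : ℝ))
    (g := g) (v := v) (by simp) (by simpa using hg')
    (by simpa using hg.continuous.integrable_of_hasCompactSupport hgc)
    (fun _ _ => differentiableAt_const _)
    (fun x _ => hg.differentiable one_ne_zero x)
  simpa using key

/-- Picone's inequality in the direction `v`. -/
theorem neg_fderiv_fderiv_div_mul_sq_le {F : Type*} [NormedAddCommGroup F] [NormedSpace ℝ F]
    {E φ : F → ℝ} {x : F} (hE : ContDiffAt ℝ 2 E x) (hEx : E x ≠ 0)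
    (hφ : DifferentiableAt ℝ φ x) (v : F) :
    -(fderiv ℝ (fderiv ℝ E) x v v) / E x * φ x ^ 2 ≤
      fderiv ℝ φ x v ^ 2 - fderiv ℝ (fun y => φ y ^ 2 * (fderiv ℝ E y v / E y)) x v := by
  have hE' : HasFDerivAt (fun y => fderiv ℝ E y v)
      ((fderiv ℝ (fderiv ℝ E) x).flip v) x := by
    have h : DifferentiableAt ℝ (fderiv ℝ E) x :=
      (hE.fderiv_right (m := 1) (by norm_num)).differentiableAt one_ne_zero
    simpa using h.hasFDerivAt.clm_apply (hasFDerivAt_const v x)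
  have hE1 : HasFDerivAt E (fderiv ℝ E x) x := (hE.differentiableAt two_ne_zero).hasFDerivAt
  have hinv : HasFDerivAt (fun y => (E y)⁻¹) ((-(E x ^ 2)⁻¹) • fderiv ℝ E x) x :=
    (hasDerivAt_inv hEx).comp_hasFDerivAt x hE1
  have hg := (hφ.hasFDerivAt.pow 2).mul (hE'.mul hinv)
  simp only [div_eq_mul_inv]
  rw [HasFDerivAt.fderiv (f := fun y => φ y ^ 2 * (fderiv ℝ E y v * (E y)⁻¹)) hg]
  simp only [add_apply, smul_apply, smul_eq_mul,
    ContinuousLinearMap.flip_apply]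
  rw [← sub_nonneg]
  have : 0 ≤ (fderiv ℝ φ x v - φ x * (fderiv ℝ E x v * (E x)⁻¹)) ^ 2 := sq_nonneg _
  convert this using 1
  simp
  ring

theorem contDiff_sq_mul_logFDeriv {F : Type*} [NormedAddCommGroup F] [NormedSpace ℝ F]
    {Ω : Set F} (hΩ : IsOpen Ω) {E φ : F → ℝ} (hE : ContDiffOn ℝ 2 E Ω) (hE0 : ∀ x ∈ Ω, E x ≠ 0)
    (hφ : ContDiff ℝ 1 φ) (hφΩ : tsupport φ ⊆ Ω) (v : F) :
    ContDiff ℝ 1 (fun y => φ y ^ 2 * (fderiv ℝ E y v / E y)) := by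
  refine contDiff_iff_contDiffAt.2 fun x => ?_
  by_cases hx : x ∈ tsupport φ
  swap
  · refine contDiffAt_const (c := (0 : ℝ)) |>.congr_of_eventuallyEq ?_
    filter_upwards [notMem_tsupport_iff_eventuallyEq.1 hx] with y hy
    simp [hy]
  have hxΩ : x ∈ Ω := hφΩ hx
  have hEx : ContDiffAt ℝ 2 E x := hE.contDiffAt (hΩ.mem_nhds hxΩ)
  exact (hφ.contDiffAt.pow 2).mul
    (((hEx.fderiv_right (m := 1) (by norm_num)).clm_apply contDiffAt_const).div
      (hEx.of_le (by norm_num)) (hE0 x hxΩ))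

/-- For a positive `C²` function `E` on an open set `Ω`,
`∫_Ω (−ΔE/E) φ² ≤ ∫_Ω |∇φ|²` for all smooth compactly supported `φ`. -/
theorem stmt_2 {N : ℕ} (Ω : Set (EuclideanSpace ℝ (Fin N))) (hΩo : IsOpen Ω)
    (E : EuclideanSpace ℝ (Fin N) → ℝ) (hE : ContDiffOn ℝ 2 E Ω)
    (hEpos : ∀ x ∈ Ω, 0 < E x)
    (φ : EuclideanSpace ℝ (Fin N) → ℝ)
    (hφ : ContDiff ℝ (⊤ : ℕ∞) φ) (hφc : HasCompactSupport φ) (hφΩ : tsupport φ ⊆ Ω) :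
    ∫ x in Ω, (- lapl E x / E x) * φ x ^ 2 ≤ ∫ x in Ω, ‖gradient φ x‖ ^ 2 := by
  have hφ1 : ContDiff ℝ 1 φ := hφ.of_le (by exact_mod_cast le_top)
  by_cases hint : IntegrableOn (fun x => (- lapl E x / E x) * φ x ^ 2) Ω
  swap
  · rw [integral_undef hint]
    exact integral_nonneg fun x => sq_nonneg _
  let e : Fin N → EuclideanSpace ℝ (Fin N) := fun i => EuclideanSpace.single i 1
  let g : Fin N → EuclideanSpace ℝ (Fin N) → ℝ :=
    fun i y => φ y ^ 2 * (fderiv ℝ E y (e i) / E y)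
  have hg : ∀ i, ContDiff ℝ 1 (g i) := fun i =>
    contDiff_sq_mul_logFDeriv hΩo hE (fun x hx => (hEpos x hx).ne') hφ1 hφΩ (e i)
  have hgs : ∀ i, Function.support (g i) ⊆ Function.support φ := fun i y hy h =>
    hy (by simp [g, h])
  have hgc : ∀ i, HasCompactSupport (g i) := fun i => hφc.mono (hgs i)
  have hdg : ∀ i, Integrable (fun x => fderiv ℝ (g i) x (e i)) := fun i =>
    (((hg i).continuous_fderiv one_ne_zero).clm_apply
      continuous_const).integrable_of_hasCompactSupport ((hgc i).fderiv_apply ℝ (e i))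
  have hdφ : ∀ i, Integrable (fun x => fderiv ℝ φ x (e i) ^ 2) := fun i =>
    (((hφ1.continuous_fderiv one_ne_zero).clm_apply
      continuous_const).pow 2).integrable_of_hasCompactSupport
      ((hφc.fderiv_apply ℝ (e i)).mono fun x hx h => hx (by simp [h]))
  have hdgs : Integrable (fun x => ∑ i, fderiv ℝ (g i) x (e i)) :=
    integrable_finsetSum _ fun i _ => hdg i
  have hgrad : Integrable (fun x => ‖gradient φ x‖ ^ 2) := by
    simp only [norm_gradient_sq_eq_sum]
    exact integrable_finsetSum _ fun i _ => hdφ i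
  have hdiv : ∫ x in Ω, ∑ i, fderiv ℝ (g i) x (e i) = 0 := by
    rw [setIntegral_eq_integral_of_forall_compl_eq_zero, integral_finsetSum _ fun i _ => hdg i]
    · exact Finset.sum_eq_zero fun i _ => integral_fderiv_apply_eq_zero_s2 (hg i) (hgc i) _
    · intro x hx
      refine Finset.sum_eq_zero fun i _ => ?_
      rw [fderiv_of_notMem_tsupport ℝ fun h => hx (hφΩ (closure_mono (hgs i) h))]
      simp
  calc ∫ x in Ω, (- lapl E x / E x) * φ x ^ 2
      ≤ ∫ x in Ω, (‖gradient φ x‖ ^ 2 - ∑ i, fderiv ℝ (g i) x (e i)) := by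
        refine setIntegral_mono_on hint (hgrad.integrableOn.sub hdgs.integrableOn)
          hΩo.measurableSet fun x hx => ?_
        rw [norm_gradient_sq_eq_sum, ← Finset.sum_sub_distrib, lapl, ← Finset.sum_neg_distrib,
          Finset.sum_div, Finset.sum_mul]
        refine Finset.sum_le_sum fun i _ => ?_
        rw [iteratedFDeriv_two_apply]
        exact neg_fderiv_fderiv_div_mul_sq_le (hE.contDiffAt (hΩo.mem_nhds hx)) (hEpos x hx).ne'
          (hφ1.differentiable one_ne_zero x) (e i)
    _ = ∫ x in Ω, ‖gradient φ x‖ ^ 2 := by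
        rw [integral_sub hgrad.integrableOn hdgs.integrableOn, hdiv, sub_zero]
end

section
/- Let Ω ⊂ ℝ^N be a bounded open set and λ, γ > 0. Let f, g : ℝ → ℝ be C³ with f(0) = g(0) = 1, f', g' ≥ 0, f'', g'' ≥ 0, f''', g''' ≥ 0, and set a := f'(0) > 0, b := g'(0) > 0. Let u, v be C³ on a neighborhood of the closure of Ω, nonnegative on Ω, with u = v = 0 on ∂Ω, solving −Δu = λ f'(u) g(v) and −Δv = γ f(u) g'(v) in Ω. Assume Green's identity holds for u and for v on Ω, i.e. ∫_Ω ∇w·∇u = ∫_Ω w(−Δu) and ∫_Ω ∇w·∇v = ∫_Ω w(−Δv) for every C¹ function w on a neighborhood of the closure of Ω vanishing on ∂Ω. Assume furthermore the stability inequality holds for the test functions φ := f'(u) − a and ψ := g'(v) − b, namely ∫_Ω f''(u) g(v) φ² + ∫_Ω f(u) g''(v) ψ² + 2 ∫_Ω f'(u) g'(v) φ ψ ≤ (1/λ) ∫_Ω |∇φ|² + (1/γ) ∫_Ω |∇ψ|². Define h₁(s) := ∫₀^s (f'(t) − a) f'''(t) dt and h₂(s) := ∫₀^s (g'(t) − b)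 g'''(t) dt. Then ∫_Ω h₁(u) f'(u) g(v) + ∫_Ω h₂(v) f(u) g'(v) + 2 ∫_Ω f'(u) g'(v) (f'(u) − a)(g'(v) − b) ≤ a ∫_Ω f''(u) (f'(u) − a) g(v) + b ∫_Ω g''(v) (g'(v) − b) f(u). -/
open MeasureTheory Real Set Filter Topology
open scoped RealInnerProductSpace

/-- On a bounded set, functions continuous on the closure are integrable. -/
theorem integrableOn_of_continuousOn_closure {N : ℕ} {Ω : Set (EuclideanSpace ℝ (Fin N))}
    (hΩ : Bornology.IsBounded Ω) {F : EuclideanSpace ℝ (Fin N) → ℝ}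
    (hF : ContinuousOn F (closure Ω)) : IntegrableOn F Ω :=
  (hF.integrableOn_compact hΩ.isCompact_closure).mono_set subset_closure

/-- The chain rule for the gradient of `k ∘ u`, with `k` a function of one real variable. -/
theorem HasDerivAt.hasGradientAt_comp {E : Type*} [NormedAddCommGroup E] [InnerProductSpace ℝ E]
    [CompleteSpace E] {k : ℝ → ℝ} {k' : ℝ} {u : E → ℝ} {x : E} (hk : HasDerivAt k k' (u x))
    (hu : DifferentiableAt ℝ u x) :
    HasGradientAt (fun y => k (u y)) (k' • gradient u x) x := by
  rw [hasGradientAt_iff_hasFDerivAt, map_smul]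
  exact hk.comp_hasFDerivAt x hu.hasGradientAt.hasFDerivAt

/-- Integration by parts: `∫₀ˢ f''² = (f'(s) - f'(0)) f''(s) - ∫₀ˢ (f' - f'(0)) f'''`, for `f` three times
continuously differentiable. -/
theorem integral_deriv_deriv_sq {f : ℝ → ℝ} (hf : ContDiff ℝ 3 f) (s : ℝ) :
    ∫ t in (0 : ℝ)..s, deriv (deriv f) t ^ 2 =
      (deriv f s - deriv f 0) * deriv (deriv f) s
        - ∫ t in (0 : ℝ)..s, (deriv f t - deriv f 0) * deriv (deriv (deriv f)) t := by
  have h1 : ContDiff ℝ 2 (deriv f) := hf.deriv'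
  have h2 : ContDiff ℝ 1 (deriv (deriv f)) := h1.deriv'
  have h3 : Continuous (deriv (deriv (deriv f))) := h2.continuous_deriv le_rfl
  have key := intervalIntegral.integral_mul_deriv_eq_deriv_mul (a := 0) (b := s)
    (u := fun t => deriv f t - deriv f 0) (v := deriv (deriv f))
    (fun t _ => ((h1.differentiable (by norm_num)).differentiableAt.hasDerivAt).sub_const _)
    (fun t _ => (h2.differentiable (by norm_num)).differentiableAt.hasDerivAt)
    (h2.continuous.intervalIntegrable _ _) (h3.intervalIntegrable _ _)
  simp only [sub_self, zero_mul, sub_zero] at key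
  rw [key]
  simp only [sq, sub_sub_cancel]

/-- Green's identity tested with `∫₀ᵘ f''²` computes the energy of `f'(u) - f'(0)`; combined with
integration by parts it compares that energy with the quadratic form on the left of the stability
inequality. -/
theorem energy_sub_quadratic_form {N : ℕ} {Ω : Set (EuclideanSpace ℝ (Fin N))}
    (hΩo : IsOpen Ω) (hΩb : Bornology.IsBounded Ω) {c : ℝ} (hc : 0 < c)
    {f : ℝ → ℝ} (hf : ContDiff ℝ 3 f) {u q : EuclideanSpace ℝ (Fin N) → ℝ}
    {U : Set (EuclideanSpace ℝ (Fin N))} (hUo : IsOpen U) (hUc : closure Ω ⊆ U)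
    (hu : ContDiffOn ℝ 3 u U) (hubd : ∀ x ∈ frontier Ω, u x = 0)
    (hq : ContinuousOn q (closure Ω))
    (hequ : ∀ x ∈ Ω, - lapl u x = c * (deriv f (u x) * q x))
    (hGreen : ∀ (w : EuclideanSpace ℝ (Fin N) → ℝ) (V : Set (EuclideanSpace ℝ (Fin N))),
      IsOpen V → closure Ω ⊆ V → ContDiffOn ℝ 1 w V → (∀ x ∈ frontier Ω, w x = 0) →
      ∫ x in Ω, ⟪gradient w x, gradient u x⟫ = ∫ x in Ω, w x * (- lapl u x)) :
    (1 / c) * (∫ x in Ω, ‖gradient (fun y => deriv f (u y) - deriv f 0) x‖ ^ 2)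
        - ∫ x in Ω, deriv (deriv f) (u x) * q x * (deriv f (u x) - deriv f 0) ^ 2
      = deriv f 0 * (∫ x in Ω, deriv (deriv f) (u x) * (deriv f (u x) - deriv f 0) * q x)
        - ∫ x in Ω,
            (∫ t in (0 : ℝ)..(u x), (deriv f t - deriv f 0) * deriv (deriv (deriv f)) t)
              * deriv f (u x) * q x := by
  have h1 : ContDiff ℝ 2 (deriv f) := hf.deriv'
  have h2 : ContDiff ℝ 1 (deriv (deriv f)) := h1.deriv'
  have h3 : Continuous (deriv (deriv (deriv f))) := h2.continuous_deriv le_rfl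
  have hc1 := h1.continuous
  have hc2 := h2.continuous
  have hu0 : ContinuousOn u (closure Ω) := hu.continuousOn.mono hUc
  have hud : ∀ x ∈ Ω, DifferentiableAt ℝ u x := fun x hx =>
    (hu.contDiffAt (hUo.mem_nhds (hUc (subset_closure hx)))).differentiableAt (by norm_num)
  have hW : ∀ s, HasDerivAt (fun s => ∫ t in (0 : ℝ)..s, deriv (deriv f) t ^ 2)
      (deriv (deriv f) s ^ 2) s := fun s =>
    (hc2.pow 2).integral_hasStrictDerivAt 0 s |>.hasDerivAt
  have hWc : ContDiff ℝ 1 (fun s => ∫ t in (0 : ℝ)..s, deriv (deriv f) t ^ 2) := by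
    refine contDiff_one_iff_deriv.2 ⟨fun s => (hW s).differentiableAt, ?_⟩
    rw [show deriv _ = _ from funext fun s => (hW s).deriv]
    exact hc2.pow 2
  have green := hGreen (fun x => ∫ t in (0 : ℝ)..(u x), deriv (deriv f) t ^ 2) U hUo hUc
    (hWc.comp_contDiffOn (hu.of_le (by norm_num))) (fun x hx => by simp [hubd x hx])
  have energy : ∫ x in Ω, ‖gradient (fun y => deriv f (u y) - deriv f 0) x‖ ^ 2 =
      ∫ x in Ω, ⟪gradient (fun x => ∫ t in (0 : ℝ)..(u x), deriv (deriv f) t ^ 2) x,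
        gradient u x⟫ := by
    refine setIntegral_congr_fun hΩo.measurableSet fun x hx => ?_
    have hd : HasDerivAt (fun s => deriv f s - deriv f 0) (deriv (deriv f) (u x)) (u x) :=
      (h1.differentiable (by norm_num)).differentiableAt.hasDerivAt.sub_const _
    simp only [(hd.hasGradientAt_comp (hud x hx)).gradient,
      ((hW (u x)).hasGradientAt_comp (hud x hx)).gradient, norm_smul, real_inner_smul_left,
      real_inner_self_eq_norm_sq, mul_pow, Real.norm_eq_abs, sq_abs]
  have source : ∫ x in Ω, (∫ t in (0 : ℝ)..(u x), deriv (deriv f) t ^ 2) * (- lapl u x) =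
      c * ∫ x in Ω, (∫ t in (0 : ℝ)..(u x), deriv (deriv f) t ^ 2) * deriv f (u x) * q x := by
    rw [← integral_const_mul]
    refine setIntegral_congr_fun hΩo.measurableSet fun x hx => ?_
    simp only [hequ x hx]
    ring
  have hh : Continuous fun s : ℝ =>
      ∫ t in (0 : ℝ)..s, (deriv f t - deriv f 0) * deriv (deriv (deriv f)) t :=
    intervalIntegral.continuous_primitive
      (fun _ _ => (by fun_prop : Continuous _).intervalIntegrable _ _) 0
  have hu1 := hc1.comp_continuousOn hu0
  have hu2 := hc2.comp_continuousOn hu0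
  have huh := hh.comp_continuousOn hu0
  have huW := hWc.continuous.comp_continuousOn hu0
  rw [energy, green, source, ← mul_assoc, one_div_mul_cancel hc.ne', one_mul,
    ← integral_const_mul, ← integral_sub, ← integral_sub]
  · refine integral_congr_ae (ae_of_all _ fun x => ?_)
    simp only [integral_deriv_deriv_sq hf]
    ring
  all_goals refine integrableOn_of_continuousOn_closure hΩb ?_
  · exact continuousOn_const.mul ((hu2.mul (hu1.sub continuousOn_const)).mul hq)
  · exact (huh.mul hu1).mul hq
  · exact (huW.mul hu1).mul hq
  · exact (hu2.mul hq).mul ((hu1.sub continuousOn_const).pow 2)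

/-- The basic integral estimate (Lemma `nedev_L` of Cowan–Fazly) for solutions of the
gradient system `(G)_{λ,γ}` that are stable with respect to the test functions
`φ = f'(u) − a`, `ψ = g'(v) − b`. -/
theorem stmt_3 {N : ℕ} (Ω : Set (EuclideanSpace ℝ (Fin N)))
    (hΩo : IsOpen Ω) (hΩb : Bornology.IsBounded Ω)
    (lam gam : ℝ) (hlam : 0 < lam) (hgam : 0 < gam)
    (f g : ℝ → ℝ) (hf : ContDiff ℝ 3 f) (hg : ContDiff ℝ 3 g)
    (hf0 : f 0 = 1) (hg0 : g 0 = 1)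
    (hf' : ∀ s : ℝ, 0 ≤ deriv f s) (hg' : ∀ s : ℝ, 0 ≤ deriv g s)
    (hf'' : ∀ s : ℝ, 0 ≤ deriv (deriv f) s) (hg'' : ∀ s : ℝ, 0 ≤ deriv (deriv g) s)
    (hf''' : ∀ s : ℝ, 0 ≤ deriv (deriv (deriv f)) s)
    (hg''' : ∀ s : ℝ, 0 ≤ deriv (deriv (deriv g)) s)
    (a b : ℝ) (ha : a = deriv f 0) (hb : b = deriv g 0) (ha0 : 0 < a) (hb0 : 0 < b)
    (u v : EuclideanSpace ℝ (Fin N) → ℝ)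
    (U : Set (EuclideanSpace ℝ (Fin N))) (hUo : IsOpen U) (hUc : closure Ω ⊆ U)
    (hu : ContDiffOn ℝ 3 u U) (hv : ContDiffOn ℝ 3 v U)
    (hupos : ∀ x ∈ Ω, 0 ≤ u x) (hvpos : ∀ x ∈ Ω, 0 ≤ v x)
    (hubd : ∀ x ∈ frontier Ω, u x = 0) (hvbd : ∀ x ∈ frontier Ω, v x = 0)
    (hequ : ∀ x ∈ Ω, - lapl u x = lam * deriv f (u x) * g (v x))
    (heqv : ∀ x ∈ Ω, - lapl v x = gam * f (u x) * deriv g (v x))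
    (hGreenu : ∀ (w : EuclideanSpace ℝ (Fin N) → ℝ) (V : Set (EuclideanSpace ℝ (Fin N))),
      IsOpen V → closure Ω ⊆ V → ContDiffOn ℝ 1 w V → (∀ x ∈ frontier Ω, w x = 0) →
      ∫ x in Ω, ⟪gradient w x, gradient u x⟫ = ∫ x in Ω, w x * (- lapl u x))
    (hGreenv : ∀ (w : EuclideanSpace ℝ (Fin N) → ℝ) (V : Set (EuclideanSpace ℝ (Fin N))),
      IsOpen V → closure Ω ⊆ V → ContDiffOn ℝ 1 w V → (∀ x ∈ frontier Ω, w x = 0) →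
      ∫ x in Ω, ⟪gradient w x, gradient v x⟫ = ∫ x in Ω, w x * (- lapl v x))
    (hstab :
      (∫ x in Ω, deriv (deriv f) (u x) * g (v x) * (deriv f (u x) - a) ^ 2)
        + (∫ x in Ω, f (u x) * deriv (deriv g) (v x) * (deriv g (v x) - b) ^ 2)
        + 2 * ∫ x in Ω,
            deriv f (u x) * deriv g (v x) * (deriv f (u x) - a) * (deriv g (v x) - b)
      ≤ (1 / lam) * (∫ x in Ω, ‖gradient (fun y => deriv f (u y) - a) x‖ ^ 2)
        + (1 / gam) * ∫ x in Ω, ‖gradient (fun y => deriv g (v y) - b) x‖ ^ 2) :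
    (∫ x in Ω,
        (∫ t in (0:ℝ)..(u x), (deriv f t - a) * deriv (deriv (deriv f)) t)
          * deriv f (u x) * g (v x))
      + (∫ x in Ω,
          (∫ t in (0:ℝ)..(v x), (deriv g t - b) * deriv (deriv (deriv g)) t)
            * f (u x) * deriv g (v x))
      + 2 * ∫ x in Ω,
          deriv f (u x) * deriv g (v x) * (deriv f (u x) - a) * (deriv g (v x) - b)
    ≤ a * (∫ x in Ω, deriv (deriv f) (u x) * (deriv f (u x) - a) * g (v x))
      + b * ∫ x in Ω, deriv (deriv g) (v x) * (deriv g (v x) - b) * f (u x) := by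
  subst ha hb
  have hu0 : ContinuousOn u (closure Ω) := hu.continuousOn.mono hUc
  have hv0 : ContinuousOn v (closure Ω) := hv.continuousOn.mono hUc
  have hU := energy_sub_quadratic_form hΩo hΩb hlam hf hUo hUc hu hubd
    (hg.continuous.comp_continuousOn hv0) (fun x hx => by rw [hequ x hx, mul_assoc]; rfl) hGreenu
  have hV := energy_sub_quadratic_form hΩo hΩb hgam hg hUo hUc hv hvbd
    (hf.continuous.comp_continuousOn hu0)
    (fun x hx => by rw [heqv x hx, mul_assoc, mul_comm (f _)]; rfl) hGreenv
  simp only [Function.comp_apply] at hU hV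
  simp only [mul_comm (deriv (deriv g) _) (f _),
    mul_right_comm _ (deriv g _) (f _)] at hV
  linarith
end

section
/- Let f : ℝ → ℝ be C³ on [0, ∞) with f' ≥ 0, f'' ≥ 0 and f''' ≥ 0 on [0, ∞), suppose f is superlinear at infinity (f(u)/u → ∞ as u → ∞) and f''(u) → ∞ as u → ∞. Set a := f'(0) and h₁(u) := ∫₀^u (f'(t) − a) f'''(t) dt. Then h₁(u)/f''(u) → ∞ as u → ∞. -/
open MeasureTheory Real Set Filter Topology

/-- The one-sided derivative of a `C^(n+1)` function on `[0, ∞)` is `C^n` up to the boundary and is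
the ordinary derivative in the interior. -/
theorem ContDiffOn.exists_hasDerivAt_Ioi {n : ℕ} {f : ℝ → ℝ}
    (hf : ContDiffOn ℝ ((n + 1 : ℕ) : WithTop ℕ∞) f (Set.Ici 0)) :
    ∃ g : ℝ → ℝ, ContDiffOn ℝ (n : WithTop ℕ∞) g (Set.Ici 0) ∧
      ∀ t : ℝ, 0 < t → HasDerivAt f (g t) t := by
  refine ⟨derivWithin f (Set.Ici 0), hf.derivWithin (uniqueDiffOn_Ici 0) (by norm_cast), ?_⟩
  intro t ht
  have hd : DifferentiableOn ℝ f (Set.Ici 0) := hf.differentiableOn (by norm_cast)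
  exact (hd t ht.le).hasDerivWithinAt.hasDerivAt (Ici_mem_nhds ht)

/-- A function whose derivative tends to infinity tends to infinity. -/
theorem tendsto_atTop_of_hasDerivAt_tendsto_atTop {g g' : ℝ → ℝ}
    (hg : ∀ t : ℝ, 0 < t → HasDerivAt g (g' t) t) (hg' : Tendsto g' atTop atTop) :
    Tendsto g atTop atTop := by
  obtain ⟨T, hT⟩ := eventually_atTop.1 ((hg'.eventually_ge_atTop 1).and (eventually_gt_atTop 0))
  have hmono : MonotoneOn (fun t => g t - t) (Set.Ici T) := by
    have hd : ∀ t ∈ Set.Ici T, HasDerivAt (fun t => g t - t) (g' t - 1) t := fun t ht =>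
      (hg t (hT t ht).2).sub (hasDerivAt_id t)
    refine monotoneOn_of_deriv_nonneg (convex_Ici T)
      (fun t ht => (hd t ht).continuousAt.continuousWithinAt)
      (fun t ht => (hd t (interior_subset ht)).differentiableAt.differentiableWithinAt) ?_
    intro t ht
    rw [(hd t (interior_subset ht)).deriv]
    linarith [(hT t (interior_subset ht)).1]
  refine tendsto_atTop_mono' _ ?_ (tendsto_atTop_add_const_right atTop (g T - T) tendsto_id)
  filter_upwards [eventually_ge_atTop T] with t ht
  have := hmono (Set.mem_Ici.2 le_rfl) ht ht
  simp only [id] at *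
  linarith

/-- If a weight `w` and `q` both tend to infinity, with `q` nondecreasing, then
`∫₀ᵘ w q'` dominates `q u`. -/
theorem tendsto_integral_mul_deriv_div_atTop {w q q' : ℝ → ℝ}
    (hw : ContinuousOn w (Set.Ici 0)) (hq' : ContinuousOn q' (Set.Ici 0))
    (hq : ∀ t : ℝ, 0 < t → HasDerivAt q (q' t) t) (hnonneg : ∀ t : ℝ, 0 < t → 0 ≤ q' t)
    (hwinf : Tendsto w atTop atTop) (hqinf : Tendsto q atTop atTop) :
    Tendsto (fun u : ℝ => (∫ t in (0:ℝ)..u, w t * q' t) / q u) atTop atTop := by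
  have hint : ∀ x y : ℝ, 0 ≤ x → x ≤ y →
      IntervalIntegrable (fun t => w t * q' t) volume x y := fun x y hx hxy =>
    ((hw.mul hq').mono (by
      rw [uIcc_of_le hxy]; exact fun t ht => hx.trans ht.1)).intervalIntegrable
  refine tendsto_atTop.2 fun M => ?_
  obtain ⟨T, hT⟩ := eventually_atTop.1
    ((hwinf.eventually_ge_atTop (M + 1)).and (eventually_gt_atTop 0))
  have hT0 : 0 < T := (hT T le_rfl).2
  set C := ∫ t in (0:ℝ)..T, w t * q' t
  filter_upwards [eventually_ge_atTop T, hqinf.eventually_gt_atTop 0,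
    hqinf.eventually_ge_atTop ((M + 1) * q T - C)] with u hu hqu hqC
  have hsub : Set.uIcc T u ⊆ Set.Ici 0 := by
    rw [uIcc_of_le hu]; exact fun t ht => hT0.le.trans ht.1
  have hiq : IntervalIntegrable q' volume T u := (hq'.mono hsub).intervalIntegrable
  have hftc : ∫ t in T..u, q' t = q u - q T := by
    refine intervalIntegral.integral_eq_sub_of_hasDerivAt (fun t ht => hq t ?_) hiq
    rw [uIcc_of_le hu] at ht
    exact hT0.trans_le ht.1
  have hle : ∫ t in T..u, (M + 1) * q' t ≤ ∫ t in T..u, w t * q' t :=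
    intervalIntegral.integral_mono_on hu (hiq.const_mul _) (hint T u hT0.le hu) fun t ht =>
      mul_le_mul_of_nonneg_right (hT t ht.1).1 (hnonneg t (hT t ht.1).2)
  rw [intervalIntegral.integral_const_mul, hftc] at hle
  rw [le_div_iff₀ hqu, ← intervalIntegral.integral_add_adjacent_intervals
    (hint 0 T le_rfl hT0.le) (hint T u hT0.le hu)]
  linarith

/-- If `f` is `C³` on `[0,∞)` with `f', f'', f''' ≥ 0` there, superlinear at infinity and with
`f'' → ∞`, then `h₁(u)/f''(u) → ∞` where `h₁(u) = ∫₀ᵘ (f'(t) − f'(0)) f'''(t) dt`. -/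
theorem stmt_4 (f : ℝ → ℝ) (hf : ContDiffOn ℝ 3 f (Set.Ici 0))
    (hf' : ∀ s ∈ Set.Ici (0:ℝ), 0 ≤ deriv f s)
    (hf'' : ∀ s ∈ Set.Ici (0:ℝ), 0 ≤ deriv (deriv f) s)
    (hf''' : ∀ s ∈ Set.Ici (0:ℝ), 0 ≤ deriv (deriv (deriv f)) s)
    (hsuper : Tendsto (fun u : ℝ => f u / u) atTop atTop)
    (hf''inf : Tendsto (fun u : ℝ => deriv (deriv f) u) atTop atTop)
    (a : ℝ) (ha : a = deriv f 0)
    (h₁ : ℝ → ℝ)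
    (hh₁ : ∀ u : ℝ, h₁ u = ∫ t in (0:ℝ)..u, (deriv f t - a) * deriv (deriv (deriv f)) t) :
    Tendsto (fun u : ℝ => h₁ u / deriv (deriv f) u) atTop atTop := by
  obtain ⟨g₁, hg₁, hd₁⟩ := ContDiffOn.exists_hasDerivAt_Ioi (n := 2) (f := f) (by exact_mod_cast hf)
  obtain ⟨g₂, hg₂, hd₂⟩ := ContDiffOn.exists_hasDerivAt_Ioi (n := 1) (f := g₁) hg₁
  obtain ⟨g₃, hg₃, hd₃⟩ := ContDiffOn.exists_hasDerivAt_Ioi (n := 0) (f := g₂) hg₂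
  have e₁ : ∀ t : ℝ, 0 < t → deriv f t = g₁ t := fun t ht => (hd₁ t ht).deriv
  have e₂ : ∀ t : ℝ, 0 < t → deriv (deriv f) t = g₂ t := fun t ht => by
    rw [Filter.EventuallyEq.deriv_eq ((eventually_gt_nhds ht).mono e₁), (hd₂ t ht).deriv]
  have e₃ : ∀ t : ℝ, 0 < t → deriv (deriv (deriv f)) t = g₃ t := fun t ht => by
    rw [Filter.EventuallyEq.deriv_eq ((eventually_gt_nhds ht).mono e₂), (hd₃ t ht).deriv]
  have hg₂inf : Tendsto g₂ atTop atTop :=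
    hf''inf.congr' ((eventually_gt_atTop 0).mono e₂)
  have hwinf : Tendsto (fun t => g₁ t - a) atTop atTop :=
    tendsto_atTop_add_const_right _ (-a) (tendsto_atTop_of_hasDerivAt_tendsto_atTop hd₂ hg₂inf)
  refine (tendsto_integral_mul_deriv_div_atTop (hg₁.continuousOn.sub continuousOn_const)
    hg₃.continuousOn hd₃ (fun t ht => e₃ t ht ▸ hf''' t ht.le) hwinf hg₂inf).congr' ?_
  filter_upwards [eventually_gt_atTop 0] with u hu
  rw [hh₁, e₂ u hu]
  congr 1
  refine intervalIntegral.integral_congr_ae (Eventually.of_forall fun t ht => ?_)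
  rw [uIoc_of_le hu.le] at ht
  simp only [Pi.sub_apply, e₁ t ht.1, e₃ t ht.1]
end

section
/- Let f : ℝ → ℝ be C² on [0, ∞) with f(0) = 1, f' ≥ 0 on [0, ∞), and suppose there is a constant C > 0 with f''(u) ≥ C for all u ≥ 0. Define h(u) := ∫₀^u (f(τ) − 1) f''(τ) dτ. Then h(u)/f'(u) → ∞ as u → ∞. -/
open MeasureTheory Real Set Filter Topology

/-- A function whose derivative is at least `C > 0` on `[a, ∞)` tends to infinity. -/
lemma tendsto_atTop_of_le_deriv_Ici {g : ℝ → ℝ} {a C : ℝ} (hC : 0 < C)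
    (hg : ∀ s ∈ Ici a, C ≤ deriv g s) : Tendsto g atTop atTop := by
  have hd : ∀ s ∈ Ici a, DifferentiableAt ℝ g s := fun s hs =>
    differentiableAt_of_deriv_ne_zero (hC.trans_le (hg s hs)).ne'
  have hmvt := (convex_Ici a).mul_sub_le_image_sub_of_le_deriv
    (fun s hs => (hd s hs).continuousAt.continuousWithinAt)
    (fun s hs => (hd s (interior_subset hs)).differentiableWithinAt)
    (fun s hs => hg s (interior_subset hs))
  have hlin : Tendsto (fun u : ℝ => C * (u - a) + g a) atTop atTop :=
    tendsto_atTop_add_const_right _ _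
      ((tendsto_atTop_add_const_right _ (-a) tendsto_id).const_mul_atTop hC)
  refine tendsto_atTop_mono' _ ?_ hlin
  filter_upwards [eventually_ge_atTop a] with u hu
  linarith [hmvt a self_mem_Ici u hu hu]

/-- On the open half-line, the second derivative of `f` is its second derivative
within the closed half-line. -/
lemma deriv_deriv_eq_iteratedDerivWithin_Ici (f : ℝ → ℝ) {x : ℝ} (hx : 0 < x) :
    deriv (deriv f) x = iteratedDerivWithin 2 f (Ici 0) x := by
  rw [iteratedDerivWithin_succ, derivWithin_of_mem_nhds (Ici_mem_nhds hx)]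
  refine Filter.EventuallyEq.deriv_eq ?_
  filter_upwards [Ioi_mem_nhds hx] with y hy
  rw [iteratedDerivWithin_one, derivWithin_of_mem_nhds (Ici_mem_nhds hy)]

/-- If `f` is `C²` on `[0,∞)` with `f(0) = 1`, `f' ≥ 0` and `f'' ≥ C > 0` there, then
`h(u)/f'(u) → ∞` where `h(u) = ∫₀ᵘ (f(τ) − 1) f''(τ) dτ`. -/
theorem stmt_5 (f : ℝ → ℝ) (hf : ContDiffOn ℝ 2 f (Set.Ici 0)) (hf0 : f 0 = 1)
    (hf' : ∀ s ∈ Set.Ici (0:ℝ), 0 ≤ deriv f s)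
    (C : ℝ) (hC : 0 < C) (hf'' : ∀ s ∈ Set.Ici (0:ℝ), C ≤ deriv (deriv f) s)
    (h : ℝ → ℝ)
    (hh : ∀ u : ℝ, h u = ∫ τ in (0:ℝ)..u, (f τ - 1) * deriv (deriv f) τ) :
    Tendsto (fun u : ℝ => h u / deriv f u) atTop atTop := by
  have hd : ∀ s ∈ Ici (0:ℝ), DifferentiableAt ℝ (deriv f) s := fun s hs =>
    differentiableAt_of_deriv_ne_zero (hC.trans_le (hf'' s hs)).ne'
  have hf'_top : Tendsto (deriv f) atTop atTop := tendsto_atTop_of_le_deriv_Ici hC hf''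
  have hf_top : Tendsto f atTop atTop := by
    obtain ⟨a, ha⟩ := eventually_atTop.1 (hf'_top.eventually_ge_atTop 1)
    exact tendsto_atTop_of_le_deriv_Ici one_pos ha
  have hcont : ContinuousOn (iteratedDerivWithin 2 f (Ici 0)) (Ici 0) :=
    hf.continuousOn_iteratedDerivWithin le_rfl (uniqueDiffOn_Ici 0)
  have huIcc : ∀ {a b : ℝ}, 0 ≤ a → 0 ≤ b → uIcc a b ⊆ Ici 0 := fun ha hb x hx =>
    (le_min ha hb).trans hx.1
  have hint : ∀ {g : ℝ → ℝ}, ContinuousOn g (Ici 0) → ∀ {a b : ℝ}, 0 ≤ a → 0 ≤ b →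
      IntervalIntegrable (fun τ => g τ * deriv (deriv f) τ) volume a b := by
    intro g hg a b ha hb
    refine ((hg.mul hcont).mono (huIcc ha hb)).intervalIntegrable.congr ?_
    intro x hx
    simp only [Pi.mul_apply]
    rw [deriv_deriv_eq_iteratedDerivWithin_Ici f ((le_min ha hb).trans_lt hx.1)]
  have hf1 : ContinuousOn (fun τ => f τ - 1) (Ici 0) := hf.continuousOn.sub continuousOn_const
  refine tendsto_atTop.2 fun M => ?_
  obtain ⟨A, hA⟩ := eventually_atTop.1
    ((hf_top.eventually_ge_atTop (M + 2)).and (eventually_ge_atTop 0))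
  have hA0 : 0 ≤ A := (hA A le_rfl).2
  filter_upwards [eventually_ge_atTop A, hf'_top.eventually_gt_atTop 0,
    hf'_top.eventually_ge_atTop ((M + 1) * deriv f A - h A)] with u hu hpos hlarge
  have hu0 : 0 ≤ u := hA0.trans hu
  have hsplit : h u = h A + ∫ τ in A..u, (f τ - 1) * deriv (deriv f) τ := by
    rw [hh, hh, intervalIntegral.integral_add_adjacent_intervals
      (hint hf1 le_rfl hA0) (hint hf1 hA0 hu0)]
  have hFTC : ∫ τ in A..u, deriv (deriv f) τ = deriv f u - deriv f A := by
    refine intervalIntegral.integral_deriv_eq_sub (fun x hx => hd x (huIcc hA0 hu0 hx)) ?_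
    simpa using hint (g := fun _ => 1) continuousOn_const hA0 hu0
  have hmono : ∫ τ in A..u, (M + 1) * deriv (deriv f) τ ≤
      ∫ τ in A..u, (f τ - 1) * deriv (deriv f) τ := by
    refine intervalIntegral.integral_mono_on hu (hint continuousOn_const hA0 hu0)
      (hint hf1 hA0 hu0) fun x hx => ?_
    have hfx := (hA x hx.1).1
    exact mul_le_mul_of_nonneg_right (by linarith)
      (hC.le.trans (hf'' x (hA0.trans hx.1)))
  rw [intervalIntegral.integral_const_mul, hFTC] at hmono
  rw [le_div_iff₀ hpos]
  linarith
end

section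
/- Let Ω ⊂ ℝ^N be a bounded open set, let p, q > 1 and λ, γ > 0 with λp ≥ γq. Let u, v be C² on a neighborhood of the closure of Ω, nonnegative on Ω, with u = v = 0 on ∂Ω, and suppose that in Ω: −Δu = λ p (1+u)^{p−1} (1+v)^q and −Δv = γ q (1+u)^p (1+v)^{q−1}. Then v ≤ u ≤ (λp/(γq)) v throughout Ω. -/
open MeasureTheory Real Set Filter Topology

lemma lapl_eq_laplacian {N : ℕ} (f : EuclideanSpace ℝ (Fin N) → ℝ) :
    lapl f = Laplacian.laplacian f := by
  rw [InnerProductSpace.laplacian_eq_iteratedFDeriv_orthonormalBasis f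
    (EuclideanSpace.basisFun (Fin N) ℝ)]
  funext x
  simp [lapl]

lemma lapl_sub_const_mul {N : ℕ} {f g : EuclideanSpace ℝ (Fin N) → ℝ}
    {x : EuclideanSpace ℝ (Fin N)} (hf : ContDiffAt ℝ 2 f x) (hg : ContDiffAt ℝ 2 g x) (c : ℝ) :
    lapl (fun y => f y - c * g y) x = lapl f x - c * lapl g x := by
  have hsub := hf.laplacian_sub (f₂ := c • g) (hg.const_smul c)
  rw [InnerProductSpace.laplacian_smul c hg] at hsub
  rw [lapl_eq_laplacian, lapl_eq_laplacian, lapl_eq_laplacian]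
  exact hsub

lemma IsLocalMax.deriv_deriv_nonpos {g : ℝ → ℝ} {t : ℝ} (h : IsLocalMax g t)
    (hc : ContinuousAt g t) : deriv (deriv g) t ≤ 0 := by
  by_contra! hpos
  have hmin := isLocalMin_of_deriv_deriv_pos hpos h.deriv_eq_zero hc
  have hconst : g =ᶠ[𝓝 t] fun _ => g t := by
    filter_upwards [h, hmin] with s hs hs' using le_antisymm hs hs'
  have := hconst.deriv.deriv_eq
  simp at this
  exact hpos.ne' this

lemma IsLocalMax.iteratedFDeriv_two_nonpos {E : Type*} [NormedAddCommGroup E] [NormedSpace ℝ E]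
    {f : E → ℝ} {x : E} (h : IsLocalMax f x) (hf : ContDiffAt ℝ 2 f x) (e : E) :
    iteratedFDeriv ℝ 2 f x ![e, e] ≤ 0 := by
  have hline (t : ℝ) : HasDerivAt (fun t : ℝ => x + t • e) e t := by
    simpa using ((hasDerivAt_id t).smul_const e).const_add x
  have hlim : Tendsto (fun t : ℝ => x + t • e) (𝓝 0) (𝓝 x) := by
    simpa using (hline 0).continuousAt.tendsto
  have hderiv : deriv (fun t : ℝ => f (x + t • e)) =ᶠ[𝓝 0]
      fun t => fderiv ℝ f (x + t • e) e := by
    filter_upwards [hlim.eventually (hf.eventually (by simp))] with t ht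
    exact ((ht.differentiableAt (by simp)).hasFDerivAt.comp_hasDerivAt t (hline t)).deriv
  have hderiv2 : deriv (fun t : ℝ => fderiv ℝ f (x + t • e) e) 0 =
      fderiv ℝ (fderiv ℝ f) x e e := by
    have hd : DifferentiableAt ℝ (fderiv ℝ f) (x + (0 : ℝ) • e) := by
      simpa using (hf.fderiv_right (m := 1) (by norm_num)).differentiableAt (by simp)
    have hD : HasDerivAt (fun t : ℝ => fderiv ℝ f (x + t • e))
        (fderiv ℝ (fderiv ℝ f) (x + (0 : ℝ) • e) e) 0 :=
      hd.hasFDerivAt.comp_hasDerivAt 0 (hline 0)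
    simpa using (hD.clm_apply (hasDerivAt_const 0 e)).deriv
  have hmax : IsLocalMax (fun t : ℝ => f (x + t • e)) 0 := by
    filter_upwards [hlim.eventually h] with t ht
    simpa using ht
  have hcont : ContinuousAt (fun t : ℝ => f (x + t • e)) 0 := by
    have : ContinuousAt f (x + (0 : ℝ) • e) := by simpa using hf.continuousAt
    exact this.comp (f := fun t : ℝ => x + t • e) (hline 0).continuousAt
  have := hmax.deriv_deriv_nonpos hcont
  rw [hderiv.deriv_eq, hderiv2] at this
  simpa [iteratedFDeriv_two_apply] using this

lemma IsLocalMax.lapl_nonpos {N : ℕ} {f : EuclideanSpace ℝ (Fin N) → ℝ}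
    {x : EuclideanSpace ℝ (Fin N)} (h : IsLocalMax f x) (hf : ContDiffAt ℝ 2 f x) :
    lapl f x ≤ 0 :=
  Finset.sum_nonpos fun _ _ => h.iteratedFDeriv_two_nonpos hf _

/-- A maximum principle: a function that is nonpositive on the boundary and strictly subharmonic
wherever it is positive is nonpositive. -/
lemma nonpos_of_lapl_pos_of_pos {N : ℕ} {Ω : Set (EuclideanSpace ℝ (Fin N))}
    (hΩo : IsOpen Ω) (hΩb : Bornology.IsBounded Ω) {w : EuclideanSpace ℝ (Fin N) → ℝ}
    (hw : ∀ x ∈ closure Ω, ContDiffAt ℝ 2 w x) (hbd : ∀ x ∈ frontier Ω, w x ≤ 0)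
    (hlapl : ∀ x ∈ Ω, 0 < w x → 0 < lapl w x) : ∀ x ∈ Ω, w x ≤ 0 := by
  intro x hx
  by_contra! hpos
  obtain ⟨y, hy, hmax⟩ := hΩb.isCompact_closure.exists_isMaxOn ⟨x, subset_closure hx⟩
    fun z hz => (hw z hz).continuousAt.continuousWithinAt
  have hypos : 0 < w y := hpos.trans_le (hmax (subset_closure hx))
  have hyΩ : y ∈ Ω := by
    by_contra hn
    exact (hbd y (hΩo.frontier_eq ▸ ⟨hy, hn⟩)).not_gt hypos
  have hloc : IsLocalMax w y := (hmax.on_subset subset_closure).isLocalMax (hΩo.mem_nhds hyΩ)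
  exact (hlapl y hyΩ hypos).not_ge (hloc.lapl_nonpos (hw y hy))

/-- Pointwise comparison for solutions of the gradient system `(G)_{λ,γ}` with
`f(u) = (1+u)^p`, `g(v) = (1+v)^q` when `λp ≥ γq`: one has `v ≤ u ≤ (λp/(γq)) v`. -/
theorem stmt_12 {N : ℕ} (Ω : Set (EuclideanSpace ℝ (Fin N)))
    (hΩo : IsOpen Ω) (hΩb : Bornology.IsBounded Ω)
    (p q : ℝ) (hp : 1 < p) (hq : 1 < q)
    (lam gam : ℝ) (hlam : 0 < lam) (hgam : 0 < gam) (hcomp : gam * q ≤ lam * p)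
    (u v : EuclideanSpace ℝ (Fin N) → ℝ)
    (U : Set (EuclideanSpace ℝ (Fin N))) (hUo : IsOpen U) (hUc : closure Ω ⊆ U)
    (hu : ContDiffOn ℝ 2 u U) (hv : ContDiffOn ℝ 2 v U)
    (hupos : ∀ x ∈ Ω, 0 ≤ u x) (hvpos : ∀ x ∈ Ω, 0 ≤ v x)
    (hubd : ∀ x ∈ frontier Ω, u x = 0) (hvbd : ∀ x ∈ frontier Ω, v x = 0)
    (hequ : ∀ x ∈ Ω, - lapl u x = lam * p * (1 + u x) ^ (p - 1) * (1 + v x) ^ q)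
    (heqv : ∀ x ∈ Ω, - lapl v x = gam * q * (1 + u x) ^ p * (1 + v x) ^ (q - 1)) :
    ∀ x ∈ Ω, v x ≤ u x ∧ u x ≤ (lam * p / (gam * q)) * v x := by
  have hsmooth {f : EuclideanSpace ℝ (Fin N) → ℝ} (hf : ContDiffOn ℝ 2 f U) (x)
      (hx : x ∈ closure Ω) :
      ContDiffAt ℝ 2 f x := hf.contDiffAt (hUo.mem_nhds (hUc hx))
  have hgq : 0 < gam * q := by positivity
  have hfactor : ∀ x ∈ Ω, ∃ A : ℝ, 0 < A ∧ lapl u x = -(lam * p * A * (1 + v x)) ∧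
      lapl v x = -(gam * q * A * (1 + u x)) := by
    intro x hx
    have hu1 : 0 < 1 + u x := by linarith [hupos x hx]
    have hv1 : 0 < 1 + v x := by linarith [hvpos x hx]
    refine ⟨(1 + u x) ^ (p - 1) * (1 + v x) ^ (q - 1), by positivity, ?_, ?_⟩
    · rw [← neg_eq_iff_eq_neg, hequ x hx, Real.rpow_sub_one hv1.ne' q]
      field_simp
    · rw [← neg_eq_iff_eq_neg, heqv x hx, Real.rpow_sub_one hu1.ne' p]
      field_simp
  have hvu : ∀ x ∈ Ω, v x - 1 * u x ≤ 0 := by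
    refine nonpos_of_lapl_pos_of_pos hΩo hΩb
      (fun x hx => (hsmooth hv x hx).sub (contDiffAt_const.mul (hsmooth hu x hx)))
      (fun x hx => by simp [hubd x hx, hvbd x hx]) fun x hx hpos => ?_
    obtain ⟨A, hA, hAu, hAv⟩ := hfactor x hx
    have hxc := subset_closure hx
    rw [lapl_sub_const_mul (hsmooth hv x hxc) (hsmooth hu x hxc), hAu, hAv]
    have hlt : gam * q * (1 + u x) < lam * p * (1 + v x) :=
      mul_lt_mul' hcomp (by linarith) (by linarith [hupos x hx]) (hgq.trans_le hcomp)
    nlinarith [mul_lt_mul_of_pos_left hlt hA]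
  have huv : ∀ x ∈ Ω, u x - lam * p / (gam * q) * v x ≤ 0 := by
    refine nonpos_of_lapl_pos_of_pos hΩo hΩb
      (fun x hx => (hsmooth hu x hx).sub (contDiffAt_const.mul (hsmooth hv x hx)))
      (fun x hx => by simp [hubd x hx, hvbd x hx]) fun x hx hpos => ?_
    obtain ⟨A, hA, hAu, hAv⟩ := hfactor x hx
    have hxc := subset_closure hx
    have hlt : v x < u x := by
      have : 1 ≤ lam * p / (gam * q) := (one_le_div hgq).2 hcomp
      nlinarith [hvpos x hx]
    rw [lapl_sub_const_mul (hsmooth hu x hxc) (hsmooth hv x hxc), hAu, hAv]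
    have : -(lam * p * A * (1 + v x)) - lam * p / (gam * q) * -(gam * q * A * (1 + u x)) =
        lam * p * A * (u x - v x) := by
      field_simp
      ring
    rw [this]
    have := sub_pos.2 hlt
    positivity
  exact fun x hx => ⟨by linarith [hvu x hx], by linarith [huv x hx]⟩
end

section
/- Let Ω ⊂ ℝ^N be a bounded open set, let p, q > 1 and λ, γ > 0 with λq ≥ γp. Let u, v be C² on a neighborhood of the closure of Ω, nonnegative on Ω, with u = v = 0 on ∂Ω, and suppose that in Ω: −Δu = λ q (1+u)^p (1+v)^{q−1} and −Δv = γ p (1+u)^{p−1} (1+v)^q. Assume in addition there exist η > 0 and a C² function ψ on a neighborhood of the closure of Ω with ψ > 0 on the closure of Ω and −Δψ ≥ (p q γ (1+u)^{p−1}(1+v)^{q−1} + η) ψ in Ω. Then v ≤ u and λ q v ≤ γ p u throughout Ω. -/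
open MeasureTheory Real Set Filter Topology

/-- A pure second derivative is nonnegative at a local minimum. -/
lemma iteratedFDeriv_two_nonneg_of_isLocalMin {E : Type*} [NormedAddCommGroup E]
    [NormedSpace ℝ E] {f : E → ℝ} {x : E} (hf : ContDiffAt ℝ 2 f x) (hmin : IsLocalMin f x)
    (e : E) : 0 ≤ iteratedFDeriv ℝ 2 f x ![e, e] := by
  have hline (t : ℝ) : HasDerivAt (fun s : ℝ => x + s • e) e t := by
    simpa using ((hasDerivAt_id t).smul_const e).const_add x
  have hline0 : Tendsto (fun s : ℝ => x + s • e) (𝓝 0) (𝓝 x) := by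
    simpa [ContinuousAt] using (hline 0).continuousAt
  have hdiff : ∀ᶠ y in 𝓝 x, DifferentiableAt ℝ f y := by
    filter_upwards [hf.eventually (by simp)] with y hy using hy.differentiableAt (by simp)
  have hderiv : deriv (fun s : ℝ => f (x + s • e)) =ᶠ[𝓝 0]
      fun s => fderiv ℝ f (x + s • e) e := by
    filter_upwards [hline0.eventually hdiff] with t ht
    exact (ht.hasFDerivAt.comp_hasDerivAt t (hline t)).deriv
  have hfd : DifferentiableAt ℝ (fderiv ℝ f) x :=
    (hf.fderiv_right (m := 1) (by norm_num)).differentiableAt (by simp)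
  have hderiv2 : deriv (deriv fun s : ℝ => f (x + s • e)) 0 =
      fderiv ℝ (fderiv ℝ f) x e e := by
    rw [hderiv.deriv_eq]
    have h0 : HasFDerivAt (fderiv ℝ f) (fderiv ℝ (fderiv ℝ f) x) (x + (0 : ℝ) • e) := by
      simpa using hfd.hasFDerivAt
    have h1 := h0.comp_hasDerivAt (0 : ℝ) (hline 0)
    simpa using (h1.clm_apply (hasDerivAt_const (0 : ℝ) e)).deriv
  have hming : IsLocalMin (fun s : ℝ => f (x + s • e)) 0 := by
    have := hline0.eventually hmin
    filter_upwards [this] with t ht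
    simpa using ht
  rw [iteratedFDeriv_two_apply]
  simp only [Matrix.cons_val_zero, Matrix.cons_val_one]
  by_contra! hneg
  rw [← hderiv2] at hneg
  have hmax := isLocalMax_of_deriv_deriv_neg hneg hming.deriv_eq_zero
    (by
      have : ContinuousAt f (x + (0 : ℝ) • e) := by simpa using hf.continuousAt
      exact ContinuousAt.comp (f := fun s : ℝ => x + s • e) this (hline 0).continuousAt)
  have hconst : (fun s : ℝ => f (x + s • e)) =ᶠ[𝓝 0] fun _ => f (x + (0 : ℝ) • e) := by
    filter_upwards [hming, hmax] with t h1 h2 using le_antisymm h2 h1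
  rw [hconst.deriv.deriv_eq] at hneg
  simp at hneg

lemma lapl_nonneg_of_isLocalMin {N : ℕ} {f : EuclideanSpace ℝ (Fin N) → ℝ}
    {x : EuclideanSpace ℝ (Fin N)} (hf : ContDiffAt ℝ 2 f x) (hmin : IsLocalMin f x) :
    0 ≤ lapl f x :=
  Finset.sum_nonneg fun _ _ => iteratedFDeriv_two_nonneg_of_isLocalMin hf hmin _

lemma lapl_const_mul_add_const_mul {N : ℕ} {f g : EuclideanSpace ℝ (Fin N) → ℝ}
    {x : EuclideanSpace ℝ (Fin N)} (hf : ContDiffAt ℝ 2 f x) (hg : ContDiffAt ℝ 2 g x)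
    (a b : ℝ) : lapl (fun y => a * f y + b * g y) x = a * lapl f x + b * lapl g x := by
  have h : iteratedFDeriv ℝ 2 (fun y => a * f y + b * g y) x =
      a • iteratedFDeriv ℝ 2 f x + b • iteratedFDeriv ℝ 2 g x := by
    have h1 : (fun y => a * f y + b * g y) = a • f + b • g := by ext; simp
    rw [h1, iteratedFDeriv_add_apply (f := a • f) (g := b • g) (hf.const_smul a)
      (hg.const_smul b),
      iteratedFDeriv_const_smul_apply hf, iteratedFDeriv_const_smul_apply hg]
  simp [lapl, h, Finset.sum_add_distrib, Finset.mul_sum]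

/-- Maximum principle: a strict positive supersolution `ψ` of `-Δ - V` on the closure of a bounded
domain forces supersolutions vanishing on the boundary to be nonnegative. -/
lemma nonneg_of_strict_supersolution {N : ℕ} {Ω : Set (EuclideanSpace ℝ (Fin N))}
    (hΩo : IsOpen Ω) (hΩb : Bornology.IsBounded Ω)
    {w ψ V : EuclideanSpace ℝ (Fin N) → ℝ}
    (hw : ∀ x ∈ closure Ω, ContDiffAt ℝ 2 w x) (hψ : ∀ x ∈ closure Ω, ContDiffAt ℝ 2 ψ x)
    (hψpos : ∀ x ∈ closure Ω, 0 < ψ x) (hψineq : ∀ x ∈ Ω, V x * ψ x < - lapl ψ x)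
    (hwbd : ∀ x ∈ frontier Ω, w x = 0)
    (hwineq : ∀ x ∈ Ω, w x < 0 → V x * w x ≤ - lapl w x) :
    ∀ x ∈ Ω, 0 ≤ w x := by
  intro x hx
  by_contra! hneg
  have hcont : ContinuousOn (fun y => w y / ψ y) (closure Ω) := fun y hy =>
    ((hw y hy).continuousAt.div (hψ y hy).continuousAt (hψpos y hy).ne').continuousWithinAt
  obtain ⟨z, hz, hzmin⟩ := hΩb.isCompact_closure.exists_isMinOn ⟨x, subset_closure hx⟩ hcont
  have hzneg : w z / ψ z < 0 :=
    (hzmin (subset_closure hx)).trans_lt (div_neg_of_neg_of_pos hneg (hψpos x (subset_closure hx)))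
  have hzΩ : z ∈ Ω := by
    by_contra hzn
    have : z ∈ frontier Ω := by
      rw [hΩo.frontier_eq]
      exact ⟨hz, hzn⟩
    simp [hwbd z this] at hzneg
  have hψz := hψpos z hz
  obtain ⟨t, ht⟩ : ∃ t, t = -(w z / ψ z) := ⟨_, rfl⟩
  have htpos : 0 < t := by linarith
  have hwz : w z = -t * ψ z := by
    rw [ht]
    field_simp
  have hmin : IsLocalMin (fun y => 1 * w y + t * ψ y) z := by
    filter_upwards [hΩo.mem_nhds hzΩ] with y hy
    have h1 : w z / ψ z ≤ w y / ψ y := hzmin (subset_closure hy)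
    rw [le_div_iff₀ (hψpos y (subset_closure hy))] at h1
    rw [hwz, ht]
    linarith
  have hlap := lapl_nonneg_of_isLocalMin
    ((contDiffAt_const.mul (hw z hz)).add (contDiffAt_const.mul (hψ z hz))) hmin
  rw [lapl_const_mul_add_const_mul (hw z hz) (hψ z hz)] at hlap
  have h1 := hwineq z hzΩ (by rw [hwz]; nlinarith)
  have h2 := mul_lt_mul_of_pos_left (hψineq z hzΩ) htpos
  rw [hwz] at h1
  linarith

/-- Pointwise comparison for semi-stable solutions of the Hamiltonian system `(H)_{λ,γ}`
with `f(u) = (1+u)^p`, `g(v) = (1+v)^q` when `λq ≥ γp`: one has `v ≤ u` and `λq v ≤ γp u`. -/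
theorem stmt_13 {N : ℕ} (Ω : Set (EuclideanSpace ℝ (Fin N)))
    (hΩo : IsOpen Ω) (hΩb : Bornology.IsBounded Ω)
    (p q : ℝ) (hp : 1 < p) (hq : 1 < q)
    (lam gam : ℝ) (hlam : 0 < lam) (hgam : 0 < gam) (hcomp : gam * p ≤ lam * q)
    (u v : EuclideanSpace ℝ (Fin N) → ℝ)
    (U : Set (EuclideanSpace ℝ (Fin N))) (hUo : IsOpen U) (hUc : closure Ω ⊆ U)
    (hu : ContDiffOn ℝ 2 u U) (hv : ContDiffOn ℝ 2 v U)
    (hupos : ∀ x ∈ Ω, 0 ≤ u x) (hvpos : ∀ x ∈ Ω, 0 ≤ v x)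
    (hubd : ∀ x ∈ frontier Ω, u x = 0) (hvbd : ∀ x ∈ frontier Ω, v x = 0)
    (hequ : ∀ x ∈ Ω, - lapl u x = lam * q * (1 + u x) ^ p * (1 + v x) ^ (q - 1))
    (heqv : ∀ x ∈ Ω, - lapl v x = gam * p * (1 + u x) ^ (p - 1) * (1 + v x) ^ q)
    (η : ℝ) (hη : 0 < η)
    (ψ : EuclideanSpace ℝ (Fin N) → ℝ)
    (W : Set (EuclideanSpace ℝ (Fin N))) (hWo : IsOpen W) (hWc : closure Ω ⊆ W)
    (hψ : ContDiffOn ℝ 2 ψ W) (hψpos : ∀ x ∈ closure Ω, 0 < ψ x)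
    (hψineq : ∀ x ∈ Ω,
      (p * q * gam * (1 + u x) ^ (p - 1) * (1 + v x) ^ (q - 1) + η) * ψ x ≤ - lapl ψ x) :
    ∀ x ∈ Ω, v x ≤ u x ∧ lam * q * v x ≤ gam * p * u x := by
  have hu' : ∀ x ∈ closure Ω, ContDiffAt ℝ 2 u x := fun x hx =>
    hu.contDiffAt (hUo.mem_nhds (hUc hx))
  have hv' : ∀ x ∈ closure Ω, ContDiffAt ℝ 2 v x := fun x hx =>
    hv.contDiffAt (hUo.mem_nhds (hUc hx))
  have hψ' : ∀ x ∈ closure Ω, ContDiffAt ℝ 2 ψ x := fun x hx =>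
    hψ.contDiffAt (hWo.mem_nhds (hWc hx))
  obtain ⟨a, ha⟩ : ∃ a : EuclideanSpace ℝ (Fin N) → ℝ,
      ∀ x, a x = (1 + u x) ^ (p - 1) * (1 + v x) ^ (q - 1) := ⟨_, fun _ => rfl⟩
  have hapos : ∀ x ∈ Ω, 0 < a x := fun x hx => by
    have := hupos x hx
    have := hvpos x hx
    rw [ha]
    positivity
  have hequ' : ∀ x ∈ Ω, - lapl u x = lam * q * (a x * (1 + u x)) := fun x hx => by
    have h : 1 + u x ≠ 0 := by linarith [hupos x hx]
    rw [hequ x hx, ha, rpow_sub_one h]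
    field_simp
  have heqv' : ∀ x ∈ Ω, - lapl v x = gam * p * (a x * (1 + v x)) := fun x hx => by
    have h : 1 + v x ≠ 0 := by linarith [hvpos x hx]
    rw [heqv x hx, ha, rpow_sub_one h]
    field_simp
  have hgp : 0 < gam * p := by positivity
  have hψineq' : ∀ x ∈ Ω, p * q * gam * a x * ψ x < - lapl ψ x := fun x hx => by
    have h1 := hψineq x hx
    have h2 := mul_pos hη (hψpos x (subset_closure hx))
    rw [ha]
    linarith
  have hvu : ∀ x ∈ Ω, v x ≤ u x := by
    intro x hx
    have h := nonneg_of_strict_supersolution hΩo hΩb (w := fun y => 1 * u y + (-1) * v y)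
      (fun y hy => (contDiffAt_const.mul (hu' y hy)).add (contDiffAt_const.mul (hv' y hy)))
      hψ' hψpos hψineq' (fun y hy => by simp [hubd y hy, hvbd y hy]) (fun y hy hneg => ?_) x hx
    · linarith
    · rw [lapl_const_mul_add_const_mul (hu' y (subset_closure hy)) (hv' y (subset_closure hy))]
      have h1 := hequ' y hy
      have h2 := heqv' y hy
      have h3 : 0 ≤ a y * (1 + u y) := mul_nonneg (hapos y hy).le (by linarith [hupos y hy])
      have h4 := mul_le_mul_of_nonneg_right hcomp h3
      have h5 : 0 ≤ gam * p * a y * (q - 1) * (v y - u y) :=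
        mul_nonneg (mul_nonneg (mul_pos hgp (hapos y hy)).le (by linarith)) (by linarith)
      linarith
  refine fun x hx => ⟨hvu x hx, ?_⟩
  have h := nonneg_of_strict_supersolution hΩo hΩb
    (w := fun y => gam * p * u y + (-(lam * q)) * v y)
    (fun y hy => (contDiffAt_const.mul (hu' y hy)).add (contDiffAt_const.mul (hv' y hy)))
    hψ' hψpos hψineq' (fun y hy => by simp [hubd y hy, hvbd y hy]) (fun y hy hneg => ?_) x hx
  · linarith
  · rw [lapl_const_mul_add_const_mul (hu' y (subset_closure hy)) (hv' y (subset_closure hy))]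
    have hV : 0 < p * q * gam * a y := by
      have := hapos y hy
      positivity
    have h1 := mul_neg_of_pos_of_neg hV hneg
    have h2 : 0 ≤ gam * p * (lam * q) * (a y * (u y - v y)) :=
      mul_nonneg (by positivity) (mul_nonneg (hapos y hy).le (by linarith [hvu y hy]))
    have h3 : -(gam * p * lapl u y + -(lam * q) * lapl v y) =
        gam * p * (lam * q) * (a y * (u y - v y)) := by
      linear_combination gam * p * hequ' y hy - lam * q * heqv' y hy
    linarith
end

section
/- Let Ω ⊂ ℝ^N be a bounded open set, p, q > 1, λ, γ > 0, and let t, s be real numbers with t ≠ 1/2 and s ≠ 1/2. Let u, v be C² on a neighborhood of the closure of Ω, nonnegative on Ω, with u = v = 0 on ∂Ω, solving −Δu = λ p (1+u)^{p−1}(1+v)^q and −Δv = γ q (1+u)^p (1+v)^{q−1} in Ω. Assume the two energy identities (2t−1) ∫_Ω |∇u|² (1+u)^{2t−2} = λ p ∫_Ω (1+u)^{2t+p−2}(1+v)^q − λ p ∫_Ω (1+u)^{p−1}(1+v)^q and (2s−1) ∫_Ω |∇v|² (1+v)^{2s−2} = γ q ∫_Ω (1+v)^{2s+q−2}(1+u)^p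 − γ q ∫_Ω (1+v)^{q−1}(1+u)^p, and assume the stability inequality holds for φ := (1+u)^t − 1, ψ := (1+v)^s − 1, namely p(p−1) ∫_Ω (1+u)^{p−2}(1+v)^q ((1+u)^t − 1)² + q(q−1) ∫_Ω (1+v)^{q−2}(1+u)^p ((1+v)^s − 1)² + 2pq ∫_Ω (1+u)^{p−1}(1+v)^{q−1} ((1+u)^t − 1)((1+v)^s − 1) ≤ (t²/λ) ∫_Ω |∇u|² (1+u)^{2t−2} + (s²/γ) ∫_Ω |∇v|² (1+v)^{2s−2}. Then p(p−1−t²/(2t−1)) ∫_Ω (1+u)^{2t+p−2}(1+v)^q + q(q−1−s²/(2s−1)) ∫_Ω (1+v)^{2s+q−2}(1+u)^p + 2pq ∫_Ω (1+u)^{t+p−1}(1+v)^{s+q−1} + p(p−1) ∫_Ω (1+u)^{p−2}(1+v)^q + q(q−1) ∫_Ω (1+u)^p(1+v)^{q−2} + p(t²/(2t−1)) ∫_Ω (1+u)^{p−1}(1+v)^q + q(s²/(2s−1)) ∫_Ω (1+u)^p(1+v)^{q−1} ≤ 2p(p−1) ∫_Ω (1+u)^{t+p−2}(1+v)^q + 2pq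 ∫_Ω (1+u)^{t+p−1}(1+v)^{q−1} + 2q(q−1) ∫_Ω (1+u)^p(1+v)^{s+q−2} + 2pq ∫_Ω (1+u)^{p−1}(1+v)^{s+q−1}. -/
open MeasureTheory Real Set Filter Topology

/-- Products of real powers of positive functions continuous on the closure of a bounded set are
integrable on that set. -/
theorem integrableOn_rpow_mul_rpow {N : ℕ} {Ω : Set (EuclideanSpace ℝ (Fin N))}
    (hΩ : Bornology.IsBounded Ω) {A B : EuclideanSpace ℝ (Fin N) → ℝ}
    (hA : ContinuousOn A (closure Ω)) (hB : ContinuousOn B (closure Ω))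
    (hApos : ∀ x ∈ closure Ω, 0 < A x) (hBpos : ∀ x ∈ closure Ω, 0 < B x) (a b : ℝ) :
    IntegrableOn (fun x => A x ^ a * B x ^ b) Ω := by
  refine IntegrableOn.mono_set ?_ subset_closure
  refine ContinuousOn.integrableOn_compact hΩ.isCompact_closure ?_
  exact (hA.rpow_const fun x hx => Or.inl (hApos x hx).ne').mul
    (hB.rpow_const fun x hx => Or.inl (hBpos x hx).ne')

/-- Expansion of the weighted integral of the square of `A ^ t - 1`. -/
theorem integral_rpow_mul_rpow_mul_sub_one_sq {α : Type*} [MeasurableSpace α] {μ : Measure α}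
    {A B : α → ℝ} (hA : ∀ᵐ x ∂μ, 0 < A x)
    (hI : ∀ a b : ℝ, Integrable (fun x => A x ^ a * B x ^ b) μ) (a b t : ℝ) :
    ∫ x, A x ^ a * B x ^ b * (A x ^ t - 1) ^ 2 ∂μ
      = (∫ x, A x ^ (2 * t + a) * B x ^ b ∂μ) - 2 * (∫ x, A x ^ (t + a) * B x ^ b ∂μ)
        + ∫ x, A x ^ a * B x ^ b ∂μ := by
  rw [← integral_const_mul, ← integral_sub (hI _ _) ((hI _ _).const_mul 2),
    ← integral_add ((hI _ _).sub' ((hI _ _).const_mul 2)) (hI _ _)]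
  refine integral_congr_ae ?_
  filter_upwards [hA] with x hx
  rw [two_mul t, rpow_add hx, rpow_add hx, rpow_add hx]
  ring

/-- Expansion of the weighted integral of the product of `A ^ t - 1` and `B ^ s - 1`. -/
theorem integral_rpow_mul_rpow_mul_sub_one_mul_sub_one {α : Type*} [MeasurableSpace α]
    {μ : Measure α} {A B : α → ℝ} (hA : ∀ᵐ x ∂μ, 0 < A x) (hB : ∀ᵐ x ∂μ, 0 < B x)
    (hI : ∀ a b : ℝ, Integrable (fun x => A x ^ a * B x ^ b) μ) (a b t s : ℝ) :
    ∫ x, A x ^ a * B x ^ b * (A x ^ t - 1) * (B x ^ s - 1) ∂μ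
      = (∫ x, A x ^ (t + a) * B x ^ (s + b) ∂μ) - (∫ x, A x ^ (t + a) * B x ^ b ∂μ)
        - (∫ x, A x ^ a * B x ^ (s + b) ∂μ) + ∫ x, A x ^ a * B x ^ b ∂μ := by
  rw [← integral_sub (hI _ _) (hI _ _), ← integral_sub ((hI _ _).sub' (hI _ _)) (hI _ _),
    ← integral_add (((hI _ _).sub' (hI _ _)).sub' (hI _ _)) (hI _ _)]
  refine integral_congr_ae ?_
  filter_upwards [hA, hB] with x hx hx'
  rw [rpow_add hx, rpow_add hx']
  ring

/-- The general energy estimate (Lemma `stabpol` of Cowan–Fazly) for semi-stable solutions of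
the gradient system `(G)_{λ,γ}` with `f(u) = (1+u)^p`, `g(v) = (1+v)^q`, tested on
`φ = (1+u)^t − 1`, `ψ = (1+v)^s − 1`. -/
theorem stmt_14 {N : ℕ} (Ω : Set (EuclideanSpace ℝ (Fin N)))
    (hΩo : IsOpen Ω) (hΩb : Bornology.IsBounded Ω)
    (p q : ℝ) (hp : 1 < p) (hq : 1 < q)
    (lam gam : ℝ) (hlam : 0 < lam) (hgam : 0 < gam)
    (t s : ℝ) (ht : t ≠ 1 / 2) (hs : s ≠ 1 / 2)
    (u v : EuclideanSpace ℝ (Fin N) → ℝ)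
    (U : Set (EuclideanSpace ℝ (Fin N))) (hUo : IsOpen U) (hUc : closure Ω ⊆ U)
    (hu : ContDiffOn ℝ 2 u U) (hv : ContDiffOn ℝ 2 v U)
    (hupos : ∀ x ∈ Ω, 0 ≤ u x) (hvpos : ∀ x ∈ Ω, 0 ≤ v x)
    (hubd : ∀ x ∈ frontier Ω, u x = 0) (hvbd : ∀ x ∈ frontier Ω, v x = 0)
    (hequ : ∀ x ∈ Ω, - lapl u x = lam * p * (1 + u x) ^ (p - 1) * (1 + v x) ^ q)
    (heqv : ∀ x ∈ Ω, - lapl v x = gam * q * (1 + u x) ^ p * (1 + v x) ^ (q - 1))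
    (henergy_u : (2 * t - 1) * ∫ x in Ω, ‖gradient u x‖ ^ 2 * (1 + u x) ^ (2 * t - 2)
      = lam * p * (∫ x in Ω, (1 + u x) ^ (2 * t + p - 2) * (1 + v x) ^ q)
        - lam * p * ∫ x in Ω, (1 + u x) ^ (p - 1) * (1 + v x) ^ q)
    (henergy_v : (2 * s - 1) * ∫ x in Ω, ‖gradient v x‖ ^ 2 * (1 + v x) ^ (2 * s - 2)
      = gam * q * (∫ x in Ω, (1 + v x) ^ (2 * s + q - 2) * (1 + u x) ^ p)
        - gam * q * ∫ x in Ω, (1 + v x) ^ (q - 1) * (1 + u x) ^ p)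
    (hstab :
      p * (p - 1) * (∫ x in Ω, (1 + u x) ^ (p - 2) * (1 + v x) ^ q * ((1 + u x) ^ t - 1) ^ 2)
        + q * (q - 1) *
            (∫ x in Ω, (1 + v x) ^ (q - 2) * (1 + u x) ^ p * ((1 + v x) ^ s - 1) ^ 2)
        + 2 * p * q * ∫ x in Ω, (1 + u x) ^ (p - 1) * (1 + v x) ^ (q - 1)
            * ((1 + u x) ^ t - 1) * ((1 + v x) ^ s - 1)
      ≤ (t ^ 2 / lam) * (∫ x in Ω, ‖gradient u x‖ ^ 2 * (1 + u x) ^ (2 * t - 2))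
        + (s ^ 2 / gam) * ∫ x in Ω, ‖gradient v x‖ ^ 2 * (1 + v x) ^ (2 * s - 2)) :
    p * (p - 1 - t ^ 2 / (2 * t - 1)) *
        (∫ x in Ω, (1 + u x) ^ (2 * t + p - 2) * (1 + v x) ^ q)
      + q * (q - 1 - s ^ 2 / (2 * s - 1)) *
          (∫ x in Ω, (1 + v x) ^ (2 * s + q - 2) * (1 + u x) ^ p)
      + 2 * p * q * (∫ x in Ω, (1 + u x) ^ (t + p - 1) * (1 + v x) ^ (s + q - 1))
      + p * (p - 1) * (∫ x in Ω, (1 + u x) ^ (p - 2) * (1 + v x) ^ q)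
      + q * (q - 1) * (∫ x in Ω, (1 + u x) ^ p * (1 + v x) ^ (q - 2))
      + p * (t ^ 2 / (2 * t - 1)) * (∫ x in Ω, (1 + u x) ^ (p - 1) * (1 + v x) ^ q)
      + q * (s ^ 2 / (2 * s - 1)) * (∫ x in Ω, (1 + u x) ^ p * (1 + v x) ^ (q - 1))
    ≤ 2 * p * (p - 1) * (∫ x in Ω, (1 + u x) ^ (t + p - 2) * (1 + v x) ^ q)
      + 2 * p * q * (∫ x in Ω, (1 + u x) ^ (t + p - 1) * (1 + v x) ^ (q - 1))
      + 2 * q * (q - 1) * (∫ x in Ω, (1 + u x) ^ p * (1 + v x) ^ (s + q - 2))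
      + 2 * p * q * ∫ x in Ω, (1 + u x) ^ (p - 1) * (1 + v x) ^ (s + q - 1) := by
  have one_add_pos {w : EuclideanSpace ℝ (Fin N) → ℝ} (hw : ∀ x ∈ Ω, 0 ≤ w x)
      (hw0 : ∀ x ∈ frontier Ω, w x = 0) : ∀ x ∈ closure Ω, 0 < 1 + w x := by
    intro x hx
    rw [closure_eq_self_union_frontier] at hx
    rcases hx with hx | hx
    · linarith [hw x hx]
    · linarith [hw0 x hx]
  have hA := one_add_pos hupos hubd
  have hB := one_add_pos hvpos hvbd
  have hI := integrableOn_rpow_mul_rpow hΩb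
    (continuousOn_const.fun_add (hu.continuousOn.mono hUc))
    (continuousOn_const.fun_add (hv.continuousOn.mono hUc)) hA hB
  have hA' : ∀ᵐ x ∂volume.restrict Ω, 0 < 1 + u x :=
    ae_restrict_of_forall_mem hΩo.measurableSet fun x hx => hA x (subset_closure hx)
  have hB' : ∀ᵐ x ∂volume.restrict Ω, 0 < 1 + v x :=
    ae_restrict_of_forall_mem hΩo.measurableSet fun x hx => hB x (subset_closure hx)
  have hI' (b a : ℝ) : IntegrableOn (fun x => (1 + v x) ^ b * (1 + u x) ^ a) Ω := by
    simpa only [mul_comm] using hI a b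
  have hcomm (b a : ℝ) : ∫ x in Ω, (1 + v x) ^ b * (1 + u x) ^ a
      = ∫ x in Ω, (1 + u x) ^ a * (1 + v x) ^ b := by
    simp only [mul_comm]
  have ht' : 2 * t - 1 ≠ 0 := fun h => ht (by linarith)
  have hs' : 2 * s - 1 ≠ 0 := fun h => hs (by linarith)
  rw [integral_rpow_mul_rpow_mul_sub_one_sq hA' hI,
    integral_rpow_mul_rpow_mul_sub_one_sq hB' hI',
    integral_rpow_mul_rpow_mul_sub_one_mul_sub_one hA' hB' hI,
    eq_div_of_mul_eq ht' ((mul_comm _ _).trans henergy_u),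
    eq_div_of_mul_eq hs' ((mul_comm _ _).trans henergy_v)] at hstab
  have hcancel {l c d e : ℝ} (hl : 0 < l) (X Y : ℝ) :
      d ^ 2 / l * ((l * c * X - l * c * Y) / e) = c * (d ^ 2 / e) * (X - Y) := by
    have := hl.ne'
    field_simp
  rw [hcancel hlam, hcancel hgam] at hstab
  simp only [← add_sub_assoc, hcomm] at hstab ⊢
  have hpos : 0 ≤ 2 * p * q * ∫ x in Ω, (1 + u x) ^ (p - 1) * (1 + v x) ^ (q - 1) :=
    mul_nonneg (by positivity) (integral_nonneg_of_ae (by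
      filter_upwards [hA', hB'] with x hx hx' using by positivity))
  linarith
end

section
/- Let N ≥ 2, let B₁ be the open unit ball in ℝ^N, let λ, γ > 0 and let f, g : ℝ → ℝ be C³. Let u, v be radial C³ functions on the closed unit ball, vanishing on ∂B₁, solving −Δu = λ f'(u) g(v) and −Δv = γ f(u) g'(v) in B₁, and denote by u_r(x) := ∇u(x)·x/|x| and v_r(x) := ∇v(x)·x/|x| their radial derivatives. Assume the stability inequality holds: for all Lipschitz functions φ, ψ on the closed unit ball vanishing on ∂B₁, ∫_{B₁} f''(u) g(v) φ² + ∫_{B₁} f(u) g''(v) ψ² + 2 ∫_{B₁} f'(u) g'(v) φ ψ ≤ (1/λ) ∫_{B₁} |∇φ|² + (1/γ) ∫_{B₁} |∇ψ|². Then for every Lipschitz function φ on the closed unit ball vanishing on ∂B₁ one has (N−1) ∫_{B₁} (u_r²/λ + v_r²/γ) φ² ≤ ∫_{B₁} (u_r²/λ + v_r²/γ) |∇(|x| φ)|². -/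
open MeasureTheory Real Set Filter Topology Metric
open scoped RealInnerProductSpace

theorem LipschitzOnWith.exists_mul {α : Type*} [PseudoMetricSpace α] {s : Set α} {p q : α → ℝ}
    (hs : IsCompact s) (hp : ∃ K, LipschitzOnWith K p s) (hq : ∃ K, LipschitzOnWith K q s) :
    ∃ K, LipschitzOnWith K (fun x => p x * q x) s := by
  obtain ⟨A, hA⟩ := hp
  obtain ⟨B, hB⟩ := hq
  obtain ⟨a, ha⟩ := hs.exists_bound_of_continuousOn hA.continuousOn
  obtain ⟨b, hb⟩ := hs.exists_bound_of_continuousOn hB.continuousOn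
  refine ⟨(a.toNNReal * B + b.toNNReal * A), LipschitzOnWith.of_dist_le_mul fun x hx y hy => ?_⟩
  have h1 := hA.dist_le_mul x hx y hy
  have h2 := hB.dist_le_mul x hx y hy
  have h3 := (ha x hx).trans (Real.le_coe_toNNReal a)
  have h4 := (hb y hy).trans (Real.le_coe_toNNReal b)
  rw [Real.dist_eq] at h1 h2 ⊢
  rw [Real.norm_eq_abs] at h3 h4
  have h5 : p x * q x - p y * q y = p x * (q x - q y) + q y * (p x - p y) := by ring
  rw [h5]
  refine (abs_add_le _ _).trans ?_
  rw [abs_mul, abs_mul]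
  push_cast
  have h6 := mul_le_mul h3 h2 (abs_nonneg _) (NNReal.coe_nonneg _)
  have h7 := mul_le_mul h4 h1 (abs_nonneg _) (NNReal.coe_nonneg _)
  linarith

theorem Metric.closedBall_mem_nhds_of_mem_ball {α : Type*} [PseudoMetricSpace α] {c x : α} {r : ℝ}
    (hx : x ∈ ball c r) : closedBall c r ∈ 𝓝 x :=
  mem_of_superset (isOpen_ball.mem_nhds hx) ball_subset_closedBall

section NormedSpace

variable {E : Type*} [NormedAddCommGroup E] [NormedSpace ℝ E]

theorem ContDiffOn.exists_lipschitzOnWith_of_isCompact {s : Set E} {p : E → ℝ}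
    (hp : ContDiffOn ℝ 1 p s) (hs : IsCompact s) (hc : Convex ℝ s) (hu : UniqueDiffOn ℝ s) :
    ∃ K, LipschitzOnWith K p s := by
  obtain ⟨C, hC⟩ := hs.exists_bound_of_continuousOn (hp.continuousOn_fderivWithin hu le_rfl)
  refine ⟨C.toNNReal, hc.lipschitzOnWith_of_nnnorm_fderivWithin_le
    (hp.differentiableOn one_ne_zero) fun x hx => ?_⟩
  rw [← NNReal.coe_le_coe, coe_nnnorm]
  exact (hC x hx).trans (Real.le_coe_toNNReal C)

theorem uniqueDiffOn_closedBall_zero_one : UniqueDiffOn ℝ (closedBall (0 : E) 1) :=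
  uniqueDiffOn_convex (convex_closedBall _ _)
    ⟨0, ball_subset_interior_closedBall (mem_ball_self one_pos)⟩

theorem LipschitzOnWith.indicator_ball {K : NNReal} {G : E → ℝ}
    (hG : LipschitzOnWith K G (closedBall 0 1)) (h0 : ∀ x, ‖x‖ = 1 → G x = 0) :
    LipschitzWith (2 * K) ((ball (0 : E) 1).indicator G) := by
  have key : ∀ x y : E, x ∈ ball (0 : E) 1 → y ∉ ball (0 : E) 1 →
      |G x| ≤ 2 * K * dist x y := by
    intro x y hx hy
    rw [mem_ball_zero_iff] at hx
    rw [mem_ball_zero_iff, not_lt] at hy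
    have hy0 : 0 < ‖y‖ := one_pos.trans_le hy
    have hz : ‖‖y‖⁻¹ • y‖ = 1 := by
      rw [norm_smul, norm_inv, norm_norm, inv_mul_cancel₀ hy0.ne']
    have h1 := hG.dist_le_mul x (by simpa using hx.le) (‖y‖⁻¹ • y) (by simp [hz])
    rw [Real.dist_eq, h0 _ hz, sub_zero] at h1
    have h2 : dist y (‖y‖⁻¹ • y) = ‖y‖ - 1 := by
      rw [dist_eq_norm]
      nth_rewrite 1 [← one_smul ℝ y]
      rw [← sub_smul, norm_smul, Real.norm_of_nonneg, sub_mul, inv_mul_cancel₀ hy0.ne', one_mul]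
      exact sub_nonneg.2 (inv_le_one_of_one_le₀ hy)
    have h3 : ‖y‖ - ‖x‖ ≤ dist x y := by
      rw [dist_comm, dist_eq_norm]; exact norm_sub_norm_le _ _
    have h4 := dist_triangle x y (‖y‖⁻¹ • y)
    have h5 : dist x (‖y‖⁻¹ • y) ≤ 2 * dist x y := by linarith
    have := mul_le_mul_of_nonneg_left h5 K.coe_nonneg
    linarith
  refine LipschitzWith.of_dist_le_mul fun x y => ?_
  push_cast
  by_cases hx : x ∈ ball (0 : E) 1 <;> by_cases hy : y ∈ ball (0 : E) 1
  · rw [indicator_of_mem hx, indicator_of_mem hy]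
    have h1 := hG.dist_le_mul x (ball_subset_closedBall hx) y (ball_subset_closedBall hy)
    have : 0 ≤ (K : ℝ) * dist x y := by positivity
    linarith
  · rw [indicator_of_mem hx, indicator_of_notMem hy, Real.dist_eq, sub_zero]
    exact key x y hx hy
  · rw [indicator_of_notMem hx, indicator_of_mem hy, Real.dist_eq, zero_sub, abs_neg, dist_comm]
    exact key y x hy hx
  · rw [indicator_of_notMem hx, indicator_of_notMem hy, dist_self]
    positivity

variable [FiniteDimensional ℝ E] [MeasurableSpace E] [BorelSpace E] (μ : Measure E)
  [μ.IsAddHaarMeasure]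

theorem LipschitzOnWith.ae_differentiableAt_ball {K : NNReal} {G : E → ℝ}
    (hG : LipschitzOnWith K G (closedBall 0 1)) :
    ∀ᵐ x ∂(μ.restrict (ball (0 : E) 1)), DifferentiableAt ℝ G x := by
  filter_upwards [(hG.mono ball_subset_closedBall).ae_differentiableWithinAt (μ := μ)
    measurableSet_ball, ae_restrict_mem measurableSet_ball] with x hx hxb
  exact hx.differentiableAt (isOpen_ball.mem_nhds hxb)

theorem LipschitzOnWith.integrableOn_comp_fderiv {K : NNReal} {G : E → ℝ}
    (hG : LipschitzOnWith K G (closedBall 0 1)) {T : (E →L[ℝ] ℝ) → ℝ} (hT : Continuous T) :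
    IntegrableOn (fun x => T (fderiv ℝ G x)) (ball (0 : E) 1) μ := by
  obtain ⟨C, hC⟩ := (isCompact_closedBall (0 : E →L[ℝ] ℝ) K).exists_bound_of_continuousOn
    hT.continuousOn
  refine IntegrableOn.of_bound measure_ball_lt_top
    (hT.measurable.comp (measurable_fderiv ℝ G)).aestronglyMeasurable C ?_
  filter_upwards [ae_restrict_mem measurableSet_ball] with x hx
  refine hC _ ?_
  rw [mem_closedBall_zero_iff]
  exact norm_fderiv_le_of_lipschitzOn ℝ (closedBall_mem_nhds_of_mem_ball hx) hG

theorem LipschitzOnWith.integral_fderiv_ball_eq_zero {K : NNReal} {G : E → ℝ}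
    (hG : LipschitzOnWith K G (closedBall 0 1)) (h0 : ∀ x, ‖x‖ = 1 → G x = 0) (e : E) :
    ∫ x in ball (0 : E) 1, fderiv ℝ G x e ∂μ = 0 := by
  have hL := hG.indicator_ball h0
  have hcs : HasCompactSupport ((ball (0 : E) 1).indicator G) :=
    HasCompactSupport.intro (isCompact_closedBall 0 1) fun x hx =>
      indicator_of_notMem (fun h => hx (ball_subset_closedBall h)) _
  have h1 := LipschitzWith.integral_lineDeriv_mul_eq (μ := μ)
    (LipschitzWith.const (α := E) (1 : ℝ)) hL hcs (-e)
  have hc : ∀ x : E, lineDeriv ℝ (fun _ : E => (1 : ℝ)) x (-e) = 0 := fun x => by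
    simp [lineDeriv]
  simp only [hc, zero_mul, integral_zero, neg_neg, mul_one] at h1
  have h2 : ∀ᵐ x ∂μ, lineDeriv ℝ ((ball (0 : E) 1).indicator G) x e
      = (ball (0 : E) 1).indicator (fun x => fderiv ℝ G x e) x := by
    have hs : ∀ᵐ x ∂μ, x ∉ sphere (0 : E) 1 :=
      measure_eq_zero_iff_ae_notMem.1 (Measure.addHaar_sphere_of_ne_zero μ 0 one_ne_zero)
    filter_upwards [hs, hL.ae_differentiableAt (μ := μ)] with x hx hd
    rw [hd.lineDeriv_eq_fderiv]
    by_cases hxb : x ∈ ball (0 : E) 1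
    · rw [indicator_of_mem hxb]
      have : (ball (0 : E) 1).indicator G =ᶠ[𝓝 x] G := by
        filter_upwards [isOpen_ball.mem_nhds hxb] with y hy using indicator_of_mem hy _
      rw [this.fderiv_eq]
    · rw [indicator_of_notMem hxb]
      have hxc : x ∈ (closedBall (0 : E) 1)ᶜ := by
        simp only [mem_ball_zero_iff, mem_sphere_zero_iff_norm, mem_compl_iff,
          mem_closedBall_zero_iff, not_lt, not_le] at *
        exact lt_of_le_of_ne hxb (Ne.symm hx)
      have : (ball (0 : E) 1).indicator G =ᶠ[𝓝 x] fun _ => 0 := by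
        filter_upwards [isClosed_closedBall.isOpen_compl.mem_nhds hxc] with y hy
        exact indicator_of_notMem (fun h => hy (ball_subset_closedBall h)) _
      rw [this.fderiv_eq]
      simp
  rw [← integral_indicator measurableSet_ball, ← integral_congr_ae h2, ← h1]

end NormedSpace

section Euclidean

variable {N : ℕ}

/-- The `i`-th partial derivative of a function on the closed unit ball. -/
noncomputable def partialDerivBall (i : Fin N) (h : EuclideanSpace ℝ (Fin N) → ℝ)
    (x : EuclideanSpace ℝ (Fin N)) : ℝ :=
  fderivWithin ℝ h (closedBall 0 1) x (EuclideanSpace.single i 1)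

theorem ContDiffOn.partialDerivBall {m n : WithTop ℕ∞} {h : EuclideanSpace ℝ (Fin N) → ℝ}
    (hh : ContDiffOn ℝ n h (closedBall 0 1)) (hmn : m + 1 ≤ n) (i : Fin N) :
    ContDiffOn ℝ m (partialDerivBall i h) (closedBall 0 1) :=
  (hh.fderivWithin uniqueDiffOn_closedBall_zero_one hmn).clm_apply contDiffOn_const

theorem partialDerivBall_congr {h k : EuclideanSpace ℝ (Fin N) → ℝ}
    (hk : EqOn h k (closedBall 0 1)) (i : Fin N) :
    EqOn (partialDerivBall i h) (partialDerivBall i k) (closedBall 0 1) := fun x hx => by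
  rw [partialDerivBall, partialDerivBall, fderivWithin_congr hk (hk hx)]

theorem partialDerivBall_of_mem_ball (h : EuclideanSpace ℝ (Fin N) → ℝ) (i : Fin N)
    {x : EuclideanSpace ℝ (Fin N)} (hx : x ∈ ball 0 1) :
    partialDerivBall i h x = fderiv ℝ h x (EuclideanSpace.single i 1) := by
  rw [partialDerivBall, fderivWithin_of_mem_nhds (closedBall_mem_nhds_of_mem_ball hx)]

theorem partialDerivBall_partialDerivBall {h : EuclideanSpace ℝ (Fin N) → ℝ}
    (hh : ContDiffOn ℝ 2 h (closedBall 0 1)) (i j : Fin N) {x : EuclideanSpace ℝ (Fin N)}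
    (hx : x ∈ closedBall 0 1) :
    partialDerivBall i (partialDerivBall j h) x =
      fderivWithin ℝ (fderivWithin ℝ h (closedBall 0 1)) (closedBall 0 1) x
        (EuclideanSpace.single i 1) (EuclideanSpace.single j 1) := by
  have hd : DifferentiableWithinAt ℝ (fderivWithin ℝ h (closedBall 0 1)) (closedBall 0 1) x :=
    (hh.fderivWithin (m := 1) uniqueDiffOn_closedBall_zero_one
      (by norm_num)).differentiableOn one_ne_zero x hx
  have := fderivWithin_clm_apply (uniqueDiffOn_closedBall_zero_one x hx) hd
    (differentiableWithinAt_const (EuclideanSpace.single j (1 : ℝ)))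
  change fderivWithin ℝ (fun y => fderivWithin ℝ h (closedBall 0 1) y _) (closedBall 0 1) x _ = _
  rw [this]
  simp

theorem partialDerivBall_comm {h : EuclideanSpace ℝ (Fin N) → ℝ}
    (hh : ContDiffOn ℝ 2 h (closedBall 0 1)) (i j : Fin N) :
    EqOn (partialDerivBall i (partialDerivBall j h)) (partialDerivBall j (partialDerivBall i h))
      (closedBall 0 1) := fun x hx => by
  rw [partialDerivBall_partialDerivBall hh i j hx, partialDerivBall_partialDerivBall hh j i hx]
  refine (hh x hx).isSymmSndFDerivWithinAt (by simp) uniqueDiffOn_closedBall_zero_one ?_ hx _ _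
  have hi : (interior (closedBall (0 : EuclideanSpace ℝ (Fin N)) 1)).Nonempty :=
    ⟨0, ball_subset_interior_closedBall (mem_ball_self one_pos)⟩
  rw [(convex_closedBall _ _).closure_interior_eq_closure_of_nonempty_interior hi]
  exact subset_closure hx

theorem lapl_eq_sum_partialDerivBall {h : EuclideanSpace ℝ (Fin N) → ℝ}
    (hh : ContDiffOn ℝ 2 h (closedBall 0 1)) {x : EuclideanSpace ℝ (Fin N)}
    (hx : x ∈ ball 0 1) :
    lapl h x = ∑ j, partialDerivBall j (partialDerivBall j h) x := by
  refine Finset.sum_congr rfl fun j _ => ?_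
  rw [partialDerivBall_partialDerivBall hh j j (ball_subset_closedBall hx),
    iteratedFDeriv_two_apply, fderivWithin_of_mem_nhds (closedBall_mem_nhds_of_mem_ball hx)]
  have : fderivWithin ℝ h (closedBall 0 1) =ᶠ[𝓝 x] fderiv ℝ h := by
    filter_upwards [isOpen_ball.mem_nhds hx] with y hy
    exact fderivWithin_of_mem_nhds (closedBall_mem_nhds_of_mem_ball hy)
  rw [this.fderiv_eq]
  simp

theorem sum_partialDerivBall_eq_fderiv_lapl {h : EuclideanSpace ℝ (Fin N) → ℝ}
    (hh : ContDiffOn ℝ 3 h (closedBall 0 1)) (i : Fin N) {x : EuclideanSpace ℝ (Fin N)}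
    (hx : x ∈ ball 0 1) :
    ∑ j, partialDerivBall j (partialDerivBall j (partialDerivBall i h)) x =
      fderiv ℝ (lapl h) x (EuclideanSpace.single i 1) := by
  have hxc := ball_subset_closedBall hx
  have hh2 : ContDiffOn ℝ 2 h (closedBall 0 1) := hh.of_le (by norm_num)
  have hev : lapl h =ᶠ[𝓝 x] fun y => ∑ j, partialDerivBall j (partialDerivBall j h) y := by
    filter_upwards [isOpen_ball.mem_nhds hx] with y hy using lapl_eq_sum_partialDerivBall hh2 hy
  have hd : ∀ j, ContDiffOn ℝ 1 (partialDerivBall j (partialDerivBall j h)) (closedBall 0 1) :=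
    fun j => (hh.partialDerivBall (m := 2) (by norm_num) j).partialDerivBall (by norm_num) j
  rw [hev.fderiv_eq, fderiv_fun_sum fun j _ => ((hd j).contDiffAt
    (closedBall_mem_nhds_of_mem_ball hx)).differentiableAt one_ne_zero]
  rw [_root_.sum_apply]
  refine Finset.sum_congr rfl fun j _ => ?_
  rw [← partialDerivBall_of_mem_ball _ _ hx,
    partialDerivBall_comm (hh.partialDerivBall (m := 2) (by norm_num) j) i j hxc]
  exact partialDerivBall_congr (partialDerivBall_comm hh2 j i) j hxc

theorem gradient_apply_eq_fderiv_single (h : EuclideanSpace ℝ (Fin N) → ℝ)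
    (x : EuclideanSpace ℝ (Fin N)) (i : Fin N) :
    gradient h x i = fderiv ℝ h x (EuclideanSpace.single i 1) := by
  rw [← toDual_gradient, InnerProductSpace.toDual_apply_apply, EuclideanSpace.inner_single_right]
  simp

theorem norm_gradient_sq (h : EuclideanSpace ℝ (Fin N) → ℝ) (x : EuclideanSpace ℝ (Fin N)) :
    ‖gradient h x‖ ^ 2 = ∑ j, fderiv ℝ h x (EuclideanSpace.single j 1) ^ 2 := by
  simp_rw [EuclideanSpace.real_norm_sq_eq, gradient_apply_eq_fderiv_single]

theorem gradient_eq_smul_of_radial {u : EuclideanSpace ℝ (Fin N) → ℝ}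
    (hu : ∀ x y, ‖x‖ = ‖y‖ → u x = u y) (x : EuclideanSpace ℝ (Fin N)) :
    gradient u x = (⟪gradient u x, x⟫ / ‖x‖) • (‖x‖⁻¹ • x) := by
  set R := (Submodule.span ℝ {x}).reflection with hR
  have hRx : R x = x := by
    rw [hR, Submodule.reflection_eq_self_iff]; exact Submodule.mem_span_singleton_self x
  have huR : u ∘ R = u := funext fun y => hu _ _ (R.norm_map y)
  have h1 : fderiv ℝ u x = (fderiv ℝ u x).comp (R.toContinuousLinearEquiv : _ →L[ℝ] _) := by
    have := R.toContinuousLinearEquiv.comp_right_fderiv (f := u) (x := x)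
    have h2 : u ∘ R.toContinuousLinearEquiv = u := huR
    have h3 : R.toContinuousLinearEquiv x = x := hRx
    rwa [h2, h3] at this
  have h2 : R (gradient u x) = gradient u x := by
    refine ext_inner_right ℝ fun y => ?_
    have h3 : ⟪gradient u x, R y⟫ = ⟪gradient u x, y⟫ := by
      have := congrArg (fun L => L y) h1
      rw [← toDual_gradient] at this
      simpa [InnerProductSpace.toDual_apply_apply] using this.symm
    have h4 : R (R y) = y := Submodule.reflection_reflection _ y
    rw [← h3, ← h4, R.inner_map_map, h4]
  rw [hR, Submodule.reflection_eq_self_iff, Submodule.mem_span_singleton] at h2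
  obtain ⟨c, hc⟩ := h2
  rcases eq_or_ne x 0 with rfl | hx
  · simp [← hc]
  · rw [← hc, inner_smul_left, real_inner_self_eq_norm_sq, smul_smul]
    have : ‖x‖ ≠ 0 := norm_ne_zero_iff.2 hx
    congr 1
    simp only [conj_trivial]
    field_simp

theorem fderiv_coord_div_norm {x : EuclideanSpace ℝ (Fin N)} (hx : x ≠ 0) (i j : Fin N) :
    DifferentiableAt ℝ (fun y : EuclideanSpace ℝ (Fin N) => y i * ‖y‖⁻¹) x ∧
    fderiv ℝ (fun y : EuclideanSpace ℝ (Fin N) => y i * ‖y‖⁻¹) x (EuclideanSpace.single j 1) =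
      (if i = j then ‖x‖⁻¹ else 0) - x i * x j * ‖x‖⁻¹ ^ 3 := by
  have hn : ‖x‖ ≠ 0 := norm_ne_zero_iff.2 hx
  have h1 : HasFDerivAt (fun y : EuclideanSpace ℝ (Fin N) => y i)
      (EuclideanSpace.proj i : EuclideanSpace ℝ (Fin N) →L[ℝ] ℝ) x :=
    (EuclideanSpace.proj i : EuclideanSpace ℝ (Fin N) →L[ℝ] ℝ).hasFDerivAt
  have h2 : HasFDerivAt (fun y : EuclideanSpace ℝ (Fin N) => ‖y‖) (‖x‖⁻¹ • innerSL ℝ x) x := by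
    have h := (hasStrictFDerivAt_norm_sq x).hasFDerivAt.sqrt (by positivity)
    simp only [Real.sqrt_sq (norm_nonneg _)] at h
    refine h.congr_fderiv ?_
    ext y
    simp
    field_simp
  have h3 := h1.mul ((hasDerivAt_inv hn).comp_hasFDerivAt x h2)
  refine ⟨h3.differentiableAt, ?_⟩
  have h4 := h3.fderiv
  change fderiv ℝ (fun y : EuclideanSpace ℝ (Fin N) => y i * ‖y‖⁻¹) x = _ at h4
  rw [h4]
  simp [EuclideanSpace.inner_single_right]
  split_ifs <;> field_simp <;> ring

/-- For `x ≠ 0`, the unit vector field `n = x / |x|` satisfies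
`∑ᵢ |∇(Φ nᵢ)|² = |∇Φ|² + (N - 1) Φ² / |x|²`. -/
theorem sum_sq_fderiv_mul_coord_div_norm {Φ : EuclideanSpace ℝ (Fin N) → ℝ}
    {x : EuclideanSpace ℝ (Fin N)} (hx : x ≠ 0) (hΦ : DifferentiableAt ℝ Φ x) :
    ∑ i, ∑ j, fderiv ℝ (fun y => Φ y * (y i * ‖y‖⁻¹)) x (EuclideanSpace.single j 1) ^ 2 =
      ‖gradient Φ x‖ ^ 2 + (N - 1) * (Φ x * ‖x‖⁻¹) ^ 2 := by
  have hn : ‖x‖ ≠ 0 := norm_ne_zero_iff.2 hx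
  have hs := EuclideanSpace.real_norm_sq_eq x
  set r := ‖x‖⁻¹ with hr
  have hrs : (∑ i, x i ^ 2) * r ^ 2 = 1 := by rw [← hs, hr]; field_simp
  set c := fun j => fderiv ℝ Φ x (EuclideanSpace.single j 1) with hc
  have h1 : ∀ i j, fderiv ℝ (fun y => Φ y * (y i * ‖y‖⁻¹)) x (EuclideanSpace.single j 1) =
      Φ x * ((if i = j then r else 0) - x i * x j * r ^ 3) + x i * r * c j := by
    intro i j
    rw [fderiv_fun_mul hΦ (fderiv_coord_div_norm hx i j).1]
    simp only [_root_.add_apply, _root_.smul_apply, smul_eq_mul,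
      (fderiv_coord_div_norm hx i j).2]
    rfl
  have h2 : ∀ i j, (Φ x * ((if i = j then r else 0) - x i * x j * r ^ 3) + x i * r * c j) ^ 2 =
      (if i = j then Φ x ^ 2 * r ^ 2 - 2 * Φ x ^ 2 * r ^ 4 * x i ^ 2
          + 2 * Φ x * r ^ 2 * (x i * c i) else 0)
        + Φ x ^ 2 * r ^ 6 * (x i ^ 2 * x j ^ 2) - 2 * Φ x * r ^ 4 * (x i ^ 2 * (x j * c j))
        + r ^ 2 * (x i ^ 2 * c j ^ 2) := by
    intro i j
    split_ifs with h
    · subst h; ring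
    · ring
  simp_rw [norm_gradient_sq, h1, h2, Finset.sum_add_distrib, Finset.sum_sub_distrib,
    Finset.sum_add_distrib, Finset.sum_ite_eq, Finset.mem_univ, if_true,
    Finset.sum_add_distrib, Finset.sum_sub_distrib, ← Finset.mul_sum, ← Finset.sum_mul]
  simp only [Finset.sum_const, Finset.card_univ, Fintype.card_fin, nsmul_eq_mul]
  generalize (∑ i, x i * c i) = A
  generalize (∑ i, c i ^ 2) = B
  generalize (∑ i, x i ^ 2) = S at *
  have h4 : r ^ 4 * S = r ^ 2 := by linear_combination r ^ 2 * hrs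
  have h6 : r ^ 6 * S ^ 2 = r ^ 2 := by linear_combination r ^ 2 * (S * r ^ 2 + 1) * hrs
  linear_combination (-2 * Φ x ^ 2 - 2 * Φ x * A) * h4 + Φ x ^ 2 * h6 + B * hrs

theorem inner_gradient_mul_norm_sq_of_radial {u : EuclideanSpace ℝ (Fin N) → ℝ}
    (hu : ∀ x y, ‖x‖ = ‖y‖ → u x = u y) (w x : EuclideanSpace ℝ (Fin N)) :
    ⟪w, gradient u x⟫ * ‖x‖ ^ 2 = ⟪w, x⟫ * ⟪gradient u x, x⟫ := by
  rcases eq_or_ne x 0 with rfl | hx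
  · simp
  · have hn : ‖x‖ ≠ 0 := norm_ne_zero_iff.2 hx
    nth_rewrite 1 [gradient_eq_smul_of_radial hu x]
    rw [inner_smul_right, inner_smul_right]
    field_simp

theorem inner_gradient_div_norm_sq_of_radial {u : EuclideanSpace ℝ (Fin N) → ℝ}
    (hu : ∀ x y, ‖x‖ = ‖y‖ → u x = u y) (x : EuclideanSpace ℝ (Fin N)) :
    (⟪gradient u x, x⟫ / ‖x‖) ^ 2 = ‖gradient u x‖ ^ 2 := by
  rcases eq_or_ne x 0 with rfl | hx
  · have := gradient_eq_smul_of_radial hu 0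
    rw [smul_zero, smul_zero] at this
    simp [this]
  · have hn : ‖x‖ ≠ 0 := norm_ne_zero_iff.2 hx
    have := inner_gradient_mul_norm_sq_of_radial hu (gradient u x) x
    rw [real_inner_self_eq_norm_sq] at this
    field_simp
    linarith

theorem ContinuousOn.integrableOn_ball {h : EuclideanSpace ℝ (Fin N) → ℝ}
    (hh : ContinuousOn h (closedBall 0 1)) : IntegrableOn h (ball 0 1) :=
  (hh.integrableOn_compact (isCompact_closedBall 0 1)).mono_set ball_subset_closedBall

/-- The pointwise form of the second variation identity for a radial function `u`, tested with
`u_r η`. -/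
theorem second_variation_pointwise {u φ Φ : EuclideanSpace ℝ (Fin N) → ℝ}
    (hrad : ∀ x y, ‖x‖ = ‖y‖ → u x = u y) (hu : ContDiffOn ℝ 3 u (closedBall 0 1))
    (hΦ : ∀ x ∈ ball (0 : EuclideanSpace ℝ (Fin N)) 1, Φ x = ⟪gradient u x, x⟫ * φ x)
    {x : EuclideanSpace ℝ (Fin N)} (hx : x ∈ ball 0 1) (hx0 : x ≠ 0)
    (hφd : DifferentiableAt ℝ φ x) (hΦd : DifferentiableAt ℝ Φ x) :
    ‖gradient Φ x‖ ^ 2 + (N - 1) * (‖gradient u x‖ ^ 2 * φ x ^ 2) =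
      ‖gradient u x‖ ^ 2 * ‖gradient (fun y => ‖y‖ * φ y) x‖ ^ 2
        - fderiv ℝ (lapl u) x (gradient u x) * (‖x‖ * φ x) ^ 2
        + ∑ i, ∑ j, fderiv ℝ (fun y => partialDerivBall j (partialDerivBall i u) y *
            (partialDerivBall i u y * ((‖y‖ * φ y) * (‖y‖ * φ y)))) x
              (EuclideanSpace.single j 1) := by
  have hn : ‖x‖ ≠ 0 := norm_ne_zero_iff.2 hx0
  have hnhds := closedBall_mem_nhds_of_mem_ball hx
  set η := fun y : EuclideanSpace ℝ (Fin N) => ‖y‖ * φ y with hη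
  have hηd : DifferentiableAt ℝ η x := (differentiableAt_id.norm ℝ hx0).mul hφd
  have hp : ∀ i, ContDiffOn ℝ 2 (partialDerivBall i u) (closedBall 0 1) :=
    fun i => hu.partialDerivBall (by norm_num) i
  have hpd : ∀ i, DifferentiableAt ℝ (partialDerivBall i u) x := fun i =>
    ((hp i).contDiffAt hnhds).differentiableAt two_ne_zero
  have hppd : ∀ i j, DifferentiableAt ℝ (partialDerivBall j (partialDerivBall i u)) x :=
    fun i j => (((hp i).partialDerivBall (m := 1) (by norm_num) j).contDiffAt
      hnhds).differentiableAt one_ne_zero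
  have hgrad : ∀ y ∈ ball (0 : EuclideanSpace ℝ (Fin N)) 1, ∀ i,
      partialDerivBall i u y = gradient u y i := fun y hy i => by
    rw [partialDerivBall_of_mem_ball _ _ hy, gradient_apply_eq_fderiv_single]
  have h1 : ∀ i j, fderiv ℝ (fun y => Φ y * (y i * ‖y‖⁻¹)) x (EuclideanSpace.single j 1) =
      partialDerivBall i u x * fderiv ℝ η x (EuclideanSpace.single j 1) +
        η x * partialDerivBall j (partialDerivBall i u) x := by
    intro i j
    have hev : (fun y => Φ y * (y i * ‖y‖⁻¹)) =ᶠ[𝓝 x] fun y => partialDerivBall i u y * η y := by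
      filter_upwards [isOpen_ball.mem_nhds hx, isOpen_ne.mem_nhds hx0] with y hy hy0
      have hyn : ‖y‖ ≠ 0 := norm_ne_zero_iff.2 hy0
      have hc : gradient u y i = ⟪gradient u y, y⟫ / ‖y‖ * (‖y‖⁻¹ * y i) :=
        congrArg (fun z : EuclideanSpace ℝ (Fin N) => z i) (gradient_eq_smul_of_radial hrad y)
      rw [hΦ y hy, hgrad y hy i, hc]
      simp only [hη]
      field_simp
    rw [hev.fderiv_eq, fderiv_fun_mul (hpd i) hηd, partialDerivBall_of_mem_ball _ j hx]
    rfl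
  have h2 : ∀ i j, fderiv ℝ (fun y => partialDerivBall j (partialDerivBall i u) y *
        (partialDerivBall i u y * (η y * η y))) x (EuclideanSpace.single j 1) =
      partialDerivBall j (partialDerivBall j (partialDerivBall i u)) x
          * (partialDerivBall i u x * η x ^ 2)
        + partialDerivBall j (partialDerivBall i u) x *
          (partialDerivBall j (partialDerivBall i u) x * η x ^ 2
            + 2 * partialDerivBall i u x * η x * fderiv ℝ η x (EuclideanSpace.single j 1)) := by
    intro i j
    rw [fderiv_fun_mul (hppd i j) ((hpd i).fun_mul (hηd.fun_mul hηd)),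
      fderiv_fun_mul (hpd i) (hηd.fun_mul hηd), fderiv_fun_mul hηd hηd]
    simp only [_root_.add_apply, _root_.smul_apply, smul_eq_mul,
      ← partialDerivBall_of_mem_ball _ j hx]
    ring
  have h3 : fderiv ℝ (lapl u) x (gradient u x) = ∑ i, ∑ j,
      partialDerivBall j (partialDerivBall j (partialDerivBall i u)) x
        * partialDerivBall i u x := by
    have : gradient u x = ∑ i, partialDerivBall i u x • EuclideanSpace.single i (1 : ℝ) := by
      ext k
      simp [hgrad x hx, Finset.sum_apply, Pi.single_apply]
    rw [this, map_sum]
    refine Finset.sum_congr rfl fun i _ => ?_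
    rw [map_smul, smul_eq_mul, ← sum_partialDerivBall_eq_fderiv_lapl hu i hx, mul_comm,
      Finset.sum_mul]
  have h4 : ‖gradient u x‖ ^ 2 = ∑ i, partialDerivBall i u x ^ 2 := by
    rw [EuclideanSpace.real_norm_sq_eq]
    exact Finset.sum_congr rfl fun i _ => by rw [hgrad x hx]
  have h5 := sum_sq_fderiv_mul_coord_div_norm hx0 hΦd
  have h6 : (Φ x * ‖x‖⁻¹) ^ 2 = ‖gradient u x‖ ^ 2 * φ x ^ 2 := by
    rw [hΦ x hx, ← inner_gradient_div_norm_sq_of_radial hrad]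
    ring
  rw [h6] at h5
  rw [← h5, h3, norm_gradient_sq η, h4, Finset.sum_mul_sum, Finset.sum_mul,
    ← Finset.sum_sub_distrib, ← Finset.sum_add_distrib]
  refine Finset.sum_congr rfl fun i _ => ?_
  rw [Finset.sum_mul, ← Finset.sum_sub_distrib, ← Finset.sum_add_distrib]
  refine Finset.sum_congr rfl fun j _ => ?_
  rw [h1, h2]
  ring

/-- The second variation identity for a radial function `u`, tested with `u_r η` where
`η = |x| φ`. -/
theorem second_variation_integral {u φ Φ : EuclideanSpace ℝ (Fin N) → ℝ} (hN : N ≠ 0)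
    (hrad : ∀ x y, ‖x‖ = ‖y‖ → u x = u y) (hu : ContDiffOn ℝ 3 u (closedBall 0 1))
    (hφ : ∃ K, LipschitzOnWith K φ (closedBall 0 1)) (hφ0 : ∀ x, ‖x‖ = 1 → φ x = 0)
    (hΦL : ∃ K, LipschitzOnWith K Φ (closedBall 0 1))
    (hΦ : ∀ x ∈ ball (0 : EuclideanSpace ℝ (Fin N)) 1, Φ x = ⟪gradient u x, x⟫ * φ x) :
    IntegrableOn (fun x => ‖gradient u x‖ ^ 2 * φ x ^ 2) (ball 0 1) ∧
    IntegrableOn (fun x => ‖gradient u x‖ ^ 2 * ‖gradient (fun y => ‖y‖ * φ y) x‖ ^ 2)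
      (ball 0 1) ∧
    (∫ x in ball 0 1, ‖gradient Φ x‖ ^ 2)
        + (N - 1) * ∫ x in ball 0 1, ‖gradient u x‖ ^ 2 * φ x ^ 2 =
      (∫ x in ball 0 1, ‖gradient u x‖ ^ 2 * ‖gradient (fun y => ‖y‖ * φ y) x‖ ^ 2)
        - ∫ x in ball 0 1, fderiv ℝ (lapl u) x (gradient u x) * (‖x‖ * φ x) ^ 2 := by
  have : Nonempty (Fin N) := ⟨⟨0, Nat.pos_of_ne_zero hN⟩⟩
  have hK := isCompact_closedBall (0 : EuclideanSpace ℝ (Fin N)) 1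
  have hp : ∀ i, ContDiffOn ℝ 2 (partialDerivBall i u) (closedBall 0 1) :=
    fun i => hu.partialDerivBall (by norm_num) i
  have hpp : ∀ i j, ContDiffOn ℝ 1 (partialDerivBall j (partialDerivBall i u)) (closedBall 0 1) :=
    fun i j => (hp i).partialDerivBall (by norm_num) j
  have hlip : ∀ h : EuclideanSpace ℝ (Fin N) → ℝ, ContDiffOn ℝ 1 h (closedBall 0 1) →
      ∃ K, LipschitzOnWith K h (closedBall 0 1) := fun h hh =>
    hh.exists_lipschitzOnWith_of_isCompact hK (convex_closedBall _ _)
      uniqueDiffOn_closedBall_zero_one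
  set η := fun y : EuclideanSpace ℝ (Fin N) => ‖y‖ * φ y with hη
  have hηL : ∃ K, LipschitzOnWith K η (closedBall 0 1) :=
    LipschitzOnWith.exists_mul hK ⟨1, lipschitzWith_one_norm.lipschitzOnWith⟩ hφ
  set X := fun (i j : Fin N) (y : EuclideanSpace ℝ (Fin N)) =>
    partialDerivBall j (partialDerivBall i u) y * (partialDerivBall i u y * (η y * η y)) with hX
  have hXL : ∀ i j, ∃ K, LipschitzOnWith K (X i j) (closedBall 0 1) := fun i j =>
    LipschitzOnWith.exists_mul hK (hlip _ (hpp i j)) (LipschitzOnWith.exists_mul hK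
      (hlip _ ((hp i).of_le (by norm_num))) (LipschitzOnWith.exists_mul hK hηL hηL))
  have hX0 : ∀ i j x, ‖x‖ = 1 → X i j x = 0 := fun i j x hx => by simp [hX, hη, hφ0 x hx]
  have hφc : ContinuousOn φ (closedBall 0 1) := by obtain ⟨K, h⟩ := hφ; exact h.continuousOn
  have hηc : ContinuousOn η (closedBall 0 1) := by obtain ⟨K, h⟩ := hηL; exact h.continuousOn
  have hgrad : EqOn (fun x => ‖gradient u x‖ ^ 2) (fun x => ∑ i, partialDerivBall i u x ^ 2)
      (ball 0 1) := fun x hx => by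
    simp only [norm_gradient_sq, partialDerivBall_of_mem_ball _ _ hx]
  have hgc : ContinuousOn (fun x => ∑ i, partialDerivBall i u x ^ 2) (closedBall 0 1) :=
    continuousOn_finsetSum _ fun i _ => (hp i).continuousOn.pow 2
  have hgradsq : ∀ h : EuclideanSpace ℝ (Fin N) → ℝ,
      (∃ K, LipschitzOnWith K h (closedBall 0 1)) →
      IntegrableOn (fun x => ‖gradient h x‖ ^ 2) (ball 0 1) := by
    rintro h ⟨K, hh⟩
    have := hh.integrableOn_comp_fderiv volume
      (T := fun L => ∑ j, L (EuclideanSpace.single j 1) ^ 2) (by fun_prop)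
    simpa only [norm_gradient_sq] using this
  have hI1 := hgradsq Φ hΦL
  have hI2 : IntegrableOn (fun x => ‖gradient u x‖ ^ 2 * φ x ^ 2) (ball 0 1) :=
    (hgc.mul (hφc.pow 2)).integrableOn_ball.congr_fun
      (fun x hx => by simp only [← hgrad hx, Pi.mul_apply, Pi.pow_apply]) measurableSet_ball
  have hI3 : IntegrableOn (fun x => ‖gradient u x‖ ^ 2 * ‖gradient η x‖ ^ 2) (ball 0 1) :=
    (IntegrableOn.continuousOn_mul_of_subset hgc (hgradsq η hηL) hK measurableSet_ball
      ball_subset_closedBall).congr_fun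
      (fun x hx => by simp only [← hgrad hx]) measurableSet_ball
  have hI4 : IntegrableOn (fun x => fderiv ℝ (lapl u) x (gradient u x) * (‖x‖ * φ x) ^ 2)
      (ball 0 1) := by
    have hc : ContinuousOn (fun x => (∑ i, (∑ j,
        partialDerivBall j (partialDerivBall j (partialDerivBall i u)) x)
          * partialDerivBall i u x) * η x ^ 2) (closedBall 0 1) :=
      (continuousOn_finsetSum _ fun i _ => (continuousOn_finsetSum _ fun j _ =>
        ((hpp i j).partialDerivBall (m := 0) (by norm_num) j).continuousOn).mul
          (hp i).continuousOn).mul (hηc.pow 2)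
    refine hc.integrableOn_ball.congr_fun (fun x hx => ?_) measurableSet_ball
    have : gradient u x = ∑ i, partialDerivBall i u x • EuclideanSpace.single i (1 : ℝ) := by
      ext k
      simp [partialDerivBall_of_mem_ball _ _ hx, gradient_apply_eq_fderiv_single, Pi.single_apply]
    simp only [this, map_sum, map_smul, smul_eq_mul, hη]
    congr 1
    refine Finset.sum_congr rfl fun i _ => ?_
    rw [sum_partialDerivBall_eq_fderiv_lapl hu i hx, mul_comm]
  have hI5 : ∀ i j, IntegrableOn (fun x => fderiv ℝ (X i j) x (EuclideanSpace.single j 1))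
      (ball 0 1) := fun i j => by
    obtain ⟨K, h⟩ := hXL i j
    exact h.integrableOn_comp_fderiv volume (T := fun L => L (EuclideanSpace.single j 1))
      (by fun_prop)
  have hI5' : IntegrableOn (fun x => ∑ i, ∑ j, fderiv ℝ (X i j) x (EuclideanSpace.single j 1))
      (ball 0 1) :=
    integrable_finsetSum _ fun i _ => integrable_finsetSum _ fun j _ => hI5 i j
  have hdiv : ∫ x in ball 0 1, ∑ i, ∑ j, fderiv ℝ (X i j) x (EuclideanSpace.single j 1) = 0 := by
    rw [integral_finsetSum _ fun i _ => integrable_finsetSum _ fun j _ => hI5 i j]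
    refine Finset.sum_eq_zero fun i _ => ?_
    rw [integral_finsetSum _ fun j _ => hI5 i j]
    refine Finset.sum_eq_zero fun j _ => ?_
    obtain ⟨K, h⟩ := hXL i j
    exact h.integral_fderiv_ball_eq_zero volume (hX0 i j) _
  refine ⟨hI2, hI3, ?_⟩
  have hae : ∀ᵐ x ∂(volume.restrict (ball (0 : EuclideanSpace ℝ (Fin N)) 1)),
      ‖gradient Φ x‖ ^ 2 + (N - 1) * (‖gradient u x‖ ^ 2 * φ x ^ 2) =
        ‖gradient u x‖ ^ 2 * ‖gradient η x‖ ^ 2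
        - fderiv ℝ (lapl u) x (gradient u x) * (‖x‖ * φ x) ^ 2
        + ∑ i, ∑ j, fderiv ℝ (X i j) x (EuclideanSpace.single j 1) := by
    obtain ⟨K, hφ⟩ := hφ
    obtain ⟨K', hΦL⟩ := hΦL
    have h0 : ∀ᵐ x ∂(volume.restrict (ball (0 : EuclideanSpace ℝ (Fin N)) 1)), x ≠ 0 :=
      ae_restrict_of_ae (Measure.ae_ne volume 0)
    filter_upwards [hφ.ae_differentiableAt_ball volume, hΦL.ae_differentiableAt_ball volume, h0,
      ae_restrict_mem measurableSet_ball] with x h1 h2 h3 h4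
    exact second_variation_pointwise hrad hu hΦ h4 h3 h1 h2
  have hI34 : IntegrableOn (fun x => ‖gradient u x‖ ^ 2 * ‖gradient η x‖ ^ 2
      - fderiv ℝ (lapl u) x (gradient u x) * (‖x‖ * φ x) ^ 2) (ball 0 1) := hI3.sub hI4
  have hint := integral_congr_ae hae
  rw [integral_add hI1 (hI2.const_mul _), integral_const_mul,
    integral_add hI34 hI5', integral_sub hI3 hI4, hdiv, add_zero] at hint
  exact hint

theorem fderiv_lapl_of_eq_mul_comp {u v w : EuclideanSpace ℝ (Fin N) → ℝ} {F G : ℝ → ℝ} {c : ℝ}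
    (hF : Differentiable ℝ F) (hG : Differentiable ℝ G)
    (hw : ∀ x ∈ ball (0 : EuclideanSpace ℝ (Fin N)) 1, - lapl w x = c * F (u x) * G (v x))
    {x : EuclideanSpace ℝ (Fin N)} (hx : x ∈ ball 0 1)
    (hu : DifferentiableAt ℝ u x) (hv : DifferentiableAt ℝ v x) (e : EuclideanSpace ℝ (Fin N)) :
    fderiv ℝ (lapl w) x e = -(c * (deriv F (u x) * G (v x) * ⟪gradient u x, e⟫
      + F (u x) * deriv G (v x) * ⟪gradient v x, e⟫)) := by
  have hev : lapl w =ᶠ[𝓝 x] fun y => -(c * (F (u y) * G (v y))) := by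
    filter_upwards [isOpen_ball.mem_nhds hx] with y hy
    linear_combination - hw y hy
  have h1 : HasFDerivAt (fun y => F (u y)) (deriv F (u x) • fderiv ℝ u x) x :=
    (hF (u x)).hasDerivAt.comp_hasFDerivAt x hu.hasFDerivAt
  have h2 : HasFDerivAt (fun y => G (v y)) (deriv G (v x) • fderiv ℝ v x) x :=
    (hG (v x)).hasDerivAt.comp_hasFDerivAt x hv.hasFDerivAt
  have h3 := ((h1.mul h2).const_mul c).neg
  rw [hev.fderiv_eq]
  have h4 := h3.fderiv
  change fderiv ℝ (fun y => -(c * (F (u y) * G (v y)))) x = _ at h4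
  rw [h4, ← toDual_gradient, ← toDual_gradient]
  simp
  ring

end Euclidean

theorem exists_lipschitzOnWith_fderivWithin_self_mul {N : ℕ} {u φ : EuclideanSpace ℝ (Fin N) → ℝ}
    (hu : ContDiffOn ℝ 2 u (closedBall 0 1)) (hφ : ∃ K, LipschitzOnWith K φ (closedBall 0 1)) :
    ∃ K, LipschitzOnWith K (fun x => fderivWithin ℝ u (closedBall 0 1) x x * φ x)
      (closedBall 0 1) := by
  have hc : ContDiffOn ℝ 1 (fun x => fderivWithin ℝ u (closedBall 0 1) x x)
      (closedBall (0 : EuclideanSpace ℝ (Fin N)) 1) :=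
    (hu.fderivWithin uniqueDiffOn_closedBall_zero_one (by norm_num)).clm_apply contDiffOn_id
  exact LipschitzOnWith.exists_mul (isCompact_closedBall 0 1)
    (hc.exists_lipschitzOnWith_of_isCompact (isCompact_closedBall 0 1) (convex_closedBall _ _)
      uniqueDiffOn_closedBall_zero_one) hφ

theorem fderivWithin_self_eq_inner_gradient {N : ℕ} (u : EuclideanSpace ℝ (Fin N) → ℝ)
    {x : EuclideanSpace ℝ (Fin N)} (hx : x ∈ ball 0 1) :
    fderivWithin ℝ u (closedBall 0 1) x x = ⟪gradient u x, x⟫ := by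
  rw [fderivWithin_of_mem_nhds (closedBall_mem_nhds_of_mem_ball hx), ← toDual_gradient,
    InnerProductSpace.toDual_apply_apply]

/-- The weighted stability inequality for radial semi-stable solutions of the gradient system
`(G)_{λ,γ}` on the unit ball: the nonlinearities disappear. -/
theorem stmt_16 {N : ℕ} (hN : 2 ≤ N)
    (lam gam : ℝ) (hlam : 0 < lam) (hgam : 0 < gam)
    (f g : ℝ → ℝ) (hf : ContDiff ℝ 3 f) (hg : ContDiff ℝ 3 g)
    (u v : EuclideanSpace ℝ (Fin N) → ℝ)
    (hurad : ∀ x y : EuclideanSpace ℝ (Fin N), ‖x‖ = ‖y‖ → u x = u y)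
    (hvrad : ∀ x y : EuclideanSpace ℝ (Fin N), ‖x‖ = ‖y‖ → v x = v y)
    (hu : ContDiffOn ℝ 3 u (Metric.closedBall 0 1))
    (hv : ContDiffOn ℝ 3 v (Metric.closedBall 0 1))
    (hubd : ∀ x : EuclideanSpace ℝ (Fin N), ‖x‖ = 1 → u x = 0)
    (hvbd : ∀ x : EuclideanSpace ℝ (Fin N), ‖x‖ = 1 → v x = 0)
    (hequ : ∀ x ∈ Metric.ball (0 : EuclideanSpace ℝ (Fin N)) 1,
      - lapl u x = lam * deriv f (u x) * g (v x))
    (heqv : ∀ x ∈ Metric.ball (0 : EuclideanSpace ℝ (Fin N)) 1,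
      - lapl v x = gam * f (u x) * deriv g (v x))
    (ur vr : EuclideanSpace ℝ (Fin N) → ℝ)
    (hur : ∀ x, ur x = ⟪gradient u x, x⟫ / ‖x‖)
    (hvr : ∀ x, vr x = ⟪gradient v x, x⟫ / ‖x‖)
    (hstab : ∀ φ ψ : EuclideanSpace ℝ (Fin N) → ℝ,
      (∃ K, LipschitzOnWith K φ (Metric.closedBall 0 1)) →
      (∃ K, LipschitzOnWith K ψ (Metric.closedBall 0 1)) →
      (∀ x : EuclideanSpace ℝ (Fin N), ‖x‖ = 1 → φ x = 0) →
      (∀ x : EuclideanSpace ℝ (Fin N), ‖x‖ = 1 → ψ x = 0) →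
      (∫ x in Metric.ball (0 : EuclideanSpace ℝ (Fin N)) 1,
          deriv (deriv f) (u x) * g (v x) * φ x ^ 2)
        + (∫ x in Metric.ball (0 : EuclideanSpace ℝ (Fin N)) 1,
            f (u x) * deriv (deriv g) (v x) * ψ x ^ 2)
        + 2 * ∫ x in Metric.ball (0 : EuclideanSpace ℝ (Fin N)) 1,
            deriv f (u x) * deriv g (v x) * φ x * ψ x
      ≤ (1 / lam) * (∫ x in Metric.ball (0 : EuclideanSpace ℝ (Fin N)) 1, ‖gradient φ x‖ ^ 2)
        + (1 / gam) * ∫ x in Metric.ball (0 : EuclideanSpace ℝ (Fin N)) 1, ‖gradient ψ x‖ ^ 2) :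
    ∀ φ : EuclideanSpace ℝ (Fin N) → ℝ,
      (∃ K, LipschitzOnWith K φ (Metric.closedBall 0 1)) →
      (∀ x : EuclideanSpace ℝ (Fin N), ‖x‖ = 1 → φ x = 0) →
      (N - 1 : ℝ) * ∫ x in Metric.ball (0 : EuclideanSpace ℝ (Fin N)) 1,
          (ur x ^ 2 / lam + vr x ^ 2 / gam) * φ x ^ 2
        ≤ ∫ x in Metric.ball (0 : EuclideanSpace ℝ (Fin N)) 1,
            (ur x ^ 2 / lam + vr x ^ 2 / gam) * ‖gradient (fun y => ‖y‖ * φ y) x‖ ^ 2 := by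
  intro φ hφ hφ0
  have hN0 : N ≠ 0 := by omega
  set Φ := fun x => fderivWithin ℝ u (closedBall 0 1) x x * φ x with hΦdef
  set Ψ := fun x => fderivWithin ℝ v (closedBall 0 1) x x * φ x with hΨdef
  have hΦL := exists_lipschitzOnWith_fderivWithin_self_mul (hu.of_le (by norm_num)) hφ
  have hΨL := exists_lipschitzOnWith_fderivWithin_self_mul (hv.of_le (by norm_num)) hφ
  have hΦ : ∀ x ∈ ball (0 : EuclideanSpace ℝ (Fin N)) 1, Φ x = ⟪gradient u x, x⟫ * φ x :=
    fun x hx => by rw [hΦdef, ← fderivWithin_self_eq_inner_gradient u hx]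
  have hΨ : ∀ x ∈ ball (0 : EuclideanSpace ℝ (Fin N)) 1, Ψ x = ⟪gradient v x, x⟫ * φ x :=
    fun x hx => by rw [hΨdef, ← fderivWithin_self_eq_inner_gradient v hx]
  have hst := hstab Φ Ψ hΦL hΨL (fun x hx => by simp [hΦdef, hφ0 x hx])
    fun x hx => by simp [hΨdef, hφ0 x hx]
  obtain ⟨hu1, hu2, hu3⟩ := second_variation_integral hN0 hurad hu hφ hφ0 hΦL hΦ
  obtain ⟨hv1, hv2, hv3⟩ := second_variation_integral hN0 hvrad hv hφ hφ0 hΨL hΨ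
  have huc := hu.continuousOn
  have hvc := hv.continuousOn
  have hΦc : ContinuousOn Φ (closedBall 0 1) := by obtain ⟨K, h⟩ := hΦL; exact h.continuousOn
  have hΨc : ContinuousOn Ψ (closedBall 0 1) := by obtain ⟨K, h⟩ := hΨL; exact h.continuousOn
  have hf' : ContDiff ℝ 2 (deriv f) := by
    rw [show (3 : WithTop ℕ∞) = 2 + 1 by norm_num] at hf
    exact (contDiff_succ_iff_deriv.1 hf).2.2
  have hg' : ContDiff ℝ 2 (deriv g) := by
    rw [show (3 : WithTop ℕ∞) = 2 + 1 by norm_num] at hg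
    exact (contDiff_succ_iff_deriv.1 hg).2.2
  have hf'' : Continuous (deriv (deriv f)) := hf'.continuous_deriv (by norm_num)
  have hg'' : Continuous (deriv (deriv g)) := hg'.continuous_deriv (by norm_num)
  have hA : IntegrableOn (fun x => deriv (deriv f) (u x) * g (v x) * Φ x ^ 2) (ball 0 1) :=
    (((hf''.comp_continuousOn huc).mul (hg.continuous.comp_continuousOn hvc)).mul
      (hΦc.pow 2)).integrableOn_ball
  have hB : IntegrableOn (fun x => f (u x) * deriv (deriv g) (v x) * Ψ x ^ 2) (ball 0 1) :=
    (((hf.continuous.comp_continuousOn huc).mul (hg''.comp_continuousOn hvc)).mul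
      (hΨc.pow 2)).integrableOn_ball
  have hC : IntegrableOn (fun x => deriv f (u x) * deriv g (v x) * Φ x * Ψ x) (ball 0 1) :=
    ((((hf'.continuous.comp_continuousOn huc).mul (hg'.continuous.comp_continuousOn hvc)).mul
      hΦc).mul hΨc).integrableOn_ball
  have hdu : ∀ x ∈ ball (0 : EuclideanSpace ℝ (Fin N)) 1, DifferentiableAt ℝ u x := fun x hx =>
    (hu.contDiffAt (closedBall_mem_nhds_of_mem_ball hx)).differentiableAt (by norm_num)
  have hdv : ∀ x ∈ ball (0 : EuclideanSpace ℝ (Fin N)) 1, DifferentiableAt ℝ v x := fun x hx =>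
    (hv.contDiffAt (closedBall_mem_nhds_of_mem_ball hx)).differentiableAt (by norm_num)
  have hDu : ∫ x in ball 0 1, fderiv ℝ (lapl u) x (gradient u x) * (‖x‖ * φ x) ^ 2 =
      -lam * ((∫ x in ball 0 1, deriv (deriv f) (u x) * g (v x) * Φ x ^ 2)
        + ∫ x in ball 0 1, deriv f (u x) * deriv g (v x) * Φ x * Ψ x) := by
    rw [← integral_add hA hC, ← integral_const_mul]
    refine setIntegral_congr_fun measurableSet_ball fun x hx => ?_
    rw [fderiv_lapl_of_eq_mul_comp (hf'.differentiable two_ne_zero)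
      (hg.differentiable (by norm_num)) hequ hx (hdu x hx) (hdv x hx), hΦ x hx, hΨ x hx]
    linear_combination
      (-lam * deriv (deriv f) (u x) * g (v x) * φ x ^ 2) *
        inner_gradient_mul_norm_sq_of_radial hurad (gradient u x) x
      + (-lam * deriv f (u x) * deriv g (v x) * φ x ^ 2) *
        inner_gradient_mul_norm_sq_of_radial hurad (gradient v x) x
  have hDv : ∫ x in ball 0 1, fderiv ℝ (lapl v) x (gradient v x) * (‖x‖ * φ x) ^ 2 =
      -gam * ((∫ x in ball 0 1, f (u x) * deriv (deriv g) (v x) * Ψ x ^ 2)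
        + ∫ x in ball 0 1, deriv f (u x) * deriv g (v x) * Φ x * Ψ x) := by
    rw [← integral_add hB hC, ← integral_const_mul]
    refine setIntegral_congr_fun measurableSet_ball fun x hx => ?_
    rw [fderiv_lapl_of_eq_mul_comp (hf.differentiable (by norm_num))
      (hg'.differentiable two_ne_zero) heqv hx (hdu x hx) (hdv x hx), hΦ x hx, hΨ x hx]
    linear_combination
      (-gam * deriv f (u x) * deriv g (v x) * φ x ^ 2) *
        inner_gradient_mul_norm_sq_of_radial hvrad (gradient u x) x
      + (-gam * f (u x) * deriv (deriv g) (v x) * φ x ^ 2) *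
        inner_gradient_mul_norm_sq_of_radial hvrad (gradient v x) x
  have hsplit : ∀ h : EuclideanSpace ℝ (Fin N) → ℝ,
      IntegrableOn (fun x => ‖gradient u x‖ ^ 2 * h x) (ball 0 1) →
      IntegrableOn (fun x => ‖gradient v x‖ ^ 2 * h x) (ball 0 1) →
      ∫ x in ball 0 1, (ur x ^ 2 / lam + vr x ^ 2 / gam) * h x =
        (1 / lam) * (∫ x in ball 0 1, ‖gradient u x‖ ^ 2 * h x)
          + (1 / gam) * ∫ x in ball 0 1, ‖gradient v x‖ ^ 2 * h x := by
    intro h h1 h2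
    rw [← integral_const_mul, ← integral_const_mul,
      ← integral_add (h1.const_mul _) (h2.const_mul _)]
    refine integral_congr_ae (Eventually.of_forall fun x => ?_)
    simp only [hur, hvr, inner_gradient_div_norm_sq_of_radial hurad,
      inner_gradient_div_norm_sq_of_radial hvrad]
    ring
  rw [hsplit _ hu1 hv1, hsplit _ hu2 hv2]
  rw [hDu] at hu3
  rw [hDv] at hv3
  rw [eq_sub_of_add_eq hu3, eq_sub_of_add_eq hv3] at hst
  have hl : 1 / lam * lam = 1 := one_div_mul_cancel hlam.ne'
  have hg1 : 1 / gam * gam = 1 := one_div_mul_cancel hgam.ne'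
  refine le_of_sub_nonneg ((sub_nonneg.2 hst).trans_eq ?_)
  linear_combination
    ((∫ x in ball 0 1, deriv (deriv f) (u x) * g (v x) * Φ x ^ 2)
        + ∫ x in ball 0 1, deriv f (u x) * deriv g (v x) * Φ x * Ψ x) * hl
    + ((∫ x in ball 0 1, f (u x) * deriv (deriv g) (v x) * Ψ x ^ 2)
        + ∫ x in ball 0 1, deriv f (u x) * deriv g (v x) * Φ x * Ψ x) * hg1
end

section
/- Let N be an integer with 3 ≤ N ≤ 9 and let λ, γ > 0. Let ũ, ṽ : (0,1] → ℝ be C¹ functions and let u(x) := ũ(|x|), v(x) := ṽ(|x|) be the corresponding radial functions on the open unit ball B₁ ⊂ ℝ^N, assumed to lie in H¹(B₁) (i.e. u, v and their gradients are square integrable on B₁). Suppose that for every Lipschitz function φ on the closed unit ball vanishing on ∂B₁ one has (N−1) ∫_{B₁} (u_r²/λ + v_r²/γ) φ² ≤ ∫_{B₁} (u_r²/λ + v_r²/γ) |∇(|x| φ)|², where u_r(x) = ũ'(|x|) and v_r(x) = ṽ'(|x|). Then there exists a constant C_N depending only on N such that for every r ∈ (0,1]: |ũ(r)|/√λ + |ṽ(r)|/√γ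 ≤ C_N ( ‖u‖_{H¹(B₁∖ closure(B_{1/2}))}/√λ + ‖v‖_{H¹(B₁∖ closure(B_{1/2}))}/√γ ), where ‖w‖_{H¹(A)} := ( ∫_A w² + |∇w|² )^{1/2}. -/
open MeasureTheory Real Set Filter Topology Metric

section Radial

variable {E : Type*} [NormedAddCommGroup E] [InnerProductSpace ℝ E]

/-- The gradient of a radial function has the size of the derivative of its profile. -/
theorem norm_gradient_comp_norm [CompleteSpace E] {f : ℝ → ℝ} {f' : ℝ} {x : E} (hx : x ≠ 0)
    (h : HasDerivAt f f' ‖x‖) : ‖gradient (fun y => f ‖y‖) x‖ = |f'| := by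
  have : Nontrivial E := ⟨x, 0, hx⟩
  have hd : DifferentiableAt ℝ (fun y : E => ‖y‖) x := differentiableAt_id.norm ℝ hx
  have hc : HasFDerivAt (fun y => f ‖y‖) (f' • fderiv ℝ (fun y : E => ‖y‖) x) x :=
    h.comp_hasFDerivAt x hd.hasFDerivAt
  rw [gradient, LinearIsometryEquiv.norm_map, hc.fderiv, norm_smul, norm_fderiv_norm hd,
    Real.norm_eq_abs, mul_one]

theorem lipschitzOnWith_mul_of_bounded {α : Type*} [PseudoMetricSpace α] {f g : α → ℝ} {s : Set α}
    {Kf Kg A B : NNReal} (hf : LipschitzOnWith Kf f s) (hg : LipschitzOnWith Kg g s)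
    (hA : ∀ x ∈ s, |f x| ≤ A) (hB : ∀ x ∈ s, |g x| ≤ B) :
    LipschitzOnWith (A * Kg + B * Kf) (fun x => f x * g x) s := by
  refine LipschitzOnWith.of_dist_le_mul fun x hx y hy => ?_
  have h1 := hf.dist_le_mul x hx y hy
  have h2 := hg.dist_le_mul x hx y hy
  rw [Real.dist_eq] at *
  have h3 : |f x * g x - f y * g y| ≤ |f x| * |g x - g y| + |g y| * |f x - f y| := by
    rw [← abs_mul, ← abs_mul]
    refine le_trans (le_of_eq ?_) (abs_add_le _ _)
    ring_nf
  have h4 := mul_le_mul (hA x hx) h2 (abs_nonneg _) A.coe_nonneg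
  have h5 := mul_le_mul (hB y hy) h1 (abs_nonneg _) B.coe_nonneg
  push_cast
  linarith

/-- The profile `s ^ (-p)`, truncated for `s ≤ a` and cut off linearly to zero on `[1/2, 1]`. -/
noncomputable def truncatedPower (a p s : ℝ) : ℝ :=
  (max a (min s (1 / 2))) ^ (-p) * min 1 (2 - 2 * s)

theorem truncatedPower_continuous {a p : ℝ} (ha : 0 < a) : Continuous (truncatedPower a p) := by
  unfold truncatedPower
  refine Continuous.mul (Continuous.rpow_const (by fun_prop) fun s => Or.inl ?_) (by fun_prop)
  exact (lt_max_of_lt_left ha).ne'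

theorem truncatedPower_of_lt {a p s : ℝ} (ha2 : a < 1 / 2) (hs : s < a) :
    truncatedPower a p s = a ^ (-p) := by
  rw [truncatedPower, min_eq_left (by linarith : s ≤ 1 / 2), max_eq_left hs.le,
    min_eq_left (by linarith), mul_one]

theorem truncatedPower_of_mem {a p s : ℝ} (hs : s ∈ Ioo a (1 / 2)) :
    truncatedPower a p s = s ^ (-p) := by
  rw [truncatedPower, min_eq_left hs.2.le, max_eq_right hs.1.le,
    min_eq_left (by linarith [hs.2]), mul_one]

theorem truncatedPower_of_gt {a p s : ℝ} (ha2 : a < 1 / 2) (hs : 1 / 2 < s) :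
    truncatedPower a p s = (1 / 2) ^ (-p) * (2 - 2 * s) := by
  rw [truncatedPower, min_eq_right hs.le, max_eq_right ha2.le, min_eq_right (by linarith)]

theorem truncatedPower_lipschitz {a p : ℝ} (ha : 0 < a) (ha2 : a < 1 / 2) :
    ∃ K, LipschitzOnWith K (truncatedPower a p) (Icc 0 1) := by
  obtain ⟨K, hK⟩ : ∃ K, LipschitzOnWith K (fun s : ℝ => s ^ (-p)) (Icc a (1 / 2)) := by
    refine ContDiffOn.exists_lipschitzOnWith (n := 1) (fun s hs => ?_) one_ne_zero
      (convex_Icc _ _) isCompact_Icc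
    exact (Real.contDiffAt_rpow_const (Or.inl (ha.trans_le hs.1).ne')).contDiffWithinAt
  have hc : LipschitzWith 1 (fun s : ℝ => max a (min s (1 / 2))) :=
    (LipschitzWith.id.min_const _).const_max _
  have hmaps : MapsTo (fun s : ℝ => max a (min s (1 / 2))) (Icc 0 1) (Icc a (1 / 2)) :=
    fun s _ => ⟨le_max_left _ _, max_le ha2.le (min_le_right _ _)⟩
  have h1 := hK.comp hc.lipschitzOnWith hmaps
  have h2 : LipschitzWith 2 (fun s : ℝ => min 1 (2 - 2 * s)) := by
    refine LipschitzWith.const_min ?_ 1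
    refine LipschitzWith.of_dist_le_mul fun x y => ?_
    rw [Real.dist_eq, Real.dist_eq, show 2 - 2 * x - (2 - 2 * y) = -(2 * (x - y)) by ring, abs_neg,
      abs_mul]
    norm_num
  obtain ⟨A, hA⟩ := (isCompact_Icc (a := (0 : ℝ)) (b := 1)).exists_bound_of_continuousOn
    h1.continuousOn
  obtain ⟨B, hB⟩ := (isCompact_Icc (a := (0 : ℝ)) (b := 1)).exists_bound_of_continuousOn
    h2.continuous.continuousOn
  exact ⟨_, lipschitzOnWith_mul_of_bounded (A := A.toNNReal) (B := B.toNNReal) h1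
    h2.lipschitzOnWith (fun x hx => (hA x hx).trans (Real.le_coe_toNNReal A))
    (fun x hx => (hB x hx).trans (Real.le_coe_toNNReal B))⟩

/-- Away from the two corners, the derivative of `s * truncatedPower a p s` is controlled by
`truncatedPower a p s`, with a gain in the middle region. -/
theorem exists_hasDerivAt_mul_truncatedPower {a p m s : ℝ} (ha : 0 < a) (ha2 : a < 1 / 2)
    (hm : 1 ≤ m) (hs0 : 0 < s) (hs1 : s < 1) (hsa : s ≠ a) (hs2 : s ≠ 1 / 2) :
    ∃ d, HasDerivAt (fun t => t * truncatedPower a p t) d s ∧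
      d ^ 2 ≤ m * truncatedPower a p s ^ 2
        + (Ioo (1 / 2) 1).indicator (fun _ => (4 * 4 ^ p : ℝ)) s
        - (Ioo a (1 / 2)).indicator (fun t => (m - (1 - p) ^ 2) * truncatedPower a p t ^ 2) s := by
  rcases lt_or_gt_of_ne hsa with h | h
  · refine ⟨a ^ (-p), ?_, ?_⟩
    · have h1 : HasDerivAt (fun t : ℝ => t * a ^ (-p)) (a ^ (-p)) s := by
        simpa using (hasDerivAt_id s).mul_const (a ^ (-p))
      refine h1.congr_of_eventuallyEq ?_
      filter_upwards [Iio_mem_nhds h] with t ht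
      rw [truncatedPower_of_lt ha2 ht]
    · rw [indicator_of_notMem (fun h' => by linarith [h'.1]),
        indicator_of_notMem (fun h' => by linarith [h'.1]), truncatedPower_of_lt ha2 h]
      nlinarith [sq_nonneg (a ^ (-p))]
  rcases lt_or_gt_of_ne hs2 with h2 | h2
  · refine ⟨(1 - p) * s ^ (-p), ?_, ?_⟩
    · have h1 : HasDerivAt (fun t : ℝ => t * t ^ (-p)) ((1 - p) * s ^ (-p)) s := by
        have := (hasDerivAt_id s).mul (Real.hasDerivAt_rpow_const (p := -p) (Or.inl hs0.ne'))
        refine this.congr_deriv ?_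
        rw [Real.rpow_sub_one hs0.ne', id]
        field_simp
        ring
      refine h1.congr_of_eventuallyEq ?_
      filter_upwards [Ioo_mem_nhds h h2] with t ht
      rw [truncatedPower_of_mem ht]
    · rw [indicator_of_notMem (fun h' => by linarith [h'.1]),
        indicator_of_mem (show s ∈ Ioo a (1 / 2) from ⟨h, h2⟩),
        truncatedPower_of_mem ⟨h, h2⟩]
      apply le_of_eq
      ring
  · refine ⟨(1 / 2) ^ (-p) * (2 - 4 * s), ?_, ?_⟩
    · have h1 : HasDerivAt (fun t : ℝ => t * ((1 / 2) ^ (-p) * (2 - 2 * t)))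
          ((1 / 2) ^ (-p) * (2 - 4 * s)) s := by
        have := (hasDerivAt_id s).mul
          ((((hasDerivAt_id s).const_mul 2).const_sub 2).const_mul ((1 / 2 : ℝ) ^ (-p)))
        refine this.congr_deriv ?_
        rw [id]
        ring
      refine h1.congr_of_eventuallyEq ?_
      filter_upwards [Ioi_mem_nhds h2] with t ht
      rw [truncatedPower_of_gt ha2 ht]
    · rw [indicator_of_mem (show s ∈ Ioo (1 / 2) 1 from ⟨h2, hs1⟩),
        indicator_of_notMem (fun h' => by linarith [h'.2])]
      have h4 : (4 : ℝ) ^ p = ((1 / 2 : ℝ) ^ (-p)) ^ 2 := by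
        rw [one_div, Real.inv_rpow (by norm_num), ← Real.rpow_neg (by norm_num), neg_neg, sq,
          ← Real.mul_rpow (by norm_num) (by norm_num)]
        norm_num
      have h5 : (2 - 4 * s) ^ 2 ≤ 4 := by nlinarith
      rw [h4, mul_pow]
      nlinarith [sq_nonneg ((1 / 2 : ℝ) ^ (-p)), sq_nonneg (truncatedPower a p s),
        mul_le_mul_of_nonneg_left h5 (sq_nonneg ((1 / 2 : ℝ) ^ (-p)))]

variable [FiniteDimensional ℝ E] [MeasurableSpace E] [BorelSpace E]

/-- Testing the stability inequality with a truncated power bounds a singular weighted integral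
over an inner annulus by the unweighted integral over the outer annulus. -/
theorem integral_inner_annulus_le_of_stability [Nontrivial E] {μ : Measure E} [μ.IsAddHaarMeasure]
    {w : ℝ → ℝ} {m p a : ℝ} (hw : ∀ s, 0 ≤ w s) (hm : 1 ≤ m)
    (hwint : IntegrableOn (fun x : E => w ‖x‖) (ball 0 1) μ) (ha : 0 < a) (ha2 : a < 1 / 2)
    (hstab : ∀ φ : E → ℝ, (∃ K, LipschitzOnWith K φ (closedBall 0 1)) →
      (∀ x : E, ‖x‖ = 1 → φ x = 0) →
      m * ∫ x in ball (0 : E) 1, w ‖x‖ * φ x ^ 2 ∂μ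
        ≤ ∫ x in ball (0 : E) 1, w ‖x‖ * ‖gradient (fun y => ‖y‖ * φ y) x‖ ^ 2 ∂μ) :
    (m - (1 - p) ^ 2) * ∫ x in norm ⁻¹' Ioo a (1 / 2), w ‖(x : E)‖ * (‖x‖ ^ (-p)) ^ 2 ∂μ
      ≤ 4 * 4 ^ p * ∫ x in norm ⁻¹' Ioo (1 / 2) 1, w ‖(x : E)‖ ∂μ := by
  set ψ := truncatedPower a p with hψ
  set κ := m - (1 - p) ^ 2 with hκ
  set O : Set E := norm ⁻¹' Ioo (1 / 2) 1 with hO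
  set M : Set E := norm ⁻¹' Ioo a (1 / 2) with hM
  have hOm : MeasurableSet O := measurableSet_Ioo.preimage measurable_norm
  have hMm : MeasurableSet M := measurableSet_Ioo.preimage measurable_norm
  have hOb : O ⊆ ball 0 1 := fun x hx => mem_ball_zero_iff.2 hx.2
  have hMb : M ⊆ ball 0 1 := fun x hx => mem_ball_zero_iff.2 (hx.2.trans (by norm_num))
  have hψc : Continuous ψ := truncatedPower_continuous ha
  have hs := hstab (fun x => ψ ‖x‖) (by
      obtain ⟨K, hK⟩ := truncatedPower_lipschitz (p := p) ha ha2
      exact ⟨_, hK.comp (lipschitzWith_one_norm.lipschitzOnWith (s := closedBall (0 : E) 1))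
        fun x hx => ⟨norm_nonneg x, mem_closedBall_zero_iff.1 hx⟩⟩) (by
      intro x hx
      rw [hx, hψ, truncatedPower_of_gt ha2 (by norm_num)]
      norm_num)
  have hi1 : IntegrableOn (fun x : E => w ‖x‖ * ψ ‖x‖ ^ 2) (ball 0 1) μ :=
    hwint.mul_continuousOn_of_subset ((hψc.comp continuous_norm).pow 2).continuousOn
      measurableSet_ball (isCompact_closedBall 0 1) ball_subset_closedBall
  have hi2 : IntegrableOn (O.indicator fun x : E => 4 * 4 ^ p * w ‖x‖) (ball 0 1) μ :=
    (hwint.const_mul _).indicator hOm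
  have hi3 : IntegrableOn (M.indicator fun x : E => κ * (w ‖x‖ * ψ ‖x‖ ^ 2)) (ball 0 1) μ :=
    (hi1.const_mul _).indicator hMm
  have hle : ∫ x in ball (0 : E) 1, w ‖x‖ * ‖gradient (fun y => ‖y‖ * ψ ‖y‖) x‖ ^ 2 ∂μ
      ≤ ∫ x in ball (0 : E) 1, (m * (w ‖x‖ * ψ ‖x‖ ^ 2)
        + O.indicator (fun x : E => 4 * 4 ^ p * w ‖x‖) x
        - M.indicator (fun x : E => κ * (w ‖x‖ * ψ ‖x‖ ^ 2)) x) ∂μ := by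
    refine integral_mono_of_nonneg (Eventually.of_forall fun x => mul_nonneg (hw _) (sq_nonneg _))
      (((hi1.const_mul m).add hi2).sub hi3) ?_
    have hsph : ∀ r : ℝ, ∀ᵐ x : E ∂(μ.restrict (ball 0 1)), ‖x‖ ≠ r := fun r => by
      refine ae_restrict_of_ae ?_
      have := Measure.addHaar_sphere μ (0 : E) r
      rw [ae_iff]
      convert this using 2
      ext x
      simp
    filter_upwards [hsph 0, hsph a, hsph (1 / 2), ae_restrict_mem measurableSet_ball]
      with x h0 hxa hx2 hx1
    rw [mem_ball_zero_iff] at hx1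
    obtain ⟨d, hd, hdle⟩ := exists_hasDerivAt_mul_truncatedPower (p := p) ha ha2 hm
      (lt_of_le_of_ne (norm_nonneg x) h0.symm) hx1 hxa hx2
    rw [norm_gradient_comp_norm (f := fun t => t * ψ t) (norm_ne_zero_iff.1 h0) hd, sq_abs]
    refine (mul_le_mul_of_nonneg_left hdle (hw _)).trans (le_of_eq ?_)
    by_cases h1 : x ∈ O <;> by_cases h2 : x ∈ M <;>
    · have h1' := h1
      have h2' := h2
      rw [hO, mem_preimage] at h1'
      rw [hM, mem_preimage] at h2'
      simp only [indicator, h1, h2, h1', h2', if_true, if_false]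
      ring
  rw [integral_sub (Integrable.fun_add (hi1.const_mul m) hi2) hi3, integral_add (hi1.const_mul m) hi2,
    integral_const_mul, setIntegral_indicator hOm, setIntegral_indicator hMm,
    inter_eq_self_of_subset_right hOb, inter_eq_self_of_subset_right hMb, integral_const_mul,
    integral_const_mul] at hle
  have hMψ : ∫ x in M, w ‖x‖ * ψ ‖x‖ ^ 2 ∂μ = ∫ x in M, w ‖x‖ * (‖x‖ ^ (-p)) ^ 2 ∂μ :=
    setIntegral_congr_fun hMm fun x hx => by
      simp only [hψ, truncatedPower_of_mem (p := p) (mem_preimage.1 hx)]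
  rw [hMψ] at hle
  linarith

/-- Polar coordinates for a radial function on an annulus. -/
theorem setIntegral_annulus_comp_norm [Nontrivial E] (μ : Measure E) [μ.IsAddHaarMeasure]
    (f : ℝ → ℝ) {a b : ℝ} (ha : 0 ≤ a) :
    ∫ x in norm ⁻¹' Ioo a b, f ‖(x : E)‖ ∂μ =
      Module.finrank ℝ E * μ.real (ball 0 1) *
        ∫ s in Ioo a b, s ^ (Module.finrank ℝ E - 1) * f s := by
  have h := integral_fun_norm_addHaar μ (E := E) ((Ioo a b).indicator f)
  have h1 : (fun x : E => (Ioo a b).indicator f ‖x‖)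
      = (norm ⁻¹' Ioo a b).indicator fun x => f ‖x‖ := rfl
  have h2 : (fun y : ℝ => y ^ (Module.finrank ℝ E - 1) • (Ioo a b).indicator f y)
      = (Ioo a b).indicator fun y => y ^ (Module.finrank ℝ E - 1) * f y := by
    ext y
    by_cases hy : y ∈ Ioo a b <;> simp [hy]
  have hsub : Ioo a b ⊆ Ioi 0 := fun y hy => ha.trans_lt hy.1
  rw [h1, integral_indicator (measurableSet_Ioo.preimage measurable_norm), h2,
    setIntegral_indicator measurableSet_Ioo,
    inter_eq_self_of_subset_right hsub] at h
  rw [h, nsmul_eq_mul, smul_eq_mul, mul_assoc]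

end Radial

section OneDim

/-- One-dimensional Sobolev bound on `[1/2, 1]`. -/
theorem sq_le_three_mul_integral_sq_add_sq {f D : ℝ → ℝ} {r : ℝ}
    (hf : ContinuousOn f (Icc (1 / 2) 1)) (hD : ContinuousOn D (Icc (1 / 2) 1))
    (hd : ∀ s ∈ Ioo (1 / 2) 1, HasDerivAt f (D s) s) (hr : r ∈ Icc (1 / 2 : ℝ) 1) :
    f r ^ 2 ≤ 3 * ∫ s in Ioo (1 / 2) 1, (f s ^ 2 + D s ^ 2) := by
  have hi : IntegrableOn (fun s => f s ^ 2 + D s ^ 2) (Ioo (1 / 2) 1) :=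
    (((hf.pow 2).add (hD.pow 2)).integrableOn_Icc).mono_set Ioo_subset_Icc_self
  obtain ⟨t, ht, hmin⟩ := isCompact_Icc.exists_isMinOn (nonempty_Icc.2 (by norm_num)) (hf.pow 2)
  have h1 : f t ^ 2 ≤ 2 * ∫ s in Ioo (1 / 2) 1, (f s ^ 2 + D s ^ 2) := by
    have h := setIntegral_mono_on (f := fun _ => f t ^ 2) (s := Ioo (1 / 2 : ℝ) 1) (μ := volume)
      (integrableOn_const (by simp)) hi measurableSet_Ioo fun s hs => by
        have := isMinOn_iff.1 hmin s (Ioo_subset_Icc_self hs)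
        simp only [Pi.pow_apply] at this
        nlinarith [sq_nonneg (D s)]
    rw [setIntegral_const, Real.volume_real_Ioo_of_le (by norm_num), smul_eq_mul] at h
    linarith
  have hsub : uIcc t r ⊆ Icc (1 / 2) 1 := uIcc_subset_Icc ht hr
  have h2 : ∫ s in t..r, 2 * f s * D s = f r ^ 2 - f t ^ 2 := by
    refine intervalIntegral.integral_eq_sub_of_hasDeriv_right (f := fun s => f s ^ 2)
      ((hf.mono hsub).pow 2) (fun s hs => ?_)
      ((((continuousOn_const.mul hf).mul hD).mono hsub).intervalIntegrable)
    have hs' : s ∈ Ioo (1 / 2 : ℝ) 1 :=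
      ⟨(le_min ht.1 hr.1).trans_lt hs.1, hs.2.trans_le (max_le ht.2 hr.2)⟩
    simpa using ((hd s hs').fun_pow 2).hasDerivWithinAt
  have h3 : ‖∫ s in t..r, 2 * f s * D s‖ ≤ ∫ s in Ioo (1 / 2) 1, (f s ^ 2 + D s ^ 2) := by
    refine intervalIntegral.norm_integral_le_integral_norm_uIoc.trans ?_
    rw [← integral_Icc_eq_integral_Ioo]
    have hi' := (integrableOn_Icc_iff_integrableOn_Ioo (by simp) (by simp)).2 hi
    have hu : uIoc t r ⊆ Icc (1 / 2) 1 := uIoc_subset_uIcc.trans hsub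
    refine (setIntegral_mono_on ?_ (hi'.mono_set hu) measurableSet_uIoc fun s _ => ?_).trans
      (setIntegral_mono_set hi' (Eventually.of_forall fun s => by positivity)
        (Eventually.of_forall hu))
    · exact (((continuousOn_const.mul hf).mul hD).norm.integrableOn_Icc).mono_set hu
    · rw [Real.norm_eq_abs, abs_le]
      constructor <;> nlinarith [sq_nonneg (f s + D s), sq_nonneg (f s - D s)]
  rw [h2, Real.norm_eq_abs] at h3
  linarith [le_abs_self (f r ^ 2 - f t ^ 2)]

/-- A weighted bound on the derivative controls the oscillation, since `s ^ (-1/2)` is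
integrable near the origin. -/
theorem abs_sub_le_of_integral_rpow_half_mul_sq_le {f D : ℝ → ℝ} {r A : ℝ} (hr : 0 < r)
    (hr2 : r < 1 / 2) (hf : ContinuousOn f (Icc r (1 / 2))) (hD : ContinuousOn D (Icc r (1 / 2)))
    (hd : ∀ s ∈ Ioo r (1 / 2), HasDerivAt f (D s) s) (hA : 0 ≤ A)
    (h : ∫ s in Ioo r (1 / 2), s ^ (1 / 2 : ℝ) * D s ^ 2 ≤ A ^ 2) :
    |f (1 / 2) - f r| ≤ 2 * A := by
  refine le_of_forall_pos_le_add fun ε hε => ?_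
  set B := A + ε / 2 with hB
  have hB0 : 0 < B := by positivity
  have hne : ∀ s ∈ Icc r (1 / 2 : ℝ), s ≠ 0 := fun s hs => (hr.trans_le hs.1).ne'
  have hw (q : ℝ) : ContinuousOn (fun s : ℝ => s ^ q) (Icc r (1 / 2)) :=
    continuousOn_id.rpow_const fun s hs => Or.inl (hne s hs)
  have hi1 : IntegrableOn (fun s : ℝ => s ^ (1 / 2 : ℝ) * D s ^ 2) (Ioo r (1 / 2)) :=
    ((hw _).mul (hD.pow 2)).integrableOn_Icc.mono_set Ioo_subset_Icc_self
  have hi2 : IntegrableOn (fun s : ℝ => s ^ (-(1 / 2) : ℝ)) (Ioo r (1 / 2)) :=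
    (hw _).integrableOn_Icc.mono_set Ioo_subset_Icc_self
  have h1 : ∫ s in r..(1 / 2), D s = f (1 / 2) - f r :=
    intervalIntegral.integral_eq_sub_of_hasDerivAt_of_le hr2.le hf hd
      ((hD.mono (uIcc_of_le hr2.le).subset).intervalIntegrable)
  have h2 : ∫ s in Ioo r (1 / 2), s ^ (-(1 / 2) : ℝ) ≤ 2 := by
    rw [← integral_Ioc_eq_integral_Ioo, ← intervalIntegral.integral_of_le hr2.le,
      integral_rpow (Or.inl (by norm_num))]
    have e1 : (1 / 2 : ℝ) ^ (-(1 / 2) + 1 : ℝ) ≤ 1 :=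
      Real.rpow_le_one (by norm_num) (by norm_num) (by norm_num)
    have e2 : 0 ≤ r ^ (-(1 / 2) + 1 : ℝ) := Real.rpow_nonneg hr.le _
    rw [div_le_iff₀ (by norm_num)]
    linarith
  have h3 : ‖∫ s in r..(1 / 2), D s‖
      ≤ ∫ s in Ioo r (1 / 2), (1 / (2 * B) * (s ^ (1 / 2 : ℝ) * D s ^ 2)
        + B / 2 * s ^ (-(1 / 2) : ℝ)) := by
    refine (intervalIntegral.norm_integral_le_integral_norm hr2.le).trans ?_
    rw [intervalIntegral.integral_of_le hr2.le, integral_Ioc_eq_integral_Ioo]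
    refine setIntegral_mono_on (hD.norm.integrableOn_Icc.mono_set Ioo_subset_Icc_self)
      ((hi1.const_mul _).add (hi2.const_mul _)) measurableSet_Ioo fun s hs => ?_
    have hs0 : 0 < s := hr.trans hs.1
    set q := s ^ (1 / 2 : ℝ) with hq
    have hq0 : 0 < q := Real.rpow_pos_of_pos hs0 _
    rw [Real.rpow_neg hs0.le, ← hq, Real.norm_eq_abs, ← sq_abs (D s)]
    have key : 1 / (2 * B) * (q * |D s| ^ 2) + B / 2 * q⁻¹ - |D s|
        = (q * |D s| - B) ^ 2 / (2 * B * q) := by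
      field_simp
      ring
    have : 0 ≤ (q * |D s| - B) ^ 2 / (2 * B * q) := by positivity
    linarith
  rw [integral_add (hi1.const_mul _) (hi2.const_mul _), integral_const_mul, integral_const_mul,
    h1, Real.norm_eq_abs] at h3
  have h4 : 1 / (2 * B) * ∫ s in Ioo r (1 / 2), s ^ (1 / 2 : ℝ) * D s ^ 2 ≤ B / 2 := by
    have hAB : A ^ 2 ≤ B ^ 2 := pow_le_pow_left₀ hA (by linarith) 2
    rw [one_div, inv_mul_le_iff₀ (by positivity)]
    nlinarith
  have h5 := mul_le_mul_of_nonneg_left h2 (show 0 ≤ B / 2 by positivity)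
  linarith

theorem hasDerivAt_deriv_of_contDiffOn_Ioc {f : ℝ → ℝ} (hf : ContDiffOn ℝ 1 f (Ioc 0 1)) {s : ℝ}
    (hs : s ∈ Ioo (0 : ℝ) 1) : HasDerivAt f (deriv f s) s :=
  ((hf.differentiableOn one_ne_zero s ⟨hs.1, hs.2.le⟩).differentiableAt
    (Ioc_mem_nhds hs.1 hs.2)).hasDerivAt

/-- Pointwise bound for a `C¹` function on `(0, 1]` from an unweighted `H¹` bound on `(1/2, 1)`
and a weighted bound on its derivative inside. -/
theorem abs_le_of_integral_bounds {f : ℝ → ℝ} {r A B : ℝ} (hf : ContDiffOn ℝ 1 f (Ioc 0 1))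
    (hr : r ∈ Ioc (0 : ℝ) 1) (hA : 0 ≤ A) (hB : 0 ≤ B)
    (hout : ∫ s in Ioo (1 / 2) 1, (f s ^ 2 + deriv f s ^ 2) ≤ B ^ 2)
    (hin : r < 1 / 2 → ∫ s in Ioo r (1 / 2), s ^ (1 / 2 : ℝ) * deriv f s ^ 2 ≤ A ^ 2) :
    |f r| ≤ 2 * A + 2 * B := by
  set D := derivWithin f (Ioc 0 1) with hDdef
  have hDc : ContinuousOn D (Ioc 0 1) :=
    hf.continuousOn_derivWithin (uniqueDiffOn_Ioc 0 1) le_rfl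
  have hDe : ∀ s ∈ Ioo (0 : ℝ) 1, D s = deriv f s := fun s hs =>
    derivWithin_of_mem_nhds (Ioc_mem_nhds hs.1 hs.2)
  have hd : ∀ s ∈ Ioo (0 : ℝ) 1, HasDerivAt f (D s) s := fun s hs => by
    rw [hDe s hs]
    exact hasDerivAt_deriv_of_contDiffOn_Ioc hf hs
  have hout' : ∀ t ∈ Icc (1 / 2 : ℝ) 1, |f t| ≤ 2 * B := fun t ht => by
    have hs1 : Icc (1 / 2 : ℝ) 1 ⊆ Ioc 0 1 := fun s hs => ⟨by linarith [hs.1], hs.2⟩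
    have hs2 : Ioo (1 / 2 : ℝ) 1 ⊆ Ioo 0 1 := fun s hs => ⟨by linarith [hs.1], hs.2⟩
    have h := sq_le_three_mul_integral_sq_add_sq (hf.continuousOn.mono hs1) (hDc.mono hs1)
      (fun s hs => hd s (hs2 hs)) ht
    rw [setIntegral_congr_fun (g := fun s => f s ^ 2 + deriv f s ^ 2) measurableSet_Ioo
      fun s hs => by simp only [hDe s (hs2 hs)]] at h
    refine abs_le_of_sq_le_sq ?_ (by positivity)
    nlinarith
  rcases le_or_gt (1 / 2) r with h | h
  · linarith [hout' r ⟨h, hr.2⟩]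
  · have hs1 : Icc r (1 / 2 : ℝ) ⊆ Ioc 0 1 :=
      fun s hs => ⟨hr.1.trans_le hs.1, by linarith [hs.2]⟩
    have hs2 : Ioo r (1 / 2 : ℝ) ⊆ Ioo 0 1 := fun s hs => ⟨hr.1.trans hs.1, by linarith [hs.2]⟩
    have h1 := abs_sub_le_of_integral_rpow_half_mul_sq_le hr.1 h (hf.continuousOn.mono hs1)
      (hDc.mono hs1) (fun s hs => hd s (hs2 hs)) hA (by
        rw [setIntegral_congr_fun (g := fun s => s ^ (1 / 2 : ℝ) * deriv f s ^ 2) measurableSet_Ioo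
          fun s hs => by simp only [hDe s (hs2 hs)]]
        exact hin h)
    have h2 := hout' (1 / 2) ⟨le_rfl, by norm_num⟩
    have h3 := abs_sub_abs_le_abs_sub (f r) (f (1 / 2))
    rw [abs_sub_comm] at h3
    linarith

end OneDim

section Annulus

variable {E : Type*} [NormedAddCommGroup E] [InnerProductSpace ℝ E] [FiniteDimensional ℝ E]

theorem norm_gradient_sq_of_radial {f : ℝ → ℝ} (hf : ContDiffOn ℝ 1 f (Ioc 0 1)) {u : E → ℝ}
    (hu : ∀ x, u x = f ‖x‖) {x : E} (hx0 : x ≠ 0) (hx1 : ‖x‖ < 1) :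
    ‖gradient u x‖ ^ 2 = deriv f ‖x‖ ^ 2 := by
  rw [funext hu, norm_gradient_comp_norm hx0
    (hasDerivAt_deriv_of_contDiffOn_Ioc hf ⟨norm_pos_iff.2 hx0, hx1⟩), sq_abs]

variable [MeasurableSpace E] [BorelSpace E]

theorem integrableOn_deriv_sq_of_radial [Nontrivial E] {μ : Measure E} [μ.IsAddHaarMeasure]
    {f : ℝ → ℝ} (hf : ContDiffOn ℝ 1 f (Ioc 0 1)) {u : E → ℝ} (hu : ∀ x, u x = f ‖x‖)
    (hi : IntegrableOn (fun x => ‖gradient u x‖ ^ 2) (ball 0 1) μ) :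
    IntegrableOn (fun x : E => deriv f ‖x‖ ^ 2) (ball 0 1) μ := by
  refine hi.congr ?_
  filter_upwards [ae_restrict_mem measurableSet_ball,
    ae_restrict_of_ae (compl_mem_ae_iff.2 (measure_singleton (0 : E)))] with x hx hx0
  exact norm_gradient_sq_of_radial hf hu hx0 (mem_ball_zero_iff.1 hx)

/-- The one-dimensional `H¹` integral on `(1/2, 1)` is controlled by the one on the annulus. -/
theorem integral_sq_add_deriv_sq_le_annulus [Nontrivial E] (μ : Measure E) [μ.IsAddHaarMeasure]
    {f : ℝ → ℝ} (hf : ContDiffOn ℝ 1 f (Ioc 0 1)) {u : E → ℝ} (hu : ∀ x, u x = f ‖x‖) :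
    Module.finrank ℝ E * μ.real (ball 0 1) * ∫ s in Ioo (1 / 2) 1, (f s ^ 2 + deriv f s ^ 2)
      ≤ 2 ^ (Module.finrank ℝ E - 1) *
        ∫ x in norm ⁻¹' Ioo (1 / 2) 1, (u x ^ 2 + ‖gradient u x‖ ^ 2) ∂μ := by
  set n := Module.finrank ℝ E - 1
  have h1 : ∫ x in norm ⁻¹' Ioo (1 / 2) 1, (u x ^ 2 + ‖gradient u x‖ ^ 2) ∂μ
      = ∫ x in norm ⁻¹' Ioo (1 / 2) 1, (fun s => f s ^ 2 + deriv f s ^ 2) ‖(x : E)‖ ∂μ := by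
    refine setIntegral_congr_fun (measurableSet_Ioo.preimage measurable_norm) fun x hx => ?_
    have hx' : ‖x‖ ∈ Ioo (1 / 2 : ℝ) 1 := hx
    simp only
    rw [norm_gradient_sq_of_radial hf hu (norm_pos_iff.1 (by linarith [hx'.1])) hx'.2, hu]
  rw [h1, setIntegral_annulus_comp_norm μ (fun s => f s ^ 2 + deriv f s ^ 2) (by norm_num),
    mul_left_comm]
  refine mul_le_mul_of_nonneg_left ?_ (by positivity)
  have hs1 : Icc (1 / 2 : ℝ) 1 ⊆ Ioc 0 1 := fun s hs => ⟨by linarith [hs.1], hs.2⟩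
  have hDc := (hf.continuousOn_derivWithin (uniqueDiffOn_Ioc 0 1) le_rfl).mono hs1
  have hi (g : ℝ → ℝ) (hg : Continuous g) :
      IntegrableOn (fun s => g s * (f s ^ 2 + deriv f s ^ 2)) (Ioo (1 / 2) 1) := by
    have h := ((hg.continuousOn.mul (((hf.continuousOn.mono hs1).pow 2).add
      (hDc.pow 2))).integrableOn_Icc (μ := volume)).mono_set Ioo_subset_Icc_self
    refine h.congr_fun (fun s hs => ?_) measurableSet_Ioo
    simp only [Pi.add_apply, Pi.pow_apply, Pi.mul_apply]
    rw [derivWithin_of_mem_nhds (Ioc_mem_nhds (by linarith [hs.1]) hs.2)]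
  rw [← integral_const_mul]
  refine setIntegral_mono_on (by simpa using hi (fun _ => 1) continuous_const)
    ((hi (fun s => s ^ n) (by fun_prop)).const_mul _) measurableSet_Ioo fun s hs => ?_
  rw [← mul_assoc, ← mul_pow]
  exact le_mul_of_one_le_left (by positivity) (one_le_pow₀ (by linarith [hs.1]))

end Annulus

/-- Uniform pointwise bound for radial functions satisfying the weighted stability
inequality on the unit ball of `ℝ^N`, `3 ≤ N ≤ 9`: the value at every radius is controlled,
with a constant depending only on `N`, by the `H¹` norms on the outer annulus. -/
theorem stmt_18 (N : ℕ) (hN3 : 3 ≤ N) (hN9 : N ≤ 9) :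
    ∃ C : ℝ, 0 < C ∧
      ∀ (lam gam : ℝ), 0 < lam → 0 < gam →
      ∀ (ut vt : ℝ → ℝ),
        ContDiffOn ℝ 1 ut (Set.Ioc 0 1) → ContDiffOn ℝ 1 vt (Set.Ioc 0 1) →
      ∀ (u v : EuclideanSpace ℝ (Fin N) → ℝ),
        (∀ x, u x = ut ‖x‖) → (∀ x, v x = vt ‖x‖) →
        IntegrableOn (fun x => u x ^ 2) (Metric.ball (0 : EuclideanSpace ℝ (Fin N)) 1) →
        IntegrableOn (fun x => ‖gradient u x‖ ^ 2)
          (Metric.ball (0 : EuclideanSpace ℝ (Fin N)) 1) →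
        IntegrableOn (fun x => v x ^ 2) (Metric.ball (0 : EuclideanSpace ℝ (Fin N)) 1) →
        IntegrableOn (fun x => ‖gradient v x‖ ^ 2)
          (Metric.ball (0 : EuclideanSpace ℝ (Fin N)) 1) →
        (∀ φ : EuclideanSpace ℝ (Fin N) → ℝ,
          (∃ K, LipschitzOnWith K φ (Metric.closedBall 0 1)) →
          (∀ x : EuclideanSpace ℝ (Fin N), ‖x‖ = 1 → φ x = 0) →
          (N - 1 : ℝ) * ∫ x in Metric.ball (0 : EuclideanSpace ℝ (Fin N)) 1,
              ((deriv ut ‖x‖) ^ 2 / lam + (deriv vt ‖x‖) ^ 2 / gam) * φ x ^ 2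
            ≤ ∫ x in Metric.ball (0 : EuclideanSpace ℝ (Fin N)) 1,
                ((deriv ut ‖x‖) ^ 2 / lam + (deriv vt ‖x‖) ^ 2 / gam)
                  * ‖gradient (fun y => ‖y‖ * φ y) x‖ ^ 2) →
        ∀ r ∈ Set.Ioc (0:ℝ) 1,
          |ut r| / Real.sqrt lam + |vt r| / Real.sqrt gam
            ≤ C * (Real.sqrt (∫ x in
                    Metric.ball (0 : EuclideanSpace ℝ (Fin N)) 1 \
                      Metric.closedBall (0 : EuclideanSpace ℝ (Fin N)) (1 / 2),
                    u x ^ 2 + ‖gradient u x‖ ^ 2) / Real.sqrt lam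
                + Real.sqrt (∫ x in
                    Metric.ball (0 : EuclideanSpace ℝ (Fin N)) 1 \
                      Metric.closedBall (0 : EuclideanSpace ℝ (Fin N)) (1 / 2),
                    v x ^ 2 + ‖gradient v x‖ ^ 2) / Real.sqrt gam) := by
  have hN3' : (3 : ℝ) ≤ N := by exact_mod_cast hN3
  have hN9' : (N : ℝ) ≤ 9 := by exact_mod_cast hN9
  have : Nontrivial (EuclideanSpace ℝ (Fin N)) :=
    Module.nontrivial_of_finrank_pos (R := ℝ) (by rw [finrank_euclideanSpace_fin]; omega)
  set c : ℝ := N * (volume : Measure (EuclideanSpace ℝ (Fin N))).real (ball 0 1) with hc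
  have hc0 : 0 < c :=
    mul_pos (by linarith) (ENNReal.toReal_pos (measure_ball_pos _ _ one_pos).ne'
      measure_ball_lt_top.ne)
  set p : ℝ := (2 * N - 3) / 4 with hp
  set κ : ℝ := (N - 1) - (1 - p) ^ 2 with hκ
  have hκ0 : 0 < κ := by
    rw [hκ, hp]
    nlinarith
  set L : ℝ := 4 * 4 ^ p with hL
  have hL0 : 0 < L := by positivity
  set α := Real.sqrt (L / (κ * c)) with hα
  set β := Real.sqrt (2 ^ (N - 1) / c) with hβ
  have hα0 : 0 < α := Real.sqrt_pos.2 (by positivity)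
  have hβ0 : 0 ≤ β := Real.sqrt_nonneg _
  refine ⟨4 * α + 2 * β, by positivity, ?_⟩
  intro lam gam hlam hgam ut vt hut hvt u v hu hv hu2 hui hv2 hvi hstab r hr
  have hann : ball (0 : EuclideanSpace ℝ (Fin N)) 1 \ closedBall 0 (1 / 2)
      = norm ⁻¹' Ioo (1 / 2) 1 := by
    ext x
    simp [and_comm]
  rw [hann]
  set O : Set (EuclideanSpace ℝ (Fin N)) := norm ⁻¹' Ioo (1 / 2) 1 with hO
  set IU := ∫ x in O, (u x ^ 2 + ‖gradient u x‖ ^ 2) with hIU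
  set IV := ∫ x in O, (v x ^ 2 + ‖gradient v x‖ ^ 2) with hIV
  have hIU0 : 0 ≤ IU := integral_nonneg fun x => by positivity
  have hIV0 : 0 ≤ IV := integral_nonneg fun x => by positivity
  set X := Real.sqrt IU / Real.sqrt lam + Real.sqrt IV / Real.sqrt gam with hX
  have hX0 : 0 ≤ X := by positivity
  have hXsq : IU / lam + IV / gam ≤ X ^ 2 := by
    have e1 : IU / lam = (Real.sqrt IU / Real.sqrt lam) ^ 2 := by
      rw [div_pow, Real.sq_sqrt hIU0, Real.sq_sqrt hlam.le]
    have e2 : IV / gam = (Real.sqrt IV / Real.sqrt gam) ^ 2 := by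
      rw [div_pow, Real.sq_sqrt hIV0, Real.sq_sqrt hgam.le]
    have e3 : 0 ≤ (Real.sqrt IU / Real.sqrt lam) * (Real.sqrt IV / Real.sqrt gam) := by positivity
    rw [e1, e2, hX]
    nlinarith
  set w : ℝ → ℝ := fun s => deriv ut s ^ 2 / lam + deriv vt s ^ 2 / gam with hw
  have hw0 : ∀ s, 0 ≤ w s := fun s => by positivity
  have hui' := integrableOn_deriv_sq_of_radial hut hu hui
  have hvi' := integrableOn_deriv_sq_of_radial hvt hv hvi
  have hwi : IntegrableOn (fun x : EuclideanSpace ℝ (Fin N) => w ‖x‖) (ball 0 1) :=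
    (hui'.div_const _).add (hvi'.div_const _)
  have hOb : O ⊆ ball 0 1 := fun x hx => mem_ball_zero_iff.2 hx.2
  have hOm : MeasurableSet O := measurableSet_Ioo.preimage measurable_norm
  have hout : ∫ x in O, w ‖x‖ ≤ IU / lam + IV / gam := by
    have hiU := IntegrableOn.mono_set (Integrable.fun_add hu2 hui) hOb
    have hiV := IntegrableOn.mono_set (Integrable.fun_add hv2 hvi) hOb
    rw [hIU, hIV, ← integral_div, ← integral_div,
      ← integral_add (hiU.div_const lam) (hiV.div_const gam)]
    refine setIntegral_mono_on (hwi.mono_set hOb) ((hiU.div_const lam).add (hiV.div_const gam))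
      hOm fun x hx => ?_
    have hx' : ‖x‖ ∈ Ioo (1 / 2 : ℝ) 1 := hx
    have hx0 : x ≠ 0 := norm_pos_iff.1 (by linarith [hx'.1])
    rw [norm_gradient_sq_of_radial hut hu hx0 hx'.2, norm_gradient_sq_of_radial hvt hv hx0 hx'.2]
    exact add_le_add
      (div_le_div_of_nonneg_right (le_add_of_nonneg_left (sq_nonneg _)) hlam.le)
      (div_le_div_of_nonneg_right (le_add_of_nonneg_left (sq_nonneg _)) hgam.le)
  have hin (hr2 : r < 1 / 2) :
      ∫ s in Ioo r (1 / 2), s ^ (1 / 2 : ℝ) * w s ≤ L / (κ * c) * X ^ 2 := by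
    have h := integral_inner_annulus_le_of_stability (E := EuclideanSpace ℝ (Fin N))
      (μ := volume) (m := (N - 1 : ℝ)) (p := p) hw0 (by linarith) hwi hr.1 hr2 hstab
    rw [setIntegral_annulus_comp_norm volume (fun s => w s * (s ^ (-p)) ^ 2) hr.1.le,
      finrank_euclideanSpace_fin, ← hc, ← hκ, ← hL] at h
    have e : ∫ s in Ioo r (1 / 2), s ^ (N - 1) * (w s * (s ^ (-p)) ^ 2)
        = ∫ s in Ioo r (1 / 2), s ^ (1 / 2 : ℝ) * w s := by
      refine setIntegral_congr_fun measurableSet_Ioo fun s hs => ?_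
      have hs0 : 0 < s := hr.1.trans hs.1
      have e1 : s ^ (1 / 2 : ℝ) = s ^ (N - 1) * (s ^ (-p)) ^ 2 := by
        rw [← Real.rpow_natCast s (N - 1), ← Real.rpow_mul_natCast hs0.le, ← Real.rpow_add hs0,
          Nat.cast_sub (by omega), hp]
        congr 1
        push_cast
        ring
      rw [e1]
      ring
    rw [e] at h
    rw [div_mul_eq_mul_div, le_div_iff₀ (by positivity)]
    have := mul_le_mul_of_nonneg_left (hout.trans hXsq) hL0.le
    linarith
  have bound {f : ℝ → ℝ} {l I : ℝ} {g : EuclideanSpace ℝ (Fin N) → ℝ}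
      (hf : ContDiffOn ℝ 1 f (Ioc 0 1)) (hg : ∀ x, g x = f ‖x‖) (hl : 0 < l)
      (hI : I = ∫ x in O, (g x ^ 2 + ‖gradient g x‖ ^ 2))
      (hfw : ∀ s, deriv f s ^ 2 / l ≤ w s) :
      |f r| / Real.sqrt l ≤ 2 * α * X + 2 * β * (Real.sqrt I / Real.sqrt l) := by
    have hI0 : 0 ≤ I := hI ▸ integral_nonneg fun x => by positivity
    have hl' : 0 < Real.sqrt l := Real.sqrt_pos.2 hl
    have h := abs_le_of_integral_bounds (A := Real.sqrt l * (α * X)) (B := β * Real.sqrt I) hf hr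
      (by positivity) (by positivity) ?_ ?_
    · rw [div_le_iff₀ hl']
      refine h.trans (le_of_eq ?_)
      field_simp
    · have h := integral_sq_add_deriv_sq_le_annulus volume hf hg
      rw [finrank_euclideanSpace_fin, ← hc, ← hO, ← hI] at h
      rw [mul_pow, Real.sq_sqrt hI0, hβ, Real.sq_sqrt (by positivity), div_mul_eq_mul_div,
        le_div_iff₀ hc0]
      linarith
    · intro hr2
      rw [mul_pow, mul_pow, Real.sq_sqrt hl.le, hα, Real.sq_sqrt (by positivity)]
      refine le_trans ?_ (mul_le_mul_of_nonneg_left (hin hr2) hl.le)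
      rw [← integral_const_mul]
      have hcd {k : ℝ → ℝ} (hk : ContDiffOn ℝ 1 k (Ioc 0 1)) :
          ContinuousOn (deriv k) (Icc r (1 / 2)) :=
        ((hk.mono Ioo_subset_Ioc_self).continuousOn_deriv_of_isOpen isOpen_Ioo le_rfl).mono
          fun s hs => ⟨hr.1.trans_le hs.1, by linarith [hs.2]⟩
      have hrp : ContinuousOn (fun s : ℝ => s ^ (1 / 2 : ℝ)) (Icc r (1 / 2)) :=
        continuousOn_id.rpow_const fun s hs => Or.inl (hr.1.trans_le hs.1).ne'
      have hwc : ContinuousOn w (Icc r (1 / 2)) :=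
        (((hcd hut).pow 2).div_const _).add (((hcd hvt).pow 2).div_const _)
      refine setIntegral_mono_on
        ((hrp.mul ((hcd hf).pow 2)).integrableOn_Icc.mono_set Ioo_subset_Icc_self)
        ((continuousOn_const.mul (hrp.mul hwc)).integrableOn_Icc.mono_set Ioo_subset_Icc_self)
        measurableSet_Ioo fun s hs => ?_
      have hs0 : 0 < s := hr.1.trans hs.1
      have h2 := hfw s
      rw [div_le_iff₀ hl] at h2
      have h3 := mul_le_mul_of_nonneg_left h2 (Real.rpow_nonneg hs0.le (1 / 2))
      linarith
  have hbu := bound hut hu hlam hIU fun s => le_add_of_nonneg_right (by positivity)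
  have hbv := bound hvt hv hgam hIV fun s => le_add_of_nonneg_left (by positivity)
  have : (4 * α + 2 * β) * X = 2 * α * X + 2 * β * (Real.sqrt IU / Real.sqrt lam)
      + (2 * α * X + 2 * β * (Real.sqrt IV / Real.sqrt gam)) := by
    rw [hX]
    ring
  rw [this]
  exact add_le_add hbu hbv
end
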